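/- arXiv:2105.02536 — 2 statements merged into one kernel-verified Lean document; each statement's English description precedes it below -/
import Mathlib

section
/- Kernel function identity: assume (m−n)κ = (r−s)δ, and let G₁, G₂ : ℂ → ℂ satisfy G₁(x+δ) = [x]·G₁(x) and G₂(x−κ) = [x]·G₂(x) for all x ∈ ℂ. Define Φ(x; y; X; Y) := ∏_{1≤i≤m, 1≤j≤n} G₁(x_i+X_j−κ)/G₁(x_i+X_j) · ∏_{1≤i≤r, 1≤j≤s} G₂(y_i+Y_j+δ)/G₂(y_i+Y_j) · ∏_{1≤i≤m, 1≤j≤s} [x_i+Y_j] · ∏_{1≤i≤r, 1≤j≤n} [y_i+X_j]. Then for every k ≥ 0 and every point (x, y, X, Y) ∈ ℂ^m × ℂ^r × ℂ^n × ℂ^s at which every bracket or G-value occurring in a denominator on either side is nonzero, (H_{m,r}^{(k)} acting on the variables (x; y) applied to Φ)(x; y; X; Y) = (H_{n,s}^{(k)} acting on the variables (X; Y) applied to Φ)(x; y; X; Y). -/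
open Finset

/-- Shifted factorial `[x; a]_k` for `k ∈ ℤ`:
`[x; a]_k = [x][x+a]⋯[x+(k-1)a]` for `k ≥ 0` and `[x; a]_{-k} = 1/[x-ka; a]_k`. -/
noncomputable def sfac (br : ℂ → ℂ) (a x : ℂ) (k : ℤ) : ℂ :=
  if 0 ≤ k then ∏ i ∈ Finset.range k.toNat, br (x + (i : ℂ) * a)
  else (∏ i ∈ Finset.range (-k).toNat, br (x + ((k : ℂ) + (i : ℂ)) * a))⁻¹

/-- The coefficient `C_{μ,I}(x; y; a, b)`. -/
noncomputable def Coef (br : ℂ → ℂ) (a b : ℂ) {m r : ℕ} (μ : Fin m → ℕ)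
    (I : Finset (Fin r)) (x : Fin m → ℂ) (y : Fin r → ℂ) : ℂ :=
  (-1 : ℂ) ^ I.card
    * (∏ i : Fin m, ∏ j : Fin m,
        if i < j then br (x i - x j + ((μ i : ℂ) - (μ j : ℂ)) * a) / br (x i - x j) else 1)
    * (∏ i ∈ I, ∏ j ∈ Iᶜ, br (y i - y j - a) / br (y i - y j))
    * (∏ i : Fin m, ∏ j : Fin m,
        sfac br a (x i - x j + b) (μ i : ℤ) / sfac br a (x i - x j + a) (μ i : ℤ))
    * ∏ i : Fin m,
        ((∏ j ∈ I, br (x i - y j - b) / br (x i - y j + (μ i : ℂ) * a))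
          * ∏ j ∈ Iᶜ, br (x i - y j - a) / br (x i - y j + ((μ i : ℂ) - 1) * a))

/-- Index set of the sums: pairs `(μ, I)` with `μ ∈ ℤ_{≥0}^m`, `I ⊆ {1,…,r}`, `|μ|+|I| = k`. -/
def idxSet (m r k : ℕ) : Finset ((Fin m → ℕ) × Finset (Fin r)) :=
  ((Fintype.piFinset fun _ : Fin m => Finset.range (k + 1)) ×ˢ
      (Finset.univ : Finset (Finset (Fin r)))).filter
    fun p => (∑ i, p.1 i) + p.2.card = k

def xshift (c : ℂ) {m : ℕ} (μ : Fin m → ℕ) (x : Fin m → ℂ) : Fin m → ℂ :=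
  fun i => x i + c * (μ i : ℂ)

def xshiftI (c : ℂ) {m : ℕ} (I : Finset (Fin m)) (x : Fin m → ℂ) : Fin m → ℂ :=
  fun i => x i + c * (if i ∈ I then 1 else 0)

def yshift (c : ℂ) {r : ℕ} (I : Finset (Fin r)) (y : Fin r → ℂ) : Fin r → ℂ :=
  fun j => y j - c * (if j ∈ I then 1 else 0)

def yshiftMu (c : ℂ) {r : ℕ} (μ : Fin r → ℕ) (y : Fin r → ℂ) : Fin r → ℂ :=
  fun j => y j - c * (μ j : ℂ)

/-- The deformed elliptic Ruijsenaars operator `H_{m,r}^{(k)}`. -/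
noncomputable def Hop (br : ℂ → ℂ) (δ κ : ℂ) (m r k : ℕ)
    (F : (Fin m → ℂ) → (Fin r → ℂ) → ℂ) (x : Fin m → ℂ) (y : Fin r → ℂ) : ℂ :=
  ∑ p ∈ idxSet m r k, Coef br δ κ p.1 p.2 x y * F (xshift δ p.1 x) (yshift κ p.2 y)

/-- The operator `D_{m,r}^{(k)}`. -/
noncomputable def Dop (br : ℂ → ℂ) (δ κ : ℂ) (m r k : ℕ)
    (F : (Fin m → ℂ) → (Fin r → ℂ) → ℂ) (x : Fin m → ℂ) (y : Fin r → ℂ) : ℂ :=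
  ∑ p ∈ idxSet r m k, Coef br (-κ) (-δ) p.1 p.2 y x * F (xshiftI δ p.2 x) (yshiftMu κ p.1 y)

/-- The operator `Ĥ_{m,r}^{(k)}`. -/
noncomputable def Hhat (br : ℂ → ℂ) (δ κ : ℂ) (m r k : ℕ)
    (F : (Fin m → ℂ) → (Fin r → ℂ) → ℂ) (x : Fin m → ℂ) (y : Fin r → ℂ) : ℂ :=
  ∑ p ∈ idxSet m r k,
    Coef br (-δ) (-κ) p.1 p.2 (fun i => x i - δ) (fun j => y j + κ)
      * F (xshift (-δ) p.1 x) (yshift (-κ) p.2 y)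

/-- The operator `D̂_{m,r}^{(k)}`. -/
noncomputable def Dhat (br : ℂ → ℂ) (δ κ : ℂ) (m r k : ℕ)
    (F : (Fin m → ℂ) → (Fin r → ℂ) → ℂ) (x : Fin m → ℂ) (y : Fin r → ℂ) : ℂ :=
  ∑ p ∈ idxSet r m k,
    Coef br κ δ p.1 p.2 (fun j => y j + κ) (fun i => x i - δ)
      * F (xshiftI (-δ) p.2 x) (yshiftMu (-κ) p.1 y)

/-- Nonvanishing of all bracket values occurring in denominators of `C_{μ,I}(x; y; a, b)`. -/
def CDenomNZ (br : ℂ → ℂ) (a : ℂ) {m r : ℕ} (μ : Fin m → ℕ)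
    (I : Finset (Fin r)) (x : Fin m → ℂ) (y : Fin r → ℂ) : Prop :=
  (∀ i j : Fin m, i < j → br (x i - x j) ≠ 0)
    ∧ (∀ i ∈ I, ∀ j ∈ Iᶜ, br (y i - y j) ≠ 0)
    ∧ (∀ i j : Fin m, sfac br a (x i - x j + a) (μ i : ℤ) ≠ 0)
    ∧ (∀ i : Fin m, ∀ j ∈ I, br (x i - y j + (μ i : ℂ) * a) ≠ 0)
    ∧ (∀ i : Fin m, ∀ j ∈ Iᶜ, br (x i - y j + ((μ i : ℂ) - 1) * a) ≠ 0)

/-- The kernel function `Φ(x; y; X; Y)`. -/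
noncomputable def Phi (br G₁ G₂ : ℂ → ℂ) (δ κ : ℂ) {m r n s : ℕ}
    (x : Fin m → ℂ) (y : Fin r → ℂ) (X : Fin n → ℂ) (Y : Fin s → ℂ) : ℂ :=
  (∏ i : Fin m, ∏ j : Fin n, G₁ (x i + X j - κ) / G₁ (x i + X j))
    * (∏ i : Fin r, ∏ j : Fin s, G₂ (y i + Y j + δ) / G₂ (y i + Y j))
    * (∏ i : Fin m, ∏ j : Fin s, br (x i + Y j))
    * ∏ i : Fin r, ∏ j : Fin n, br (y i + X j)

/-- A nonzero odd entire function satisfying the three-term addition formula. -/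
structure IsBracket (br : ℂ → ℂ) : Prop where
  odd : ∀ z : ℂ, br (-z) = -br z
  entire : Differentiable ℂ br
  ne_zero : br ≠ 0
  addition : ∀ a b c d : ℂ,
    br (a + b) * br (a - b) * br (c + d) * br (c - d)
      + br (a + d) * br (a - d) * br (b + c) * br (b - c)
      = br (a + c) * br (a - c) * br (b + d) * br (b - d)

section Bracket
variable {br : ℂ → ℂ}

/-- A nonzero entire function is nonzero on a residual set after a nonconstant affine change of
variable. -/
lemma residual_bracket_ne_zero (hb : IsBracket br) (c : ℂ) {d : ℂ}
    (hd : d ≠ 0) : ∀ᶠ ε in residual ℂ, br (c + d * ε) ≠ 0 := by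
  have hd' : Differentiable ℂ fun ε => br (c + d * ε) := hb.entire.comp (by fun_prop)
  refine residual_of_dense_open ?_ ?_
  · exact isOpen_ne_fun hd'.continuous continuous_const
  · rw [← compl_compl {ε | br (c + d * ε) ≠ 0}, ← interior_eq_empty_iff_dense_compl]
    by_contra hne
    obtain ⟨e, he⟩ := Set.nonempty_iff_ne_empty.mpr hne
    have hev : (fun ε => br (c + d * ε)) =ᶠ[nhds e] 0 := by
      filter_upwards [mem_interior_iff_mem_nhds.mp he] with t ht
      simpa using ht
    have h0 := AnalyticOnNhd.eqOn_zero_of_preconnected_of_eventuallyEq_zero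
      (fun z _ => hd'.analyticAt z) isPreconnected_univ (Set.mem_univ e) hev
    apply hb.ne_zero
    funext t
    have := h0 (Set.mem_univ ((t - c) / d))
    simpa [mul_div_cancel₀ _ hd] using this

lemma residual_forall_bracket_ne_zero (hb : IsBracket br) (δ p d : ℂ) (hd : d ≠ 0) :
    ∀ᶠ ε in residual ℂ, ∀ n : ℤ, br (p + d * ε + n * δ) ≠ 0 := by
  refine eventually_countable_forall.mpr fun n => ?_
  filter_upwards [residual_bracket_ne_zero hb (p + n * δ) hd] with ε hε
  rwa [add_right_comm] at hε

lemma bracket_zero (hb : IsBracket br) : br 0 = 0 := by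
  have := hb.odd 0
  simp only [neg_zero] at this
  exact self_eq_neg.mp this

/-- The shape of the addition formula used to interpolate a product of two brackets. -/
lemma bracket_interpolation (hb : IsBracket br) (t p₀ p₁ q₀ q₁ : ℂ) :
    br (t - q₀) * br (t - q₁) * (br (p₁ - p₀) * br (p₁ + p₀ - q₀ - q₁))
      = br (p₁ - q₀) * br (p₁ - q₁) * (br (t - p₀) * br (t - (q₀ + q₁ - p₀)))
        - br (p₀ - q₀) * br (p₀ - q₁) * (br (t - p₁) * br (t - (q₀ + q₁ - p₁))) := by
  have h := hb.addition (t - (q₀ + q₁) / 2) ((q₀ - q₁) / 2) (p₀ - (q₀ + q₁) / 2)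
      (p₁ - (q₀ + q₁) / 2)
  have e₁ := hb.odd (p₁ - p₀)
  have e₂ := hb.odd (p₀ - q₀)
  have e₃ := hb.odd (p₁ - q₀)
  ring_nf at h e₁ e₂ e₃ ⊢
  simp only [e₁, e₂, e₃] at h
  linear_combination -h

variable {ι : Type*} [DecidableEq ι]

lemma sum_partial_fraction_step (hb : IsBracket br)
    (s : Finset ι) (p : ι → ℂ) (i₀ i₁ : ι) (h₀ : i₀ ∈ s) (h₁ : i₁ ∈ s) (h₀₁ : i₁ ≠ i₀)
    (hp : ∀ i ∈ s, ∀ j ∈ s, i ≠ j → br (p i - p j) ≠ 0) (q₀ q₁ : ℂ) (Q : Multiset ℂ)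
    (hq : br (p i₁ + p i₀ - q₀ - q₁) ≠ 0)
    (ih : ∀ l ∈ s, ∑ i ∈ s.erase l,
      (((q₀ + q₁ - p l) ::ₘ Q).map fun q => br (p i - q)).prod
        / ∏ j ∈ (s.erase l).erase i, br (p i - p j) = 0) :
    ∑ i ∈ s, ((q₀ ::ₘ q₁ ::ₘ Q).map fun q => br (p i - q)).prod
      / ∏ j ∈ s.erase i, br (p i - p j) = 0 := by
  have h0 := bracket_zero hb
  have hne := mul_ne_zero (hp i₁ h₁ i₀ h₀ h₀₁) hq
  have key : ∀ l ∈ s, ∑ i ∈ s, br (p i - p l) *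
      ((((q₀ + q₁ - p l) ::ₘ Q).map fun q => br (p i - q)).prod
        / ∏ j ∈ s.erase i, br (p i - p j)) = 0 := by
    intro l hl
    rw [← ih l hl, ← Finset.add_sum_erase s _ hl]
    simp only [sub_self, h0, zero_mul, zero_add]
    refine Finset.sum_congr rfl fun i hi => ?_
    obtain ⟨hil, his⟩ := Finset.mem_erase.mp hi
    have hpl := hp i his l hl hil
    rw [← Finset.mul_prod_erase (s.erase i) (fun j => br (p i - p j))
      (Finset.mem_erase.mpr ⟨hil.symm, hl⟩), Finset.erase_right_comm]
    field_simp
  have k₀ := key i₀ h₀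
  have k₁ := key i₁ h₁
  have hsum : (br (p i₁ - p i₀) * br (p i₁ + p i₀ - q₀ - q₁)) *
      ∑ i ∈ s, ((q₀ ::ₘ q₁ ::ₘ Q).map fun q => br (p i - q)).prod
      / ∏ j ∈ s.erase i, br (p i - p j) = 0 := by
    have : (br (p i₁ - q₀) * br (p i₁ - q₁)) * 0 - (br (p i₀ - q₀) * br (p i₀ - q₁)) * 0
      = (0 : ℂ) := by ring
    rw [← this]
    nth_rewrite 1 [← k₀]
    rw [← k₁, Finset.mul_sum, Finset.mul_sum, Finset.mul_sum, ← Finset.sum_sub_distrib]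
    refine Finset.sum_congr rfl fun i _ => ?_
    simp only [Multiset.map_cons, Multiset.prod_cons]
    linear_combination ((Q.map fun q => br (p i - q)).prod / ∏ j ∈ s.erase i, br (p i - p j))
      * bracket_interpolation hb (p i) (p i₀) (p i₁) q₀ q₁
  exact (mul_eq_zero.mp hsum).resolve_left hne

lemma sum_partial_fraction_multiset (hb : IsBracket br)
    (p : ι → ℂ) (s : Finset ι) (Q : Multiset ℂ)
    (hcard : Q.card = s.card) (hsum : Q.sum = ∑ i ∈ s, p i)
    (hp : ∀ i ∈ s, ∀ j ∈ s, i ≠ j → br (p i - p j) ≠ 0) :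
    ∑ i ∈ s, (Q.map fun q => br (p i - q)).prod / ∏ j ∈ s.erase i, br (p i - p j) = 0 := by
  have h0 := bracket_zero hb
  induction hn : s.card generalizing s Q with
  | zero => simp [Finset.card_eq_zero.mp hn]
  | succ n IH =>
    rcases Nat.eq_zero_or_pos n with rfl | hpos
    · obtain ⟨i, rfl⟩ := Finset.card_eq_one.mp hn
      obtain ⟨q, rfl⟩ := Multiset.card_eq_one.mp (hcard.trans hn)
      simp only [Multiset.sum_singleton, Finset.sum_singleton] at hsum
      simp [hsum, h0]
    obtain ⟨i₁, h₁, i₀, h₀, h₀₁⟩ := Finset.one_lt_card.mp (by omega : 1 < s.card)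
    obtain ⟨q₀, hq₀⟩ := Multiset.card_pos_iff_exists_mem.mp (by omega : 0 < Q.card)
    obtain ⟨Q, rfl⟩ := Multiset.exists_cons_of_mem hq₀
    simp only [Multiset.card_cons] at hcard
    obtain ⟨q₁, hq₁⟩ := Multiset.card_pos_iff_exists_mem.mp (by omega : 0 < Q.card)
    obtain ⟨Q, rfl⟩ := Multiset.exists_cons_of_mem hq₁
    simp only [Multiset.card_cons, Multiset.sum_cons] at hcard hsum
    -- the induction step away from a degenerate position of the zeros
    have step : ∀ (r₀ r₁ : ℂ) (R : Multiset ℂ), R.card + 2 = s.card →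
        r₀ + (r₁ + R.sum) = ∑ i ∈ s, p i → br (p i₁ + p i₀ - r₀ - r₁) ≠ 0 →
        ∑ i ∈ s, ((r₀ ::ₘ r₁ ::ₘ R).map fun q => br (p i - q)).prod
          / ∏ j ∈ s.erase i, br (p i - p j) = 0 := by
      intro r₀ r₁ R hR hRs hne
      refine sum_partial_fraction_step hb s p i₀ i₁ h₀ h₁ h₀₁ hp r₀ r₁ R hne ?_
      intro l hl
      have hc := Finset.card_erase_of_mem hl
      refine IH (s.erase l) _ ?_ ?_ ?_ (by omega)
      · rw [Multiset.card_cons]; omega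
      · rw [Multiset.sum_cons]
        linear_combination hRs - Finset.add_sum_erase s p hl
      · exact fun i hi j hj => hp i (Finset.mem_of_mem_erase hi) j (Finset.mem_of_mem_erase hj)
    rcases Q.empty_or_exists_mem with rfl | ⟨q₂, hq₂⟩
    · have hs : s = {i₁, i₀} := by
        refine (Finset.eq_of_subset_of_card_le ?_ ?_).symm
        · simp [Finset.insert_subset_iff, h₁, h₀]
        · rw [Finset.card_pair h₀₁]; simp at hcard; omega
      subst hs
      rw [Finset.sum_pair h₀₁] at hsum ⊢
      have e₁ : ({i₁, i₀} : Finset ι).erase i₁ = {i₀} := by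
        rw [Finset.erase_insert (by simpa using h₀₁)]
      have e₀ : ({i₁, i₀} : Finset ι).erase i₀ = {i₁} := by
        rw [Finset.pair_comm, Finset.erase_insert (by simpa using h₀₁.symm)]
      rw [e₁, e₀]
      simp only [Multiset.map_cons, Multiset.prod_cons, Multiset.map_zero, Multiset.prod_zero,
        mul_one, Finset.prod_singleton, Multiset.sum_zero, add_zero] at hsum ⊢
      have a₁ : p i₁ - q₀ = -(p i₀ - q₁) := by linear_combination -hsum
      have a₂ : p i₁ - q₁ = -(p i₀ - q₀) := by linear_combination -hsum
      have a₃ : p i₁ - p i₀ = -(p i₀ - p i₁) := by ring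
      rw [a₁, a₂, a₃, hb.odd, hb.odd, hb.odd, div_neg]
      ring
    · obtain ⟨Q, rfl⟩ := Multiset.exists_cons_of_mem hq₂
      simp only [Multiset.card_cons, Multiset.sum_cons] at hcard hsum
      have hc : Continuous fun ε : ℂ => ∑ i ∈ s,
          (((q₀ + ε) ::ₘ q₁ ::ₘ (q₂ - ε) ::ₘ Q).map fun q => br (p i - q)).prod
          / ∏ j ∈ s.erase i, br (p i - p j) := by
        have := hb.entire.continuous
        simp only [Multiset.map_cons, Multiset.prod_cons]
        refine continuous_finsetSum _ fun i _ => Continuous.div_const ?_ _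
        fun_prop
      have hd : Dense {ε : ℂ | br ((p i₁ + p i₀ - q₀ - q₁) + (-1) * ε) ≠ 0} :=
        dense_of_mem_residual (residual_bracket_ne_zero hb _ (by norm_num))
      have := hc.ext_on hd continuous_const (g := fun _ => (0 : ℂ)) ?_
      · simpa using congrFun this 0
      · intro ε hε
        refine step (q₀ + ε) q₁ ((q₂ - ε) ::ₘ Q) ?_ ?_ ?_
        · rw [Multiset.card_cons]; omega
        · rw [Multiset.sum_cons]; linear_combination hsum
        · convert hε using 2; ring_nf

/-- Elliptic partial fractions: the residues of a balanced quotient of brackets add up to zero. -/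
lemma sum_partial_fraction [Fintype ι] (hb : IsBracket br)
    (p q : ι → ℂ) (hsum : ∑ i, q i = ∑ i, p i)
    (hp : ∀ i j, i ≠ j → br (p i - p j) ≠ 0) :
    ∑ i, (∏ j, br (p i - q j)) / ∏ j ∈ univ.erase i, br (p i - p j) = 0 := by
  have := sum_partial_fraction_multiset hb p univ (univ.val.map q)
    (by simp) (by simpa using hsum) (fun i _ j _ => hp i j)
  simpa [Multiset.map_map, Function.comp_def] using this

end Bracket

section Kajihara

/-- The shifted factorial `[x; δ]_n` for a natural number `n`. -/
noncomputable def risingBracket (br : ℂ → ℂ) (δ x : ℂ) (n : ℕ) : ℂ :=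
  ∏ t ∈ range n, br (x + (t : ℂ) * δ)

variable {br : ℂ → ℂ} {δ : ℂ}

@[simp] lemma risingBracket_zero (x : ℂ) : risingBracket br δ x 0 = 1 := by
  simp [risingBracket]

@[simp] lemma risingBracket_one (x : ℂ) : risingBracket br δ x 1 = br x := by
  simp [risingBracket]

lemma risingBracket_succ (x : ℂ) (n : ℕ) :
    risingBracket br δ x (n + 1) = risingBracket br δ x n * br (x + n * δ) := by
  simp [risingBracket, prod_range_succ]

lemma risingBracket_succ_left (x : ℂ) (n : ℕ) :
    risingBracket br δ x (n + 1) = br x * risingBracket br δ (x + δ) n := by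
  simp only [risingBracket, prod_range_succ', Nat.cast_add, Nat.cast_one, Nat.cast_zero, zero_mul,
    add_zero]
  rw [mul_comm]
  congr 1
  exact prod_congr rfl fun t _ => by ring_nf

lemma risingBracket_shift (x : ℂ) (n : ℕ) :
    br x * risingBracket br δ (x + δ) n = risingBracket br δ x n * br (x + n * δ) := by
  rw [← risingBracket_succ_left, risingBracket_succ]

lemma risingBracket_ne_zero {x : ℂ} {n : ℕ} (h : ∀ t : ℕ, t < n → br (x + t * δ) ≠ 0) :
    risingBracket br δ x n ≠ 0 :=
  prod_ne_zero_iff.mpr fun t ht => h t (mem_range.mp ht)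

variable {A B : Type*}

/-- The product `∏_{i,j} [z_i - c_j]_{μ_i}`. -/
noncomputable def risingProd [Fintype A] [Fintype B] (br : ℂ → ℂ) (δ : ℂ) (z : A → ℂ) (c : B → ℂ)
    (μ : A → ℕ) : ℂ :=
  ∏ i, ∏ j, risingBracket br δ (z i - c j) (μ i)

/-- Raising one index. -/
lemma risingProd_add_single [DecidableEq A] [Fintype A] [Fintype B] (z : A → ℂ) (c : B → ℂ)
    (μ : A → ℕ) (i : A) :
    risingProd br δ z c (μ + Pi.single i 1)
      = risingProd br δ z c μ * ∏ j, br (z i + μ i * δ - c j) := by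
  unfold risingProd
  rw [← mul_prod_erase univ _ (mem_univ i), ← mul_prod_erase univ (fun p => ∏ j, _) (mem_univ i)]
  have : ∏ p ∈ univ.erase i, ∏ j, risingBracket br δ (z p - c j) ((μ + Pi.single i 1 : A → ℕ) p)
      = ∏ p ∈ univ.erase i, ∏ j, risingBracket br δ (z p - c j) (μ p) :=
    prod_congr rfl fun p hp => by simp [Pi.single_eq_of_ne (ne_of_mem_erase hp)]
  rw [this]
  simp only [Pi.add_apply, Pi.single_eq_same, risingBracket_succ, prod_mul_distrib]
  have e : ∀ j, z i - c j + μ i * δ = z i + μ i * δ - c j := fun j => by ring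
  simp only [e]
  ring

/-- Raising one index together with a downward shift of the corresponding base point. -/
lemma risingProd_add_single_left [DecidableEq A] [Fintype A] [Fintype B] (z : A → ℂ) (c : B → ℂ)
    (μ : A → ℕ) (i : A) :
    risingProd br δ z c (μ + Pi.single i 1)
      = (∏ j, br (z i - c j)) * risingProd br δ (z + Pi.single i δ) c μ := by
  unfold risingProd
  rw [← mul_prod_erase univ _ (mem_univ i), ← mul_prod_erase univ (fun p => ∏ j, _) (mem_univ i)]
  have : ∏ p ∈ univ.erase i, ∏ j, risingBracket br δ (z p - c j) ((μ + Pi.single i 1 : A → ℕ) p)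
      = ∏ p ∈ univ.erase i, ∏ j,
          risingBracket br δ ((z + Pi.single i δ : A → ℂ) p - c j) (μ p) :=
    prod_congr rfl fun p hp => by
      simp [Pi.single_eq_of_ne (M := fun _ => ℂ) (ne_of_mem_erase hp),
        Pi.single_eq_of_ne (M := fun _ => ℕ) (ne_of_mem_erase hp)]
  rw [this]
  simp only [Pi.add_apply, Pi.single_eq_same, risingBracket_succ_left, prod_mul_distrib]
  have e : ∀ j, z i - c j + δ = z i + δ - c j := fun j => by ring
  simp only [e]
  ring

/-- Shifting one of the zeros. -/
lemma risingProd_shift [DecidableEq B] [Fintype A] [Fintype B] (z : A → ℂ) (c : B → ℂ) (μ : A → ℕ)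
    (o : B) :
    risingProd br δ z (c + Pi.single o δ) μ * ∏ i, br (z i + μ i * δ - c o - δ)
      = risingProd br δ z c μ * ∏ i, br (z i - c o - δ) := by
  unfold risingProd
  rw [← prod_mul_distrib, ← prod_mul_distrib]
  refine prod_congr rfl fun i _ => ?_
  rw [← mul_prod_erase univ _ (mem_univ o),
    ← mul_prod_erase univ (fun j => risingBracket br δ (z i - c j) (μ i)) (mem_univ o)]
  have : ∏ j ∈ univ.erase o, risingBracket br δ (z i - (c + Pi.single o δ : B → ℂ) j) (μ i)
      = ∏ j ∈ univ.erase o, risingBracket br δ (z i - c j) (μ i) :=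
    prod_congr rfl fun j hj => by simp [Pi.single_eq_of_ne (ne_of_mem_erase hj)]
  rw [this]
  have h := risingBracket_shift (br := br) (δ := δ) (z i - c o - δ) (μ i)
  have e₁ : z i - (c + Pi.single o δ : B → ℂ) o = z i - c o - δ := by simp; ring
  have e₂ : z i + μ i * δ - c o - δ = z i - c o - δ + μ i * δ := by ring
  rw [e₁, e₂]
  rw [sub_add_cancel] at h
  linear_combination -(∏ j ∈ univ.erase o, risingBracket br δ (z i - c j) (μ i)) * h

lemma risingProd_ne_zero [Fintype A] [Fintype B] {z : A → ℂ} {c : B → ℂ} {μ : A → ℕ}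
    (h : ∀ i j (t : ℕ), t < μ i → br (z i - c j + t * δ) ≠ 0) :
    risingProd br δ z c μ ≠ 0 :=
  prod_ne_zero_iff.mpr fun i _ => prod_ne_zero_iff.mpr fun j _ =>
    risingBracket_ne_zero fun t ht => h i j t ht

/-- The points `z + μ δ`. -/
def shiftBy (δ : ℂ) (z : A → ℂ) (μ : A → ℕ) : A → ℂ := fun i => z i + μ i * δ

lemma shiftBy_add_single [DecidableEq A] (z : A → ℂ) (μ : A → ℕ) (i : A) :
    shiftBy δ z (μ + Pi.single i 1) = shiftBy δ z μ + Pi.single i δ := by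
  funext p
  rcases eq_or_ne p i with rfl | h
  · simp [shiftBy]; ring
  · simp [shiftBy, h]

/-- The summand of the Kajihara–Noumi transformation, up to a sign depending on `|μ|` only.
The zeros attached to the poles `z` and `-Z` are `c` and `-u`. -/
noncomputable def kajiharaTerm [Fintype A] [Fintype B] (br : ℂ → ℂ) (δ : ℂ) (z c : A → ℂ)
    (Z u : B → ℂ) (μ : A → ℕ) : ℂ :=
  risingProd br δ z c μ * risingProd br δ z (-u) μ
    / (risingProd br δ z (shiftBy δ z μ) μ * risingProd br δ z (-Z) μ)

lemma kajiharaTerm_zero [Fintype A] [Fintype B] (z c : A → ℂ)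
    (Z u : B → ℂ) : kajiharaTerm br δ z c Z u 0 = 1 := by
  simp [kajiharaTerm, risingProd]

/-- Generic position of the poles, relative to steps `δ`. -/
structure GenericPoles (br : ℂ → ℂ) (δ : ℂ) (z : A → ℂ) (Z : B → ℂ) : Prop where
  step : ∀ n : ℤ, n ≠ 0 → br (n * δ) ≠ 0
  left : ∀ i j, i ≠ j → ∀ n : ℤ, br (z i - z j + n * δ) ≠ 0
  right : ∀ i j, i ≠ j → ∀ n : ℤ, br (Z i - Z j + n * δ) ≠ 0
  cross : ∀ i j, ∀ n : ℤ, br (z i + Z j + n * δ) ≠ 0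

lemma GenericPoles.symm {z : A → ℂ} {Z : B → ℂ} (h : GenericPoles br δ z Z) :
    GenericPoles br δ Z z :=
  ⟨h.step, h.right, h.left, fun i j n => by rw [add_comm (Z i)]; exact h.cross j i n⟩

lemma GenericPoles.shift_right [DecidableEq B] {z : A → ℂ} {Z : B → ℂ} (h : GenericPoles br δ z Z)
    (l : B) :
    GenericPoles br δ z (Z + Pi.single l δ) := by
  have e : ∀ j, ∃ m : ℤ, (Z + Pi.single l δ : B → ℂ) j = Z j + m * δ := fun j => by
    rcases eq_or_ne j l with rfl | hj
    · exact ⟨1, by simp⟩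
    · exact ⟨0, by simp [hj]⟩
  refine ⟨h.step, h.left, fun i j hij n => ?_, fun i j n => ?_⟩
  · obtain ⟨m, hm⟩ := e i
    obtain ⟨m', hm'⟩ := e j
    convert h.right i j hij (n + m - m') using 2
    rw [hm, hm']; push_cast; ring
  · obtain ⟨m, hm⟩ := e j
    convert h.cross i j (n + m) using 2
    rw [hm]; push_cast; ring

lemma GenericPoles.shiftBy_sub_ne_zero {z : A → ℂ} {Z : B → ℂ} (h : GenericPoles br δ z Z)
    (μ : A → ℕ) {i j : A} (hij : i ≠ j) (n : ℤ) :
    br (shiftBy δ z μ i - shiftBy δ z μ j + n * δ) ≠ 0 := by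
  convert h.left i j hij (n + μ i - μ j) using 2
  simp only [shiftBy]; push_cast; ring

lemma GenericPoles.risingProd_self_ne_zero [Fintype A] {z : A → ℂ} {Z : B → ℂ}
    (h : GenericPoles br δ z Z)
    (μ : A → ℕ) : risingProd br δ z (shiftBy δ z μ) μ ≠ 0 := by
  refine risingProd_ne_zero fun i j t ht => ?_
  rcases eq_or_ne i j with rfl | hij
  · convert h.step (t - μ i) (by omega) using 2
    simp only [shiftBy]; push_cast; ring
  · convert h.left i j hij (t - μ j) using 2
    simp only [shiftBy]; push_cast; ring

lemma GenericPoles.risingProd_cross_ne_zero [Fintype A] [Fintype B] {z : A → ℂ} {Z : B → ℂ}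
    (h : GenericPoles br δ z Z)
    (μ : A → ℕ) : risingProd br δ z (-Z) μ ≠ 0 := by
  refine risingProd_ne_zero fun i j t _ => ?_
  convert h.cross i j t using 2
  simp

/-- Summation over multi-indices of size `k + 1` with a marked nonzero entry. -/
lemma sum_piAntidiag_succ [DecidableEq A] [Fintype A] (k : ℕ) (f : (A → ℕ) → A → ℂ)
    (hf : ∀ μ i, μ i = 0 → f μ i = 0) :
    ∑ μ ∈ piAntidiag univ (k + 1), ∑ i, f μ i
      = ∑ μ ∈ piAntidiag univ k, ∑ i, f (μ + Pi.single i 1) i := by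
  rw [sum_comm, sum_comm (s := piAntidiag univ k)]
  refine sum_congr rfl fun i _ => ?_
  symm
  refine sum_of_injOn (fun μ => μ + Pi.single i 1) (fun μ _ ν _ h => add_right_cancel h) ?_ ?_ ?_
  · intro μ hμ
    simp only [mem_coe, mem_piAntidiag] at hμ ⊢
    refine ⟨?_, fun _ _ => mem_univ _⟩
    simp [sum_add_distrib, hμ.1]
  · intro μ hμ hn
    refine hf μ i (by_contra fun h0 => hn ?_)
    have hs : Pi.single i 1 ≤ μ := by
      intro p
      rcases eq_or_ne p i with rfl | hp
      · simpa using Nat.one_le_iff_ne_zero.mpr h0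
      · simp [hp]
    refine ⟨μ - Pi.single i 1, ?_, tsub_add_cancel_of_le hs⟩
    simp only [mem_coe, mem_piAntidiag, mem_univ, implies_true, and_true] at hμ ⊢
    have : ∑ p, ((μ - Pi.single i 1 : A → ℕ) p + (Pi.single i 1 : A → ℕ) p) = k + 1 := by
      rw [← hμ]
      exact sum_congr rfl fun p _ => congrFun (tsub_add_cancel_of_le hs) p
    simp only [sum_add_distrib, sum_pi_single', mem_univ, if_true] at this
    simpa using this
  · intro μ _; rfl

end Kajihara

section Transformation

lemma sum_shiftBy {δ : ℂ} {A : Type*} [Fintype A] (z : A → ℂ) (μ : A → ℕ) :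
    ∑ i, shiftBy δ z μ i = ∑ i, z i + (∑ i, μ i : ℕ) * δ := by
  simp [shiftBy, sum_add_distrib, sum_mul]

variable {br : ℂ → ℂ} {δ : ℂ} {A B : Type*} [Fintype A] [DecidableEq A]

lemma prod_erase_inl [Fintype B] [DecidableEq B] (f : A ⊕ B → ℂ) (i : A) :
    ∏ x ∈ univ.erase (Sum.inl i), f x
      = (∏ j ∈ univ.erase i, f (Sum.inl j)) * ∏ l, f (Sum.inr l) := by
  have e : (univ.erase (Sum.inl i) : Finset (A ⊕ B)) = (univ.erase i).disjSum univ := by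
    ext (x | x) <;> simp
  rw [e, prod_disjSum]

lemma prod_erase_inr [Fintype B] [DecidableEq B] (f : A ⊕ B → ℂ) (l : B) :
    ∏ x ∈ univ.erase (Sum.inr l), f x
      = (∏ j, f (Sum.inl j)) * ∏ t ∈ univ.erase l, f (Sum.inr t) := by
  have e : (univ.erase (Sum.inr l) : Finset (A ⊕ B)) = univ.disjSum (univ.erase l) := by
    ext (x | x) <;> simp
  rw [e, prod_disjSum]

lemma sum_partial_fraction_sum [Fintype B] [DecidableEq B] (hb : IsBracket br) (p q : A → ℂ)
    (p' q' : B → ℂ)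
    (hsum : ∑ i, q i + ∑ l, q' l = ∑ i, p i + ∑ l, p' l)
    (hp : ∀ i j, i ≠ j → br (p i - p j) ≠ 0) (hp' : ∀ i j, i ≠ j → br (p' i - p' j) ≠ 0)
    (hpp' : ∀ i l, br (p i - p' l) ≠ 0) :
    ∑ i, ((∏ j, br (p i - q j)) * ∏ l, br (p i - q' l))
        / ((∏ j ∈ univ.erase i, br (p i - p j)) * ∏ l, br (p i - p' l))
      + ∑ l, ((∏ j, br (p' l - q j)) * ∏ t, br (p' l - q' t))
        / ((∏ j, br (p' l - p j)) * ∏ t ∈ univ.erase l, br (p' l - p' t)) = 0 := by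
  have h := sum_partial_fraction hb (Sum.elim p p') (Sum.elim q q') (by simpa using hsum) (by
    rintro (i | i) (j | j) hij
    · exact hp i j fun h => hij (by rw [h])
    · exact hpp' i j
    · simp only [Sum.elim_inl, Sum.elim_inr]
      rw [← neg_sub, hb.odd]
      exact neg_ne_zero.mpr (hpp' j i)
    · exact hp' i j fun h => hij (by rw [h]))
  simpa only [Fintype.sum_sum_type, Fintype.prod_sum_type, prod_erase_inl, prod_erase_inr,
    Sum.elim_inl, Sum.elim_inr] using h

lemma sum_partial_fraction_point (hb : IsBracket br) (p q : A → ℂ) (v v' : ℂ)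
    (hsum : ∑ i, q i + v' = ∑ i, p i + v)
    (hp : ∀ i j, i ≠ j → br (p i - p j) ≠ 0) (hpv : ∀ i, br (p i - v) ≠ 0) :
    ∑ i, (∏ j, br (p i - q j)) / (∏ j ∈ univ.erase i, br (p i - p j))
        * (br (p i - v') / br (p i - v))
      + (∏ j, br (v - q j)) / (∏ j, br (v - p j)) * br (v - v') = 0 := by
  have h := sum_partial_fraction_sum hb p q (fun _ : Unit => v) (fun _ => v') (by simpa using hsum)
    hp (fun i j hij => absurd (Subsingleton.elim i j) hij) (fun i _ => hpv i)
  rw [div_mul_eq_mul_div]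
  simpa [mul_div_mul_comm] using h

lemma prod_bracket_neg (hb : IsBracket br) {ι : Type*} (s : Finset ι) (f g : ι → ℂ)
    (h : ∀ i, f i = -g i) : ∏ i ∈ s, br (f i) = (-1) ^ s.card * ∏ i ∈ s, br (g i) := by
  rw [← prod_const, ← prod_mul_distrib]
  exact prod_congr rfl fun i _ => by rw [h, hb.odd]; ring

/-- The coefficients of the recursion in the size of the multi-indices. -/
noncomputable def recursionCoeff {A B : Type*} [Fintype A] [Fintype B] [DecidableEq B] (br : ℂ → ℂ)
    (δ : ℂ) (z c : A → ℂ) (Z u : B → ℂ) (o : B) (k : ℕ)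
    (j : B) : ℂ :=
  -((∏ i, br (Z j + c i)) / ∏ i, br (Z j + z i))
    * ((∏ l, br (Z j - (u - Pi.single o (k * δ) : B → ℂ) l)) / ∏ l ∈ univ.erase j, br (Z j - Z l))

/-- The weights distributing `[(k+1)δ]` over the entries of a multi-index of size `k + 1`. -/
noncomputable def leftWeight (br : ℂ → ℂ) (δ : ℂ) (z : A → ℂ) (v : ℂ) (k : ℕ) (μ : A → ℕ) (i : A) :
    ℂ :=
  ((∏ j, br (v - shiftBy δ z μ j)) / ∏ j, br (v - z j))
    * ((∏ j, br (shiftBy δ z μ i - z j))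
      / ∏ j ∈ univ.erase i, br (shiftBy δ z μ i - shiftBy δ z μ j))
    * (br (shiftBy δ z μ i - (v + (k + 1 : ℕ) * δ)) / br (shiftBy δ z μ i - v))

lemma sum_leftWeight (hb : IsBracket br) {z : A → ℂ} {Z : B → ℂ} (hg : GenericPoles br δ z Z)
    {v : ℂ} (hv : ∀ i (n : ℤ), br (z i - v + n * δ) ≠ 0) {k : ℕ} {μ : A → ℕ}
    (hμ : ∑ i, μ i = k + 1) :
    ∑ i, leftWeight br δ z v k μ i = br ((k + 1 : ℕ) * δ) := by
  have hw : ∀ i, br (shiftBy δ z μ i - v) ≠ 0 := fun i => by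
    convert hv i (μ i) using 2
    simp only [shiftBy]; push_cast; ring
  have neg : ∀ {a b : ℂ}, br (a - b) ≠ 0 → br (b - a) ≠ 0 := fun {a b} h => by
    rw [← neg_sub, hb.odd]; exact neg_ne_zero.mpr h
  have h1 : ∏ j, br (v - shiftBy δ z μ j) ≠ 0 := prod_ne_zero_iff.mpr fun j _ => neg (hw j)
  have h2 : ∏ j, br (v - z j) ≠ 0 := prod_ne_zero_iff.mpr fun j _ => neg (by simpa using hv j 0)
  have h := sum_partial_fraction_point hb (shiftBy δ z μ) z v (v + (k + 1 : ℕ) * δ)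
    (by rw [sum_shiftBy, hμ]; ring)
    (fun i j hij => by simpa using hg.shiftBy_sub_ne_zero μ hij 0) hw
  have e : v - (v + (k + 1 : ℕ) * δ) = -((k + 1 : ℕ) * δ) := by ring
  rw [e, hb.odd] at h
  simp only [leftWeight, mul_assoc]
  rw [← mul_sum]
  rw [eq_neg_of_add_eq_zero_left h]
  field_simp

lemma leftWeight_eq_zero (hb : IsBracket br) (z : A → ℂ) (v : ℂ) (k : ℕ) (μ : A → ℕ) (i : A)
    (hi : μ i = 0) : leftWeight br δ z v k μ i = 0 := by
  have : ∏ j, br (shiftBy δ z μ i - z j) = 0 :=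
    prod_eq_zero (mem_univ i) (by simp [shiftBy, hi, bracket_zero hb])
  simp [leftWeight, this]

lemma kajiharaTerm_mul_leftWeight [Fintype B] [DecidableEq B] (hb : IsBracket br) {z c : A → ℂ}
    {Z u : B → ℂ}
    (hg : GenericPoles br δ z Z) (o : B) (ho : ∀ i (n : ℤ), br (z i + u o + n * δ) ≠ 0)
    (k : ℕ) (μ : A → ℕ) (i : A) :
    kajiharaTerm br δ z c Z u (μ + Pi.single i 1)
        * leftWeight br δ z (-u o) k (μ + Pi.single i 1) i
      = -(kajiharaTerm br δ z c Z u μ * ((∏ j, br (-u o - shiftBy δ z μ j)) / ∏ j, br (-u o - z j))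
        * (((∏ j, br (shiftBy δ z μ i - c j))
            * ∏ l, br (shiftBy δ z μ i - (-(u - Pi.single o (k * δ)) : B → ℂ) l))
          / ((∏ j ∈ univ.erase i, br (shiftBy δ z μ i - shiftBy δ z μ j))
            * ∏ l, br (shiftBy δ z μ i - (-Z) l)))) := by
  set w := shiftBy δ z μ with hw
  set v := -u o with hv
  have hwi : ∀ j, w j = z j + μ j * δ := fun j => rfl
  have hδ : br δ ≠ 0 := by simpa using hg.step 1 one_ne_zero
  have hwv : ∀ j (n : ℤ), br (w j - v + n * δ) ≠ 0 := fun j n => by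
    convert ho j (μ j + n) using 2
    rw [hwi, hv]; push_cast; ring
  have hwv0 : br (w i - v) ≠ 0 := by simpa using hwv i 0
  have hwv1 : br (w i + δ - v) ≠ 0 := by
    convert hwv i 1 using 2; push_cast; ring
  -- the self-interaction denominators
  set D := risingProd br δ z w μ
  set D' := risingProd br δ z (shiftBy δ z (μ + Pi.single i 1)) (μ + Pi.single i 1) with hD'
  set P₂ := ∏ p, br (w i + δ - z p)
  set P₃ := ∏ p ∈ univ.erase i, br (w i + δ - w p)
  set P₄ := ∏ p ∈ univ.erase i, br (w i - w p)
  have hD : D ≠ 0 := hg.risingProd_self_ne_zero μ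
  have hD'0 : D' ≠ 0 := hg.risingProd_self_ne_zero _
  have hP₃ : P₃ ≠ 0 := prod_ne_zero_iff.mpr fun p hp => by
    convert hg.shiftBy_sub_ne_zero μ (ne_of_mem_erase hp).symm 1 using 2
    push_cast; ring
  have hP₄ : P₄ ≠ 0 := prod_ne_zero_iff.mpr fun p hp => by
    simpa using hg.shiftBy_sub_ne_zero μ (ne_of_mem_erase hp).symm 0
  have hw' : shiftBy δ z (μ + Pi.single i 1) = w + Pi.single i δ := shiftBy_add_single z μ i
  have hw'i : (w + Pi.single i δ : A → ℂ) i = w i + δ := by simp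
  have hw'p : ∀ p ∈ univ.erase i, (w + Pi.single i δ : A → ℂ) p = w p := fun p hp => by
    simp [ne_of_mem_erase hp]
  have key : D' * P₃ = -(D * P₂ * P₄) := by
    have s := risingProd_shift (br := br) (δ := δ) z w μ i
    have r := risingProd_add_single (br := br) (δ := δ) z (w + Pi.single i δ) μ i
    rw [← hw', ← hD', hw', ← hwi] at r
    have e₁ : ∏ p, br (z p + μ p * δ - w i - δ)
        = (-1) ^ (univ : Finset A).card * (br δ * P₃) := by
      rw [prod_bracket_neg hb univ _ (fun p => w i + δ - w p) (fun p => by rw [hwi p]; ring),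
        ← mul_prod_erase univ _ (mem_univ i), add_sub_cancel_left]
    have e₂ : ∏ p, br (z p - w i - δ) = (-1) ^ (univ : Finset A).card * P₂ :=
      prod_bracket_neg hb univ _ _ (fun p => by ring)
    have e₃ : ∏ j, br (w i - (w + Pi.single i δ : A → ℂ) j) = -(br δ * P₄) := by
      rw [← mul_prod_erase univ _ (mem_univ i), hw'i, sub_add_cancel_left, hb.odd,
        prod_congr rfl fun p hp => by rw [hw'p p hp]]
      ring
    rw [e₁, e₂] at s
    rw [e₃] at r
    have hs : ((-1 : ℂ)) ^ (univ : Finset A).card ≠ 0 := pow_ne_zero _ (by norm_num)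
    have s' : risingProd br δ z (w + Pi.single i δ) μ * (br δ * P₃) = D * P₂ :=
      mul_left_cancel₀ hs (by linear_combination s)
    rw [r]
    linear_combination -P₄ * s'
  have hP₂ : P₂ ≠ 0 := fun h => by
    rw [h] at key
    simp [hD'0, hP₃] at key
  have hvz : ∏ j, br (v - z j) ≠ 0 := prod_ne_zero_iff.mpr fun j _ => by
    rw [← neg_sub, hb.odd]
    refine neg_ne_zero.mpr ?_
    convert ho j 0 using 2
    rw [hv]; push_cast; ring
  have f₁ : ∏ j, br (v - (w + Pi.single i δ : A → ℂ) j)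
      = -(br (w i + δ - v) * ∏ j ∈ univ.erase i, br (v - w j)) := by
    rw [← mul_prod_erase univ _ (mem_univ i), hw'i, ← neg_sub, hb.odd,
      prod_congr rfl fun p hp => by rw [hw'p p hp]]
    ring
  have f₂ : ∏ j, br (v - w j) = -(br (w i - v) * ∏ j ∈ univ.erase i, br (v - w j)) := by
    rw [← mul_prod_erase univ _ (mem_univ i), ← neg_sub, hb.odd]
    ring
  have f₃ : ∏ j ∈ univ.erase i, br (w i + δ - (w + Pi.single i δ : A → ℂ) j) = P₃ :=
    prod_congr rfl fun p hp => by rw [hw'p p hp]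
  have f₄ : ∏ l, br (w i - (-u) l)
      = br (w i - v) * ∏ l ∈ univ.erase o, br (w i - (-u) l) := by
    rw [← mul_prod_erase univ _ (mem_univ o)]; rfl
  have f₅ : ∏ l, br (w i - (-(u - Pi.single o (k * δ)) : B → ℂ) l)
      = br (w i - v - k * δ) * ∏ l ∈ univ.erase o, br (w i - (-u) l) := by
    rw [← mul_prod_erase univ _ (mem_univ o)]
    congr 1
    · simp [hv]; ring_nf
    · exact prod_congr rfl fun l hl => by simp [ne_of_mem_erase hl]
  have f₆ : w i + δ - (v + (k + 1 : ℕ) * δ) = w i - v - k * δ := by push_cast; ring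
  have hZ : risingProd br δ z (-Z) μ ≠ 0 := hg.risingProd_cross_ne_zero μ
  have hPZ : ∏ l, br (w i - (-Z) l) ≠ 0 := prod_ne_zero_iff.mpr fun l _ => by
    convert hg.cross i l (μ i) using 2
    simp [hwi]; ring
  unfold kajiharaTerm leftWeight
  rw [← hD', risingProd_add_single, risingProd_add_single, risingProd_add_single, ← hwi, hw', hw'i,
    f₁, f₂, f₃, f₄, f₅, f₆]
  have hD'e : D' = -(D * P₂ * P₄) / P₃ := by rw [← key]; field_simp
  change _ * _ / (_ * _) * (_ * (P₂ / P₃) * _) = _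
  rw [hD'e]
  change _ = -(_ / (D * _) * _ * (_ / (P₄ * _)))
  field_simp

end Transformation

section Recursion
variable {br : ℂ → ℂ} {δ : ℂ} {A B : Type*} [Fintype A] [Fintype B] [DecidableEq B]

lemma kajiharaTerm_shift (hb : IsBracket br) {z c : A → ℂ} {Z u : B → ℂ}
    (hg : GenericPoles br δ z Z) (o : B) (ho : ∀ i (n : ℤ), br (z i + u o + n * δ) ≠ 0)
    (μ : A → ℕ) (l : B) :
    kajiharaTerm br δ z c (Z + Pi.single l δ) (u + Pi.single o δ) μ
      = kajiharaTerm br δ z c Z u μ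
        * ((∏ i, br (-u o - shiftBy δ z μ i)) / ∏ i, br (-u o - z i))
        * ((∏ i, br (Z l + z i)) / ∏ i, br (Z l + shiftBy δ z μ i)) := by
  have hs : ((-1 : ℂ)) ^ (univ : Finset A).card ≠ 0 := pow_ne_zero _ (by norm_num)
  have back : ∀ (f : B → ℂ) (t : B), -(f + Pi.single t δ) + Pi.single t δ = -f := fun f t => by
    rw [neg_add, add_assoc, neg_add_cancel, add_zero]
  have hZ := hg.risingProd_cross_ne_zero μ
  have hZ' := (hg.shift_right l).risingProd_cross_ne_zero μ
  have hvz : ∏ i, br (-u o - z i) ≠ 0 := prod_ne_zero_iff.mpr fun j _ => by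
    rw [show -u o - z j = -(z j + u o) by ring, hb.odd]
    simpa using ho j 0
  have hZw : ∏ i, br (Z l + shiftBy δ z μ i) ≠ 0 := prod_ne_zero_iff.mpr fun i _ => by
    convert hg.cross i l (μ i) using 2
    simp only [shiftBy]; push_cast; ring
  have s₁ := risingProd_shift (br := br) (δ := δ) z (-(u + Pi.single o δ)) μ o
  have s₂ := risingProd_shift (br := br) (δ := δ) z (-(Z + Pi.single l δ)) μ l
  rw [back] at s₁ s₂
  have e₁ : ∏ i, br (z i + μ i * δ - (-(u + Pi.single o δ) : B → ℂ) o - δ)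
      = (-1) ^ (univ : Finset A).card * ∏ i, br (-u o - shiftBy δ z μ i) :=
    prod_bracket_neg hb univ _ _ fun i => by simp [shiftBy]; ring
  have e₂ : ∏ i, br (z i - (-(u + Pi.single o δ) : B → ℂ) o - δ)
      = (-1) ^ (univ : Finset A).card * ∏ i, br (-u o - z i) :=
    prod_bracket_neg hb univ _ _ fun i => by simp; ring
  have e₃ : ∏ i, br (z i + μ i * δ - (-(Z + Pi.single l δ) : B → ℂ) l - δ)
      = ∏ i, br (Z l + shiftBy δ z μ i) :=
    prod_congr rfl fun i _ => by simp [shiftBy]; ring_nf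
  have e₄ : ∏ i, br (z i - (-(Z + Pi.single l δ) : B → ℂ) l - δ) = ∏ i, br (Z l + z i) :=
    prod_congr rfl fun i _ => by simp; ring_nf
  rw [e₁, e₂] at s₁
  rw [e₃, e₄] at s₂
  have s₁' : risingProd br δ z (-u) μ * ∏ i, br (-u o - shiftBy δ z μ i)
      = risingProd br δ z (-(u + Pi.single o δ)) μ * ∏ i, br (-u o - z i) :=
    mul_left_cancel₀ hs (by linear_combination s₁)
  have hD := hg.risingProd_self_ne_zero μ
  unfold kajiharaTerm
  rw [div_mul_div_comm, div_mul_div_comm, div_eq_div_iff (mul_ne_zero hD hZ')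
    (mul_ne_zero (mul_ne_zero (mul_ne_zero hD hZ) hvz) hZw)]
  linear_combination (risingProd br δ z c μ * risingProd br δ z (shiftBy δ z μ) μ)
    * (risingProd br δ z (-(u + Pi.single o δ)) μ * (∏ i, br (-u o - z i)) * s₂
      - risingProd br δ z (-(Z + Pi.single l δ)) μ * (∏ i, br (Z l + z i)) * s₁')

lemma sum_kajiharaTerm_succ_left [DecidableEq A] (hb : IsBracket br) {z c : A → ℂ} {Z u : B → ℂ}
    (hg : GenericPoles br δ z Z) (hbal : ∑ i, z i - ∑ i, c i = ∑ l, Z l - ∑ l, u l)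
    (o : B) (ho : ∀ i (n : ℤ), br (z i + u o + n * δ) ≠ 0) (k : ℕ) :
    br ((k + 1 : ℕ) * δ) * ∑ μ ∈ piAntidiag univ (k + 1), kajiharaTerm br δ z c Z u μ
      = ∑ l, recursionCoeff br δ z c Z u o k l * ∑ μ ∈ piAntidiag univ k,
          kajiharaTerm br δ z c (Z + Pi.single l δ) (u + Pi.single o δ) μ := by
  have h₁ : br ((k + 1 : ℕ) * δ) * ∑ μ ∈ piAntidiag univ (k + 1), kajiharaTerm br δ z c Z u μ
      = ∑ μ ∈ piAntidiag univ (k + 1), ∑ i,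
          kajiharaTerm br δ z c Z u μ * leftWeight br δ z (-u o) k μ i := by
    rw [mul_sum]
    refine sum_congr rfl fun μ hμ => ?_
    rw [← mul_sum, sum_leftWeight hb hg (fun i n => by simpa using ho i n)
      (mem_piAntidiag.mp hμ).1, mul_comm]
  rw [h₁, sum_piAntidiag_succ k _ fun μ i hi => by rw
      [leftWeight_eq_zero hb _ _ _ _ _ hi, mul_zero]]
  simp only [mul_sum]
  rw [sum_comm (s := univ)]
  refine sum_congr rfl fun μ hμ => ?_
  simp only [kajiharaTerm_mul_leftWeight hb hg o ho, kajiharaTerm_shift hb hg o ho]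
  set w := shiftBy δ z μ with hw
  have hZw : ∀ i l, br (w i - (-Z) l) ≠ 0 := fun i l => by
    convert hg.cross i l (μ i) using 2
    simp only [hw, shiftBy, Pi.neg_apply]; push_cast; ring
  have hpf := sum_partial_fraction_sum hb w c (-Z) (-(u - Pi.single o (k * δ)))
    (by
      rw [hw, sum_shiftBy, (mem_piAntidiag.mp hμ).1]
      simp only [Pi.neg_apply, Pi.sub_apply, sum_neg_distrib, sum_sub_distrib, sum_pi_single',
        mem_univ, if_true]
      linear_combination -hbal)
    (fun i j hij => by simpa using hg.shiftBy_sub_ne_zero μ hij 0)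
    (fun i j hij => by
      convert hg.right j i hij.symm 0 using 2
      simp only [Pi.neg_apply]; push_cast; ring) hZw
  rw [sum_neg_distrib, ← mul_sum, eq_neg_of_add_eq_zero_left hpf, mul_neg, neg_neg, mul_sum]
  refine sum_congr rfl fun l _ => ?_
  have e₁ : ∏ j, br ((-Z) l - c j) = (-1) ^ (univ : Finset A).card * ∏ j, br (Z l + c j) :=
    prod_bracket_neg hb univ _ _ fun j => by simp; ring
  have e₂ : ∏ t, br ((-Z) l - (-(u - Pi.single o (k * δ)) : B → ℂ) t)
      = -((-1) ^ (univ.erase l : Finset B).card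
        * ∏ t, br (Z l - (u - Pi.single o (k * δ) : B → ℂ) t)) := by
    rw [prod_bracket_neg hb univ _ (fun t => Z l - (u - Pi.single o (k * δ) : B → ℂ) t)
      fun t => by simp; ring, ← card_erase_add_one (mem_univ l), pow_succ]
    ring
  have e₃ : ∏ j, br ((-Z) l - w j) = (-1) ^ (univ : Finset A).card * ∏ j, br (Z l + w j) :=
    prod_bracket_neg hb univ _ _ fun j => by simp; ring
  have e₄ : ∏ t ∈ univ.erase l, br ((-Z) l - (-Z) t)
      = (-1) ^ (univ.erase l : Finset B).card * ∏ t ∈ univ.erase l, br (Z l - Z t) :=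
    prod_bracket_neg hb _ _ _ fun j => by simp; ring
  have hzz : ∏ i, br (Z l + z i) ≠ 0 := prod_ne_zero_iff.mpr fun i _ => by
    convert hg.cross i l 0 using 2
    push_cast; ring
  have hs : ∀ n : ℕ, ((-1 : ℂ)) ^ n ≠ 0 := fun n => pow_ne_zero _ (by norm_num)
  have hsA := hs (univ : Finset A).card
  have hsB := hs (univ.erase l : Finset B).card
  rw [e₁, e₂, e₃, e₄, recursionCoeff]
  generalize (-1 : ℂ) ^ (univ : Finset A).card = sA at *
  generalize (-1 : ℂ) ^ (univ.erase l : Finset B).card = sB at *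
  field_simp

end Recursion

section RightRecursion

lemma shiftBy_single_left {δ : ℂ} {B : Type*} [DecidableEq B] (Z : B → ℂ) (ν : B → ℕ) (j : B) :
    shiftBy δ (Z + Pi.single j δ) ν = shiftBy δ Z (ν + Pi.single j 1) := by
  rw [shiftBy_add_single]
  funext l
  simp only [shiftBy, Pi.add_apply]
  ring

variable {br : ℂ → ℂ} {δ : ℂ} {A B : Type*} [Fintype B] [DecidableEq B]

/-- The weights distributing `[(k+1)δ]` over the entries of a multi-index of size `k + 1` on the
side of the distinguished zero. -/
noncomputable def rightWeight (br : ℂ → ℂ) (δ : ℂ) (Z : B → ℂ) (v : ℂ) (k : ℕ) (ρ : B → ℕ) (j : B) :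
    ℂ :=
  -((∏ l, br (Z j - shiftBy δ Z ρ l)) / (∏ l ∈ univ.erase j, br (Z j - Z l))
    * (br (Z j - (v - k * δ)) / br (Z j - (v + δ))))
    * ((∏ l, br (Z l - (v + δ))) / ∏ l, br (shiftBy δ Z ρ l - (v + δ)))

lemma rightWeight_eq_zero (hb : IsBracket br) (Z : B → ℂ) (v : ℂ) (k : ℕ) (ρ : B → ℕ) (j : B)
    (hj : ρ j = 0) : rightWeight br δ Z v k ρ j = 0 := by
  have : ∏ l, br (Z j - shiftBy δ Z ρ l) = 0 :=
    prod_eq_zero (mem_univ j) (by simp [shiftBy, hj, bracket_zero hb])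
  simp [rightWeight, this]

lemma sum_rightWeight (hb : IsBracket br) {z : A → ℂ} {Z : B → ℂ} (hg : GenericPoles br δ z Z)
    {v : ℂ} (hv : ∀ l (n : ℤ), br (Z l - v + n * δ) ≠ 0) {k : ℕ} {ρ : B → ℕ}
    (hρ : ∑ l, ρ l = k + 1) :
    ∑ j, rightWeight br δ Z v k ρ j = br ((k + 1 : ℕ) * δ) := by
  have hZ : ∏ l, br (Z l - (v + δ)) ≠ 0 := prod_ne_zero_iff.mpr fun l _ => by
    convert hv l (-1) using 2; push_cast; ring
  have hW : ∏ l, br (shiftBy δ Z ρ l - (v + δ)) ≠ 0 := prod_ne_zero_iff.mpr fun l _ => by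
    convert hv l (ρ l - 1) using 2; simp only [shiftBy]; push_cast; ring
  have h := sum_partial_fraction_point hb Z (shiftBy δ Z ρ) (v + δ) (v - k * δ)
    (by rw [sum_shiftBy, hρ]; push_cast; ring)
    (fun i j hij => by simpa using hg.right i j hij 0)
    (fun i => by convert hv i (-1) using 2; push_cast; ring)
  simp only [rightWeight]
  rw [← sum_mul, sum_neg_distrib, eq_neg_of_add_eq_zero_left h,
    prod_bracket_neg hb univ (fun l => v + δ - Z l) (fun l => Z l - (v + δ)) fun l => by ring,
    prod_bracket_neg hb univ (fun l => v + δ - shiftBy δ Z ρ l)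
      (fun l => shiftBy δ Z ρ l - (v + δ)) fun l => by ring,
    show v + δ - (v - k * δ) = (k + 1 : ℕ) * δ by push_cast; ring]
  have hs : ((-1 : ℂ)) ^ (univ : Finset B).card ≠ 0 := pow_ne_zero _ (by norm_num)
  field_simp

lemma recursionCoeff_mul_kajiharaTerm [Fintype A] {z c : A → ℂ} {Z u : B → ℂ}
    (hg : GenericPoles br δ z Z) (o : B) (ho : ∀ l (n : ℤ), br (Z l - u o + n * δ) ≠ 0)
    (k : ℕ) (ν : B → ℕ) (j : B) :
    recursionCoeff br δ z c Z u o k j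
        * kajiharaTerm br δ (Z + Pi.single j δ) (u + Pi.single o δ) z c ν
      = kajiharaTerm br δ Z u z c (ν + Pi.single j 1)
        * rightWeight br δ Z (u o) k (ν + Pi.single j 1) j := by
  have hD := hg.symm.risingProd_self_ne_zero (ν + Pi.single j 1)
  have hz := hg.symm.risingProd_cross_ne_zero (ν + Pi.single j 1)
  have hWv : ∏ l, br (shiftBy δ Z (ν + Pi.single j 1) l - (u o + δ)) ≠ 0 :=
    prod_ne_zero_iff.mpr fun l _ => by
      convert ho l ((ν + Pi.single j 1 : B → ℕ) l - 1) using 2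
      simp only [shiftBy]; push_cast; ring
  have s := risingProd_shift (br := br) (δ := δ) (Z + Pi.single j δ) u ν o
  have f₁ : ∏ l, br ((Z + Pi.single j δ : B → ℂ) l + ν l * δ - u o - δ)
      = ∏ l, br (shiftBy δ Z (ν + Pi.single j 1) l - (u o + δ)) := by
    rw [← shiftBy_single_left]
    exact prod_congr rfl fun l _ => by simp only [shiftBy]; ring_nf
  have f₂ : ∏ l, br ((Z + Pi.single j δ : B → ℂ) l - u o - δ)
      = br (Z j - u o) * ∏ l ∈ univ.erase j, br (Z l - (u o + δ)) := by
    rw [← mul_prod_erase univ _ (mem_univ j)]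
    congr 1
    · simp only [Pi.add_apply, Pi.single_eq_same]; ring_nf
    · exact prod_congr rfl fun l hl => by simp [ne_of_mem_erase hl, sub_sub]
  have f₃ := mul_prod_erase univ (fun l => br (Z l - (u o + δ))) (mem_univ j)
  have f₄ := mul_prod_erase univ (fun l => br (Z j - u l)) (mem_univ o)
  have f₅ : ∏ l, br (Z j - (u - Pi.single o (k * δ) : B → ℂ) l)
      = br (Z j - (u o - k * δ)) * ∏ l ∈ univ.erase o, br (Z j - u l) := by
    rw [← mul_prod_erase univ _ (mem_univ o)]
    congr 1
    · simp
    · exact prod_congr rfl fun l hl => by simp [ne_of_mem_erase hl]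
  have f₆ : ∀ f : A → ℂ, ∏ i, br (Z j - (-f) i) = ∏ i, br (Z j + f i) := fun f => by
    simp
  rw [f₁, f₂] at s
  have hv : br (Z j - (u o + δ)) ≠ 0 := by
    convert ho j (-1) using 2; push_cast; ring
  have hv' : br (Z j - u o) ≠ 0 := by simpa using ho j 0
  have hPe : ∏ l ∈ univ.erase j, br (Z j - Z l) ≠ 0 := prod_ne_zero_iff.mpr fun l hl => by
    simpa using hg.right j l (ne_of_mem_erase hl).symm 0
  rw [risingProd_add_single_left] at hD hz
  rw [f₆] at hz
  simp only [kajiharaTerm, rightWeight, recursionCoeff, risingProd_add_single_left,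
    shiftBy_single_left, f₆, f₅]
  rw [← f₃, ← f₄]
  rw [← eq_div_iff hWv] at s
  rw [s]
  have hD₁ := left_ne_zero_of_mul hD
  have hD₂ := right_ne_zero_of_mul hD
  have hz₁ := left_ne_zero_of_mul hz
  have hz₂ := right_ne_zero_of_mul hz
  field_simp

lemma sum_kajiharaTerm_succ_right [Fintype A] (hb : IsBracket br) {z c : A → ℂ} {Z u : B → ℂ}
    (hg : GenericPoles br δ z Z) (o : B) (ho : ∀ l (n : ℤ), br (Z l - u o + n * δ) ≠ 0) (k : ℕ) :
    br ((k + 1 : ℕ) * δ) * ∑ ρ ∈ piAntidiag univ (k + 1), kajiharaTerm br δ Z u z c ρ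
      = ∑ j, recursionCoeff br δ z c Z u o k j * ∑ ν ∈ piAntidiag univ k,
          kajiharaTerm br δ (Z + Pi.single j δ) (u + Pi.single o δ) z c ν := by
  have h : br ((k + 1 : ℕ) * δ) * ∑ ρ ∈ piAntidiag univ (k + 1), kajiharaTerm br δ Z u z c ρ
      = ∑ ρ ∈ piAntidiag univ (k + 1), ∑ j,
          kajiharaTerm br δ Z u z c ρ * rightWeight br δ Z (u o) k ρ j := by
    rw [mul_sum]
    refine sum_congr rfl fun ρ hρ => ?_
    rw [← mul_sum, sum_rightWeight hb hg ho (mem_piAntidiag.mp hρ).1, mul_comm]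
  rw [h, sum_piAntidiag_succ k _ fun ρ j hj => by
    rw [rightWeight_eq_zero hb _ _ _ _ _ hj, mul_zero]]
  simp only [mul_sum, recursionCoeff_mul_kajiharaTerm hg o ho]
  exact sum_comm

/-- The Kajihara–Noumi transformation, with one zero in general position. -/
lemma sum_kajiharaTerm_comm_of_generic [Fintype A] [DecidableEq A] (hb : IsBracket br) {z c : A → ℂ}
    (o : B) (k : ℕ) : ∀ {Z u : B → ℂ}, GenericPoles br δ z Z →
    ∑ i, z i - ∑ i, c i = ∑ l, Z l - ∑ l, u l →
    (∀ i (n : ℤ), br (z i + u o + n * δ) ≠ 0) → (∀ l (n : ℤ), br (Z l - u o + n * δ) ≠ 0) →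
    ∑ μ ∈ piAntidiag univ k, kajiharaTerm br δ z c Z u μ
      = ∑ ρ ∈ piAntidiag univ k, kajiharaTerm br δ Z u z c ρ := by
  induction k with
  | zero => intros; simp [kajiharaTerm_zero]
  | succ k ih =>
    intro Z u hg hbal ho ho'
    refine mul_left_cancel₀ (by simpa using hg.step (k + 1) (by omega) : br
        ((k + 1 : ℕ) * δ) ≠ 0) ?_
    rw [sum_kajiharaTerm_succ_left hb hg hbal o ho, sum_kajiharaTerm_succ_right hb hg o ho']
    refine sum_congr rfl fun j _ => ?_
    rw [ih (hg.shift_right j)]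
    · simp only [Pi.add_apply, sum_add_distrib, sum_pi_single', mem_univ, if_true]
      linear_combination hbal
    · intro i n
      convert ho i (n + 1) using 2
      simp only [Pi.add_apply, Pi.single_eq_same]; push_cast; ring
    · intro l n
      rcases eq_or_ne l j with rfl | hl
      · convert ho' l n using 2
        simp only [Pi.add_apply, Pi.single_eq_same]; ring
      · convert ho' l (n - 1) using 2
        simp only [Pi.add_apply, Pi.single_eq_same, Pi.single_eq_of_ne hl]; push_cast; ring

end RightRecursion

section Degenerate
variable {br : ℂ → ℂ} {δ : ℂ} {A B : Type*} [Fintype A] [Fintype B]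

lemma risingProd_sum_elim_zero (z : A → ℂ) (τ : ℂ) (c : B → ℂ) (t : ℂ) (μ : A → ℕ) :
    risingProd br δ (Sum.elim z fun _ : Unit => τ) (Sum.elim c fun _ : Unit => t) (Sum.elim μ 0)
      = risingProd br δ z c μ * ∏ i, risingBracket br δ (z i - t) (μ i) := by
  simp [risingProd, Fintype.prod_sum_type, prod_mul_distrib]

lemma neg_sum_elim {B : Type*} (c : B → ℂ) (t : ℂ) :
    -(Sum.elim c fun _ : Unit => t) = Sum.elim (-c) fun _ : Unit => -t := by
  funext l
  cases l <;> simp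

lemma kajiharaTerm_sum_elim_zero {z c : A → ℂ} {Z u : B → ℂ} {τ σ : ℂ}
    (hg : GenericPoles br δ (Sum.elim z fun _ : Unit => τ) (Sum.elim Z fun _ : Unit => σ))
    (μ : A → ℕ) :
    kajiharaTerm br δ (Sum.elim z fun _ : Unit => τ) (Sum.elim c fun _ : Unit => τ)
        (Sum.elim Z fun _ : Unit => σ) (Sum.elim u fun _ : Unit => σ) (Sum.elim μ 0)
      = kajiharaTerm br δ z c Z u μ := by
  have hs : shiftBy δ (Sum.elim z fun _ : Unit => τ) (Sum.elim μ 0)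
      = Sum.elim (shiftBy δ z μ) fun _ : Unit => τ := by
    funext l
    cases l <;> simp [shiftBy]
  have h₁ := hg.risingProd_self_ne_zero (Sum.elim μ 0)
  have h₂ := hg.risingProd_cross_ne_zero (Sum.elim μ 0)
  rw [hs, risingProd_sum_elim_zero] at h₁
  rw [neg_sum_elim, risingProd_sum_elim_zero] at h₂
  have h₃ := right_ne_zero_of_mul h₁
  have h₄ := right_ne_zero_of_mul h₂
  simp only [kajiharaTerm, hs, neg_sum_elim, risingProd_sum_elim_zero]
  rw [show ∀ a b c d e f : ℂ, a * e * (b * f) / (c * e * (d * f))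
      = a * b * (e * f) / (c * d * (e * f)) by intros; ring_nf,
    mul_div_mul_right _ _ (mul_ne_zero h₃ h₄)]

lemma sum_kajiharaTerm_sum_elim [DecidableEq A] (hb : IsBracket br) {z c : A → ℂ} {Z u : B → ℂ}
    {τ σ : ℂ} (hg : GenericPoles br δ (Sum.elim z fun _ : Unit => τ) (Sum.elim Z fun _ : Unit => σ))
    (k : ℕ) :
    ∑ μ ∈ piAntidiag univ k,
        kajiharaTerm br δ (Sum.elim z fun _ : Unit => τ) (Sum.elim c fun _ : Unit => τ)
          (Sum.elim Z fun _ : Unit => σ) (Sum.elim u fun _ : Unit => σ) μ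
      = ∑ μ ∈ piAntidiag univ k, kajiharaTerm br δ z c Z u μ := by
  symm
  refine sum_of_injOn (fun μ => Sum.elim μ 0) (fun μ _ ν _ h => ?_) (fun μ hμ => ?_)
    (fun μ hμ hn => ?_) fun μ _ => (kajiharaTerm_sum_elim_zero hg μ).symm
  · exact funext fun i => congrFun h (Sum.inl i)
  · simp only [mem_coe, mem_piAntidiag] at hμ ⊢
    exact ⟨by simpa using hμ.1, fun _ _ => mem_univ _⟩
  · have h0 : μ (Sum.inr ()) ≠ 0 := fun h0 => hn ⟨fun i => μ (Sum.inl i), by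
      simp only [mem_coe, mem_piAntidiag] at hμ ⊢
      exact ⟨by simpa [h0] using hμ.1, fun _ _ => mem_univ _⟩, by
      funext l
      rcases l with i | ⟨⟩ <;> simp [h0]⟩
    obtain ⟨t, ht⟩ := Nat.exists_eq_succ_of_ne_zero h0
    have : risingProd br δ (Sum.elim z fun _ : Unit => τ) (Sum.elim c fun _ : Unit => τ) μ = 0 :=
      prod_eq_zero (mem_univ (Sum.inr ())) (prod_eq_zero (mem_univ (Sum.inr ())) (by
        simp [ht, risingBracket_succ_left, bracket_zero hb]))
    simp [kajiharaTerm, this]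

lemma continuous_kajiharaTerm (hb : IsBracket br) (z : A → ℂ) (Z : B → ℂ) (μ : A → ℕ)
    {c : ℂ → A → ℂ} {u : ℂ → B → ℂ} (hc : Continuous c) (hu : Continuous u) :
    Continuous fun ε => kajiharaTerm br δ z (c ε) Z (u ε) μ := by
  have := hb.entire.continuous
  unfold kajiharaTerm
  refine Continuous.div_const (Continuous.mul ?_ ?_) _
  · unfold risingProd risingBracket; fun_prop
  · unfold risingProd risingBracket; fun_prop

/-- The Kajihara–Noumi transformation. -/
theorem sum_kajiharaTerm_comm [DecidableEq A] [DecidableEq B] (hb : IsBracket br) {z c : A → ℂ}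
    {Z u : B → ℂ} (hg : GenericPoles br δ z Z)
    (hbal : ∑ i, z i - ∑ i, c i = ∑ l, Z l - ∑ l, u l) (k : ℕ) :
    ∑ μ ∈ piAntidiag univ k, kajiharaTerm br δ z c Z u μ
      = ∑ ρ ∈ piAntidiag univ k, kajiharaTerm br δ Z u z c ρ := by
  have aux := residual_forall_bracket_ne_zero hb δ
  have hτ : ∀ᶠ τ in residual ℂ,
      GenericPoles br δ (Sum.elim z fun _ : Unit => τ) (Sum.elim Z fun _ : Unit => 2 * τ) := by
    filter_upwards [eventually_countable_forall.mpr fun i => aux (z i) (-1) (by norm_num),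
      eventually_countable_forall.mpr fun i => aux (-z i) 1 (by norm_num),
      eventually_countable_forall.mpr fun l => aux (Z l) (-2) (by norm_num),
      eventually_countable_forall.mpr fun l => aux (-Z l) 2 (by norm_num),
      eventually_countable_forall.mpr fun i => aux (z i) 2 (by norm_num),
      eventually_countable_forall.mpr fun l => aux (Z l) 1 (by norm_num),
      aux 0 3 (by norm_num)] with τ h₁ h₂ h₃ h₄ h₅ h₆ h₇
    refine ⟨hg.step, ?_, ?_, ?_⟩
    · rintro (i | i) (j | j) hij n
      · exact hg.left i j (fun h => hij (by rw [h])) n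
      · convert h₁ i n using 2; simp; ring
      · convert h₂ j n using 2; simp; ring
      · exact absurd (by cases i; cases j; rfl) hij
    · rintro (i | i) (j | j) hij n
      · exact hg.right i j (fun h => hij (by rw [h])) n
      · convert h₃ i n using 2; simp; ring
      · convert h₄ j n using 2; simp; ring
      · exact absurd (by cases i; cases j; rfl) hij
    · rintro (i | i) (j | j) n
      · exact hg.cross i j n
      · convert h₅ i n using 2; simp
      · convert h₆ j n using 2; simp; ring
      · convert h₇ n using 2; simp; ring
  obtain ⟨τ, hτ⟩ := (dense_of_mem_residual hτ).nonempty
  have hε : ∀ᶠ ε in residual ℂ,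
      (∀ i (n : ℤ), br ((Sum.elim z fun _ : Unit => τ) i + (2 * τ - ε) + n * δ) ≠ 0)
        ∧ ∀ l (n : ℤ), br ((Sum.elim Z fun _ : Unit => 2 * τ) l - (2 * τ - ε) + n * δ) ≠ 0 := by
    filter_upwards [
      eventually_countable_forall.mpr fun i =>
        aux ((Sum.elim z fun _ : Unit => τ) i + 2 * τ) (-1) (by norm_num),
      eventually_countable_forall.mpr fun l =>
        aux ((Sum.elim Z fun _ : Unit => 2 * τ) l - 2 * τ) 1 (by norm_num)] with ε h₁ h₂
    exact ⟨fun i n => by convert h₁ i n using 2; ring, fun l n => by convert h₂ l n using 2; ring⟩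
  have hc : Continuous fun ε : ℂ => Sum.elim c fun _ : Unit => τ - ε :=
    continuous_pi (by rintro (i | i) <;> simp <;> fun_prop)
  have hu : Continuous fun ε : ℂ => Sum.elim u fun _ : Unit => 2 * τ - ε :=
    continuous_pi (by rintro (i | i) <;> simp <;> fun_prop)
  have h := Continuous.ext_on (dense_of_mem_residual hε)
    (continuous_finsetSum (piAntidiag univ k) fun μ _ => continuous_kajiharaTerm (δ := δ) hb
      (Sum.elim z fun _ : Unit => τ) (Sum.elim Z fun _ : Unit => 2 * τ) μ hc hu)
    (continuous_finsetSum (piAntidiag univ k) fun μ _ => continuous_kajiharaTerm (δ := δ) hb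
      (Sum.elim Z fun _ : Unit => 2 * τ) (Sum.elim z fun _ : Unit => τ) μ hu hc)
    fun ε hε => sum_kajiharaTerm_comm_of_generic hb (Sum.inr ()) k hτ
      (by simp; linear_combination hbal) hε.1 hε.2
  have h0 := congrFun h 0
  simp only [sub_zero] at h0
  rwa [sum_kajiharaTerm_sum_elim hb hτ, sum_kajiharaTerm_sum_elim hb hτ.symm] at h0

end Degenerate

section Reduction
variable {br : ℂ → ℂ} {δ κ : ℂ} {m r n s : ℕ}

lemma sfac_natCast (br : ℂ → ℂ) (a x : ℂ) (k : ℕ) : sfac br a x k = risingBracket br a x k := by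
  simp [sfac, risingBracket]

/-- The ratio of shifted and unshifted kernel functions, together with the bracket factors of the
kernel function. -/
noncomputable def kernelWeight (br : ℂ → ℂ) (δ κ : ℂ) (μ : Fin m → ℕ) (I : Finset (Fin r))
    (x : Fin m → ℂ) (y : Fin r → ℂ) (X : Fin n → ℂ) (Y : Fin s → ℂ) : ℂ :=
  (∏ i, ∏ j, risingBracket br δ (x i + X j - κ) (μ i) / risingBracket br δ (x i + X j) (μ i))
    * (∏ i ∈ I, ∏ j, br (y i + Y j + δ) / br (y i + Y j))
    * (∏ i, ∏ j, br (xshift δ μ x i + Y j))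
    * ∏ i, ∏ j, br (yshift κ I y i + X j)

/-- The action of `H_{m,r}^{(k)}` on the kernel function, with the factors `G₁`, `G₂` removed. -/
noncomputable def reducedAction (br : ℂ → ℂ) (δ κ : ℂ) (k : ℕ)
    (x : Fin m → ℂ) (y : Fin r → ℂ) (X : Fin n → ℂ) (Y : Fin s → ℂ) : ℂ :=
  ∑ p ∈ idxSet m r k, Coef br δ κ p.1 p.2 x y * kernelWeight br δ κ p.1 p.2 x y X Y

lemma gamma_add_nat_mul {G₁ : ℂ → ℂ} (hG₁ : ∀ z : ℂ, G₁ (z + δ) = br z * G₁ z) (z : ℂ) (t : ℕ) :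
    G₁ (z + t * δ) = risingBracket br δ z t * G₁ z := by
  induction t with
  | zero => simp
  | succ t ih =>
    rw [risingBracket_succ, show z + (t + 1 : ℕ) * δ = z + t * δ + δ by push_cast; ring, hG₁, ih]
    ring

lemma Phi_shift {G₁ G₂ : ℂ → ℂ} (hG₁ : ∀ z : ℂ, G₁ (z + δ) = br z * G₁ z)
    (hG₂ : ∀ z : ℂ, G₂ (z - κ) = br z * G₂ z) (μ : Fin m → ℕ) (I : Finset (Fin r))
    (x : Fin m → ℂ) (y : Fin r → ℂ) (X : Fin n → ℂ) (Y : Fin s → ℂ) :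
    Phi br G₁ G₂ δ κ (xshift δ μ x) (yshift κ I y) X Y
      = (∏ i, ∏ j, G₁ (x i + X j - κ) / G₁ (x i + X j))
        * (∏ i, ∏ j, G₂ (y i + Y j + δ) / G₂ (y i + Y j))
        * kernelWeight br δ κ μ I x y X Y := by
  have e₁ : ∀ i j, G₁ (xshift δ μ x i + X j - κ) / G₁ (xshift δ μ x i + X j)
      = risingBracket br δ (x i + X j - κ) (μ i) / risingBracket br δ (x i + X j) (μ i)
        * (G₁ (x i + X j - κ) / G₁ (x i + X j)) := fun i j => by
    rw [div_mul_div_comm, ← gamma_add_nat_mul hG₁, ← gamma_add_nat_mul hG₁]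
    congr 2 <;> simp only [xshift] <;> ring
  have e₂ : ∀ i j, G₂ (yshift κ I y i + Y j + δ) / G₂ (yshift κ I y i + Y j)
      = (if i ∈ I then br (y i + Y j + δ) / br (y i + Y j) else 1)
        * (G₂ (y i + Y j + δ) / G₂ (y i + Y j)) := fun i j => by
    split_ifs with h
    · rw [div_mul_div_comm, ← hG₂, ← hG₂]
      congr 2 <;> simp only [yshift, h, if_true] <;> ring
    · simp [yshift, h]
  have e₃ : ∏ i ∈ I, ∏ j, br (y i + Y j + δ) / br (y i + Y j)
      = ∏ i, ∏ j, if i ∈ I then br (y i + Y j + δ) / br (y i + Y j) else 1 := by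
    rw [← prod_ite_mem_eq]
    exact prod_congr rfl fun i _ => by split_ifs <;> simp
  simp only [Phi, kernelWeight, e₁, e₂, e₃, prod_mul_distrib]
  ring

lemma Phi_swap (br G₁ G₂ : ℂ → ℂ) (δ κ : ℂ)
    (x : Fin m → ℂ) (y : Fin r → ℂ) (X : Fin n → ℂ) (Y : Fin s → ℂ) :
    Phi br G₁ G₂ δ κ x y X Y = Phi br G₁ G₂ δ κ X Y x y := by
  unfold Phi
  rw [prod_comm, prod_comm (s := (univ : Finset (Fin r))) (t := (univ : Finset (Fin s))),
    prod_comm (s := (univ : Finset (Fin r))) (t := (univ : Finset (Fin n))),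
    prod_comm (s := (univ : Finset (Fin m))) (t := (univ : Finset (Fin s)))]
  simp only [add_comm]
  ring

lemma Hop_Phi {G₁ G₂ : ℂ → ℂ} (hG₁ : ∀ z : ℂ, G₁ (z + δ) = br z * G₁ z)
    (hG₂ : ∀ z : ℂ, G₂ (z - κ) = br z * G₂ z) (k : ℕ)
    (x : Fin m → ℂ) (y : Fin r → ℂ) (X : Fin n → ℂ) (Y : Fin s → ℂ) :
    Hop br δ κ m r k (fun x' y' => Phi br G₁ G₂ δ κ x' y' X Y) x y
      = (∏ i, ∏ j, G₁ (x i + X j - κ) / G₁ (x i + X j))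
        * (∏ i, ∏ j, G₂ (y i + Y j + δ) / G₂ (y i + Y j))
        * reducedAction br δ κ k x y X Y := by
  simp only [Hop, reducedAction, Phi_shift hG₁ hG₂, mul_sum]
  exact sum_congr rfl fun p _ => by ring

lemma Hop_Phi_eq_of_reducedAction_eq {G₁ G₂ : ℂ → ℂ} (hG₁ : ∀ z : ℂ, G₁ (z + δ) = br z * G₁ z)
    (hG₂ : ∀ z : ℂ, G₂ (z - κ) = br z * G₂ z) {k : ℕ}
    {x : Fin m → ℂ} {y : Fin r → ℂ} {X : Fin n → ℂ} {Y : Fin s → ℂ}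
    (h : reducedAction br δ κ k x y X Y = reducedAction br δ κ k X Y x y) :
    Hop br δ κ m r k (fun x' y' => Phi br G₁ G₂ δ κ x' y' X Y) x y
      = Hop br δ κ n s k (fun X' Y' => Phi br G₁ G₂ δ κ x y X' Y') X Y := by
  simp only [Phi_swap br G₁ G₂ δ κ x y]
  rw [Hop_Phi hG₁ hG₂, Hop_Phi hG₁ hG₂, h, prod_comm,
    prod_comm (s := (univ : Finset (Fin r)))]
  simp only [add_comm]

end Reduction

section Term
variable {br : ℂ → ℂ} {δ κ : ℂ} {m r n s : ℕ}

lemma prod_prod_eq_diag_mul (f : Fin m → Fin m → ℂ) :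
    ∏ i, ∏ j, f i j = (∏ i, f i i) * ∏ i, ∏ j, if i < j then f i j * f j i else 1 := by
  have h : ∀ i j, f i j = (if i < j then f i j else 1) * (if j < i then f i j else 1)
      * if i = j then f i j else 1 := fun i j => by
    rcases lt_trichotomy i j with h | rfl | h
    · simp [h, h.not_gt, h.ne]
    · simp
    · simp [h, h.not_gt, h.ne']
  have h' : ∀ i j, (if i < j then f i j * f j i else 1)
      = (if i < j then f i j else 1) * if i < j then f j i else 1 := fun i j => by
    split_ifs <;> simp
  calc ∏ i, ∏ j, f i j
      = (∏ i, ∏ j, if i < j then f i j else 1) * (∏ i, ∏ j, if j < i then f i j else 1)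
        * ∏ i, ∏ j, if i = j then f i j else 1 := by
        simp only [← prod_mul_distrib]
        exact prod_congr rfl fun i _ => prod_congr rfl fun j _ => h i j
    _ = _ := by
        rw [prod_comm (f := fun i j => if j < i then f i j else 1)]
        simp only [h', prod_mul_distrib, prod_ite_eq, mem_univ, if_true]
        ring

lemma risingBracket_add (x : ℂ) (a b : ℕ) :
    risingBracket br δ x (a + b) = risingBracket br δ x a * risingBracket br δ (x + a * δ) b := by
  unfold risingBracket
  rw [prod_range_add]
  congr 1
  exact prod_congr rfl fun t _ => by push_cast; ring_nf

lemma risingBracket_neg (hb : IsBracket br) (x : ℂ) (a : ℕ) :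
    risingBracket br δ (-x) a = (-1) ^ a * risingBracket br δ (x - a * δ + δ) a := by
  induction a generalizing x with
  | zero => simp
  | succ a ih =>
    rw [risingBracket_succ_left, risingBracket_succ, hb.odd, show -x + δ = -(x - δ) by ring, ih,
      show x - (a + 1 : ℕ) * δ + δ = x - δ - a * δ + δ by push_cast; ring,
      show x - δ - a * δ + δ + a * δ = x by ring]
    ring

/-- Interchanging the roles of two shifts. -/
lemma risingBracket_pair (hb : IsBracket br) (x : ℂ) (a b : ℕ) :
    risingBracket br δ (x - b * δ) a * risingBracket br δ (-x - a * δ) b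
        * br (x + ((a : ℂ) - b) * δ)
      = risingBracket br δ (x + δ) a * risingBracket br δ (-x + δ) b * br x := by
  have h₁ := risingBracket_add (br := br) (δ := δ) (x - b * δ) a (b + 1)
  have h₂ := risingBracket_add (br := br) (δ := δ) (x - b * δ) b (a + 1)
  rw [risingBracket_succ_left] at h₁ h₂
  rw [show -x - a * δ = -(x + a * δ) by ring, show -x + δ = -(x - δ) by ring,
    risingBracket_neg hb, risingBracket_neg hb,
    show x + ((a : ℂ) - b) * δ = x - b * δ + a * δ by ring,
    show x + a * δ - b * δ + δ = x - b * δ + a * δ + δ by ring,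
    show x - δ - b * δ + δ = x - b * δ by ring]
  rw [sub_add_cancel] at h₂
  rw [show b + (a + 1) = a + (b + 1) by ring, h₁] at h₂
  linear_combination (-1) ^ b * h₂

lemma risingProd_self_mul (hb : IsBracket br) (x : Fin m → ℂ) (μ : Fin m → ℕ) :
    risingProd br δ x (shiftBy δ x μ) μ
        * ∏ i, ∏ j, (if i < j then br (x i - x j + ((μ i : ℂ) - μ j) * δ) else 1)
      = (-1) ^ (∑ i, μ i) * (∏ i, ∏ j, risingBracket br δ (x i - x j + δ) (μ i))
        * ∏ i, ∏ j, if i < j then br (x i - x j) else 1 := by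
  unfold risingProd
  rw [prod_prod_eq_diag_mul, prod_prod_eq_diag_mul fun i j => risingBracket br δ (x i - x j + δ)
      (μ i),
    ← prod_pow_eq_pow_sum]
  have hd : ∏ i, risingBracket br δ (x i - shiftBy δ x μ i) (μ i)
      = (∏ i, (-1) ^ μ i) * ∏ i, risingBracket br δ (x i - x i + δ) (μ i) := by
    rw [← prod_mul_distrib]
    refine prod_congr rfl fun i _ => ?_
    rw [show x i - shiftBy δ x μ i = -(μ i * δ) by simp only [shiftBy]; ring, risingBracket_neg hb]
    simp
  have hp : (∏ i, ∏ j, if i < j then risingBracket br δ (x i - shiftBy δ x μ j) (μ i)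
        * risingBracket br δ (x j - shiftBy δ x μ i) (μ j) else 1)
      * ∏ i, ∏ j, (if i < j then br (x i - x j + ((μ i : ℂ) - μ j) * δ) else 1)
      = (∏ i, ∏ j, if i < j then risingBracket br δ (x i - x j + δ) (μ i)
        * risingBracket br δ (x j - x i + δ) (μ j) else 1)
      * ∏ i, ∏ j, if i < j then br (x i - x j) else 1 := by
    simp only [← prod_mul_distrib]
    refine prod_congr rfl fun i _ => prod_congr rfl fun j _ => ?_
    split_ifs
    · have := risingBracket_pair (δ := δ) hb (x i - x j) (μ i) (μ j)
      simp only [shiftBy]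
      rw [show x i - (x j + μ j * δ) = x i - x j - μ j * δ by ring,
        show x j - (x i + μ i * δ) = -(x i - x j) - μ i * δ by ring,
        show x j - x i = -(x i - x j) by ring, this]
    · simp
  rw [hd]
  linear_combination (∏ i, (-1) ^ μ i) * (∏ i, risingBracket br δ (x i - x i + δ) (μ i)) * hp

/-- The indicator function of a finite set. -/
def indicatorNat {α : Type*} [DecidableEq α] (I : Finset α) : α → ℕ :=
  fun j => if j ∈ I then 1 else 0

lemma risingProd_indicatorNat {A B : Type*} [Fintype A] [DecidableEq A] [Fintype B]
    (z : A → ℂ) (c : B → ℂ) (I : Finset A) :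
    risingProd br δ z c (indicatorNat I) = ∏ i ∈ I, ∏ j, br (z i - c j) := by
  rw [← prod_ite_mem_eq]
  refine prod_congr rfl fun i _ => ?_
  by_cases h : i ∈ I <;> simp [indicatorNat, h]

lemma risingProd_sum_elim {A A' B B' : Type*} [Fintype A] [Fintype A'] [Fintype B] [Fintype B']
    (z : A → ℂ) (z' : A' → ℂ) (c : B → ℂ) (c' : B' → ℂ) (μ : A → ℕ) (μ' : A' → ℕ) :
    risingProd br δ (Sum.elim z z') (Sum.elim c c') (Sum.elim μ μ')
      = risingProd br δ z c μ * risingProd br δ z c' μ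
        * (risingProd br δ z' c μ' * risingProd br δ z' c' μ') := by
  simp only [risingProd, Fintype.prod_sum_type, Sum.elim_inl, Sum.elim_inr, prod_mul_distrib]
  ring

end Term

section TermIdentity
variable {br : ℂ → ℂ} {δ κ : ℂ} {m r n s : ℕ}

lemma prod_mul_prod_compl_ite {α : Type*} [Fintype α] [DecidableEq α] (I : Finset α) (f g : α → ℂ) :
    (∏ j ∈ I, f j) * ∏ j ∈ Iᶜ, g j = ∏ j, if j ∈ I then f j else g j := by
  rw [← prod_mul_prod_compl I]
  congr 1
  · exact prod_congr rfl fun j hj => by rw [if_pos hj]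
  · exact prod_congr rfl fun j hj => by rw [if_neg (mem_compl.mp hj)]

lemma risingProd_self_ratio (hb : IsBracket br) {x : Fin m → ℂ} {μ : Fin m → ℕ}
    (hD : risingProd br δ x (shiftBy δ x μ) μ ≠ 0)
    (hx : ∀ i j, i ≠ j → ∀ t : ℤ, br (x i - x j + t * δ) ≠ 0) :
    (∏ i, ∏ j, if i < j then br (x i - x j + ((μ i : ℂ) - (μ j : ℂ)) * δ) / br (x i - x j) else 1)
        * ∏ i, ∏ j, sfac br δ (x i - x j + κ) (μ i : ℤ) / sfac br δ (x i - x j + δ) (μ i : ℤ)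
      = (-1) ^ (∑ i, μ i)
        * (risingProd br δ x (fun i => x i - κ) μ / risingProd br δ x (shiftBy δ x μ) μ) := by
  have h := risingProd_self_mul (δ := δ) hb x μ
  have hP : ∏ i, ∏ j, (if i < j then br (x i - x j + ((μ i : ℂ) - μ j) * δ) else 1) ≠ 0 :=
    prod_ne_zero_iff.mpr fun i _ => prod_ne_zero_iff.mpr fun j _ => by
      split_ifs with hij
      · convert hx i j hij.ne (μ i - μ j) using 2; push_cast; ring
      · exact one_ne_zero
  have e : (∏ i, ∏ j, if i < j then br (x i - x j + ((μ i : ℂ) - (μ j : ℂ)) * δ) / br (x i - x j)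
        else 1)
      = (∏ i, ∏ j, (if i < j then br (x i - x j + ((μ i : ℂ) - μ j) * δ) else 1))
        / ∏ i, ∏ j, if i < j then br (x i - x j) else 1 := by
    simp only [← prod_div_distrib]
    exact prod_congr rfl fun i _ => prod_congr rfl fun j _ => by split_ifs <;> simp
  have e' : ∏ i, ∏ j, risingBracket br δ (x i - x j + κ) (μ i)
      = risingProd br δ x (fun i => x i - κ) μ :=
    prod_congr rfl fun i _ => prod_congr rfl fun j _ => by ring_nf
  simp only [e, sfac_natCast, prod_div_distrib, e']
  have hne := mul_ne_zero hD hP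
  rw [h] at hne
  have h₁ := right_ne_zero_of_mul hne
  have h₂ := right_ne_zero_of_mul (left_ne_zero_of_mul hne)
  rw [div_mul_div_comm, ← mul_div_assoc, div_eq_div_iff (mul_ne_zero h₁ h₂) hD]
  linear_combination risingProd br δ x (fun i => x i - κ) μ * h

lemma risingProd_cross_ratio (hb : IsBracket br) {x : Fin m → ℂ} {y : Fin r → ℂ}
    (hxy : ∀ i j (t : ℤ), br (x i - y j + t * δ) ≠ 0) (μ : Fin m → ℕ) (I : Finset (Fin r)) :
    risingProd br δ x (fun j => y j + δ) μ * risingProd br δ y (fun i => x i - κ) (indicatorNat I)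
        / (risingProd br δ x (shiftBy δ y (indicatorNat I)) μ
          * risingProd br δ y (shiftBy δ x μ) (indicatorNat I))
      = ∏ i, ((∏ j ∈ I, br (x i - y j - κ) / br (x i - y j + (μ i : ℂ) * δ))
          * ∏ j ∈ Iᶜ, br (x i - y j - δ) / br (x i - y j + ((μ i : ℂ) - 1) * δ)) := by
  have e : ∀ f : Fin m → ℂ, risingProd br δ y f (indicatorNat I)
      = ∏ i, ∏ j, if j ∈ I then br (y j - f i) else 1 := fun f => by
    rw [risingProd_indicatorNat, prod_comm]
    exact prod_congr rfl fun i _ => (prod_ite_mem_eq I _).symm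
  rw [e, e]
  simp only [prod_mul_prod_compl_ite, risingProd]
  simp only [← prod_mul_distrib, ← prod_div_distrib]
  refine prod_congr rfl fun i _ => prod_congr rfl fun j _ => ?_
  by_cases h : j ∈ I
  · simp only [h, if_true, shiftBy, indicatorNat, Nat.cast_one, one_mul]
    have h₁ : risingBracket br δ (x i - (y j + δ)) (μ i) ≠ 0 := risingBracket_ne_zero fun t _ => by
      convert hxy i j (t - 1) using 2; push_cast; ring
    rw [mul_div_mul_left _ _ h₁, show y j - (x i - κ) = -(x i - y j - κ) by ring,
      show y j - (x i + μ i * δ) = -(x i - y j + μ i * δ) by ring, hb.odd, hb.odd, neg_div_neg_eq]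
  · simp only [h, if_false, shiftBy, indicatorNat, Nat.cast_zero, zero_mul, add_zero, mul_one]
    have h₁ : risingBracket br δ (x i - y j) (μ i) ≠ 0 := risingBracket_ne_zero fun t _ => by
      exact_mod_cast hxy i j t
    have h₂ : br (x i - y j + ((μ i : ℂ) - 1) * δ) ≠ 0 := by
      convert hxy i j (μ i - 1) using 2; push_cast; ring
    have h₃ := risingBracket_shift (br := br) (δ := δ) (x i - y j - δ) (μ i)
    rw [sub_add_cancel,
        show x i - y j - δ + μ i * δ = x i - y j + ((μ i : ℂ) - 1) * δ by ring] at h₃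
    rw [div_eq_div_iff h₁ h₂, sub_add_eq_sub_sub, h₃]

lemma risingProd_indicator_ratio {y : Fin r → ℂ} (I : Finset (Fin r)) (hδ : br (-δ) ≠ 0)
    (hy : ∀ i j, i ≠ j → ∀ t : ℤ, br (y i - y j + t * δ) ≠ 0) :
    risingProd br δ y (fun j => y j + δ) (indicatorNat I)
        / risingProd br δ y (shiftBy δ y (indicatorNat I)) (indicatorNat I)
      = ∏ i ∈ I, ∏ j ∈ Iᶜ, br (y i - y j - δ) / br (y i - y j) := by
  simp only [risingProd_indicatorNat, ← prod_div_distrib]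
  refine prod_congr rfl fun i _ => ?_
  rw [← prod_mul_prod_compl I]
  have h₁ : ∏ j ∈ I, br (y i - (y j + δ)) / br (y i - shiftBy δ y (indicatorNat I) j) = 1 :=
    prod_eq_one fun j hj => by
      simp only [shiftBy, indicatorNat, hj, if_true, Nat.cast_one, one_mul]
      refine div_self ?_
      rcases eq_or_ne i j with rfl | hij
      · simpa using hδ
      · convert hy i j hij (-1) using 2; push_cast; ring
  rw [h₁, one_mul]
  exact prod_congr rfl fun j hj => by
    simp [shiftBy, indicatorNat, mem_compl.mp hj, sub_add_eq_sub_sub]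

lemma risingProd_step_ratio {x : Fin m → ℂ} {Y : Fin s → ℂ}
    (hxY : ∀ i j (t : ℤ), br (x i + Y j + t * δ) ≠ 0) (μ : Fin m → ℕ) :
    risingProd br δ x (-fun j => Y j + δ) μ / risingProd br δ x (-Y) μ * ∏ i, ∏ j, br (x i + Y j)
      = ∏ i, ∏ j, br (xshift δ μ x i + Y j) := by
  simp only [risingProd, ← prod_div_distrib, ← prod_mul_distrib]
  refine prod_congr rfl fun i _ => prod_congr rfl fun j _ => ?_
  have h := risingBracket_shift (br := br) (δ := δ) (x i + Y j) (μ i)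
  have h₁ : risingBracket br δ (x i + Y j) (μ i) ≠ 0 := risingBracket_ne_zero fun t _ => by
    exact_mod_cast hxY i j t
  simp only [Pi.neg_apply, sub_neg_eq_add, xshift]
  rw [← add_assoc, div_mul_eq_mul_div, div_eq_iff h₁, mul_comm, h, mul_comm]
  ring_nf

lemma risingProd_indicator_shift_ratio {y : Fin r → ℂ} {X : Fin n → ℂ}
    (hyX : ∀ i j (t : ℤ), br (y i + X j + t * δ) ≠ 0) (I : Finset (Fin r)) :
    risingProd br δ y (-fun j => X j - κ) (indicatorNat I) / risingProd br δ y (-X) (indicatorNat I)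
        * ∏ i, ∏ j, br (y i + X j)
      = ∏ i, ∏ j, br (yshift κ I y i + X j) := by
  simp only [risingProd, ← prod_div_distrib, ← prod_mul_distrib]
  refine prod_congr rfl fun i _ => prod_congr rfl fun j _ => ?_
  have h₁ : br (y i + X j) ≠ 0 := by simpa using hyX i j 0
  by_cases h : i ∈ I
  · simp only [indicatorNat, yshift, h, if_true, risingBracket_one, Pi.neg_apply, sub_neg_eq_add]
    rw [div_mul_cancel₀ _ h₁]
    ring_nf
  · simp [indicatorNat, yshift, h]

lemma shiftBy_sum_elim {A B : Type*} (x : A → ℂ) (y : B → ℂ) (μ : A → ℕ) (ν : B → ℕ) :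
    shiftBy δ (Sum.elim x y) (Sum.elim μ ν) = Sum.elim (shiftBy δ x μ) (shiftBy δ y ν) := by
  funext i
  cases i <;> rfl

/-- The summands of the reduced action are summands of the Kajihara–Noumi transformation. -/
lemma coef_mul_kernelWeight (hb : IsBracket br) {x : Fin m → ℂ} {y : Fin r → ℂ} {X : Fin n → ℂ}
    {Y : Fin s → ℂ} (hg : GenericPoles br δ (Sum.elim x y) (Sum.elim X Y)) (μ : Fin m → ℕ)
    (I : Finset (Fin r)) :
    Coef br δ κ μ I x y * kernelWeight br δ κ μ I x y X Y
      = (-1) ^ (∑ i, μ i + I.card) * ((∏ i, ∏ j, br (x i + Y j)) * ∏ i, ∏ j, br (y i + X j))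
        * kajiharaTerm br δ (Sum.elim x y) (Sum.elim (fun i => x i - κ) fun j => y j + δ)
          (Sum.elim X Y) (Sum.elim (fun i => X i - κ) fun j => Y j + δ)
          (Sum.elim μ (indicatorNat I)) := by
  have hD := hg.risingProd_self_ne_zero (Sum.elim μ (indicatorNat I))
  rw [shiftBy_sum_elim, risingProd_sum_elim] at hD
  have hδ : br (-δ) ≠ 0 := by simpa using hg.step (-1) (by norm_num)
  have r₁ := risingProd_self_ratio (κ := κ) hb (left_ne_zero_of_mul (left_ne_zero_of_mul hD))
    fun i j hij => hg.left (Sum.inl i) (Sum.inl j) (by simpa using hij)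
  have r₂ := risingProd_cross_ratio (κ := κ) (x := x) (y := y) hb
    (fun i j => hg.left (Sum.inl i) (Sum.inr j) (by simp)) μ I
  have r₃ := risingProd_indicator_ratio (y := y) I hδ
    fun i j hij => hg.left (Sum.inr i) (Sum.inr j) (by simpa using hij)
  have r₄ : risingProd br δ x (-fun j => X j - κ) μ / risingProd br δ x (-X) μ
      = ∏ i, ∏ j, risingBracket br δ (x i + X j - κ) (μ i) / risingBracket br δ (x i + X j)
          (μ i) := by
    simp only [risingProd, prod_div_distrib, Pi.neg_apply, sub_neg_eq_add, add_sub_assoc]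
  have r₅ := risingProd_step_ratio (x := x) (Y := Y) (fun i j => hg.cross (Sum.inl i) (Sum.inr j)) μ
  have r₆ := risingProd_indicator_shift_ratio (κ := κ) (y := y) (X := X)
    (fun i j => hg.cross (Sum.inr i) (Sum.inl j)) I
  have r₇ : risingProd br δ y (-fun j => Y j + δ) (indicatorNat I)
        / risingProd br δ y (-Y) (indicatorNat I)
      = ∏ i ∈ I, ∏ j, br (y i + Y j + δ) / br (y i + Y j) := by
    simp only [risingProd_indicatorNat, prod_div_distrib, Pi.neg_apply, sub_neg_eq_add, add_assoc]
  have hC : Coef br δ κ μ I x y = (-1) ^ I.card * (-1) ^ (∑ i, μ i)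
      * (risingProd br δ x (fun i => x i - κ) μ / risingProd br δ x (shiftBy δ x μ) μ)
      * (risingProd br δ x (fun j => y j + δ) μ * risingProd br δ y (fun i => x i - κ)
          (indicatorNat I)
        / (risingProd br δ x (shiftBy δ y (indicatorNat I)) μ
          * risingProd br δ y (shiftBy δ x μ) (indicatorNat I)))
      * (risingProd br δ y (fun j => y j + δ) (indicatorNat I)
        / risingProd br δ y (shiftBy δ y (indicatorNat I)) (indicatorNat I)) := by
    rw [r₂, r₃, mul_assoc ((-1) ^ I.card), ← r₁, Coef]
    ring
  simp only [kajiharaTerm, ← Sum.elim_neg_neg, shiftBy_sum_elim, risingProd_sum_elim, kernelWeight]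
  rw [← r₄, ← r₅, ← r₆, ← r₇, hC]
  ring

end TermIdentity

section Symmetry
variable {br : ℂ → ℂ} {δ κ : ℂ} {m r n s : ℕ}

lemma kajiharaTerm_eq_zero_of_two_le (hb : IsBracket br) {B : Type*} [Fintype B]
    (x c : Fin m → ℂ) (y : Fin r → ℂ) (Z u : B → ℂ) {μ : Fin m ⊕ Fin r → ℕ} {j : Fin r}
    (hj : 2 ≤ μ (Sum.inr j)) :
    kajiharaTerm br δ (Sum.elim x y) (Sum.elim c fun j => y j + δ) Z u μ = 0 := by
  obtain ⟨t, ht⟩ := Nat.exists_eq_add_of_le' hj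
  have : risingProd br δ (Sum.elim x y) (Sum.elim c fun j => y j + δ) μ = 0 :=
    prod_eq_zero (mem_univ (Sum.inr j)) (prod_eq_zero (mem_univ (Sum.inr j)) (by
      simp [ht, risingBracket_succ_left, bracket_zero hb]))
  simp [kajiharaTerm, this]

lemma sum_indicatorNat (I : Finset (Fin r)) : ∑ j, indicatorNat I j = I.card := by
  simp [indicatorNat]

lemma indicatorNat_injective {α : Type*} [DecidableEq α] :
    Function.Injective (indicatorNat : Finset α → α → ℕ) := fun I J h => by
  ext j
  have := congrFun h j
  by_cases hI : j ∈ I <;> by_cases hJ : j ∈ J <;> simp_all [indicatorNat]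

lemma mem_idxSet {k : ℕ} {p : (Fin m → ℕ) × Finset (Fin r)} :
    p ∈ idxSet m r k ↔ ∑ i, p.1 i + p.2.card = k := by
  simp only [idxSet, mem_filter, mem_product, Fintype.mem_piFinset, mem_range, mem_univ, and_true,
    and_iff_right_iff_imp]
  intro h i
  have := single_le_sum (f := p.1) (fun _ _ => Nat.zero_le _) (mem_univ i)
  omega

/-- The reduced action is one side of the Kajihara–Noumi transformation. -/
lemma reducedAction_eq_sum_kajiharaTerm (hb : IsBracket br) {x : Fin m → ℂ} {y : Fin r → ℂ}
    {X : Fin n → ℂ} {Y : Fin s → ℂ} (hg : GenericPoles br δ (Sum.elim x y) (Sum.elim X Y)) (k : ℕ) :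
    reducedAction br δ κ k x y X Y
      = (-1) ^ k * ((∏ i, ∏ j, br (x i + Y j)) * ∏ i, ∏ j, br (y i + X j))
        * ∑ μ ∈ piAntidiag univ k,
          kajiharaTerm br δ (Sum.elim x y) (Sum.elim (fun i => x i - κ) fun j => y j + δ)
            (Sum.elim X Y) (Sum.elim (fun i => X i - κ) fun j => Y j + δ) μ := by
  rw [reducedAction, mul_sum]
  refine sum_of_injOn (fun p => Sum.elim p.1 (indicatorNat p.2)) (fun p _ q _ h => ?_)
    (fun p hp => ?_) (fun μ hμ hn => ?_) fun p hp => ?_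
  · exact Prod.ext (funext fun i => congrFun h (Sum.inl i))
      (indicatorNat_injective (funext fun j => congrFun h (Sum.inr j)))
  · simpa [mem_piAntidiag, sum_indicatorNat] using mem_idxSet.mp hp
  · have : ∃ j, 2 ≤ μ (Sum.inr j) := by
      by_contra! hlt
      have e : indicatorNat (univ.filter fun j => μ (Sum.inr j) = 1) = fun j => μ (Sum.inr j) := by
        funext j
        have := hlt j
        simp only [indicatorNat, mem_filter, mem_univ, true_and]
        split_ifs <;> omega
      refine hn ⟨(fun i => μ (Sum.inl i), univ.filter fun j => μ (Sum.inr j) = 1), ?_, ?_⟩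
      · rw [mem_coe, mem_idxSet, ← sum_indicatorNat, e]
        simpa using (mem_piAntidiag.mp hμ).1
      · funext l
        rcases l with i | j
        · rfl
        · exact congrFun e j
    obtain ⟨j, hj⟩ := this
    rw [kajiharaTerm_eq_zero_of_two_le hb _ _ _ _ _ hj, mul_zero]
  · rw [coef_mul_kernelWeight hb hg, mem_idxSet.mp hp]

lemma reducedAction_symm_of_genericPoles (hb : IsBracket br)
    (hbal : ((m : ℂ) - n) * κ = ((r : ℂ) - s) * δ) {x : Fin m → ℂ} {y : Fin r → ℂ}
    {X : Fin n → ℂ} {Y : Fin s → ℂ} (hg : GenericPoles br δ (Sum.elim x y) (Sum.elim X Y)) (k : ℕ) :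
    reducedAction br δ κ k x y X Y = reducedAction br δ κ k X Y x y := by
  rw [reducedAction_eq_sum_kajiharaTerm hb hg, reducedAction_eq_sum_kajiharaTerm hb hg.symm,
    sum_kajiharaTerm_comm hb hg]
  · rw [prod_comm, prod_comm (s := (univ : Finset (Fin r)))]
    simp only [add_comm]
    ring
  · simp [sum_add_distrib, sum_sub_distrib]
    linear_combination hbal

end Symmetry

section Perturbation
variable {br : ℂ → ℂ} {δ κ : ℂ} {m r n s : ℕ}

/-- Any configuration of poles becomes generic after a suitable linear perturbation. -/
lemma exists_residual_genericPoles {A B : Type*} [Finite A] [Finite B] (hb : IsBracket br)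
    (hδ : ∀ n : ℤ, n ≠ 0 → br (n * δ) ≠ 0) (z : A → ℂ) (Z : B → ℂ) :
    ∃ (a : A → ℂ) (b : B → ℂ), ∀ᶠ ε in residual ℂ,
      GenericPoles br δ (fun i => z i + a i * ε) fun l => Z l + b l * ε := by
  have aux := residual_forall_bracket_ne_zero hb δ
  obtain ⟨a, ha⟩ := exists_injective_nat A
  obtain ⟨b, hb'⟩ := exists_injective_nat B
  refine ⟨fun i => a i + 1, fun l => b l + 1, ?_⟩
  have h₁ : ∀ᶠ ε in residual ℂ, ∀ i j, i ≠ j → ∀ n : ℤ,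
      br (z i - z j + ((a i : ℂ) - a j) * ε + n * δ) ≠ 0 :=
    eventually_countable_forall.mpr fun i => eventually_countable_forall.mpr fun j =>
      eventually_countable_forall.mpr fun hij =>
        aux _ _ (sub_ne_zero.mpr (by exact_mod_cast ha.ne hij))
  have h₂ : ∀ᶠ ε in residual ℂ, ∀ i j, i ≠ j → ∀ n : ℤ,
      br (Z i - Z j + ((b i : ℂ) - b j) * ε + n * δ) ≠ 0 :=
    eventually_countable_forall.mpr fun i => eventually_countable_forall.mpr fun j =>
      eventually_countable_forall.mpr fun hij =>
        aux _ _ (sub_ne_zero.mpr (by exact_mod_cast hb'.ne hij))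
  have h₃ : ∀ᶠ ε in residual ℂ, ∀ i j, ∀ n : ℤ,
      br (z i + Z j + ((a i + b j + 2 : ℕ) : ℂ) * ε + n * δ) ≠ 0 :=
    eventually_countable_forall.mpr fun i => eventually_countable_forall.mpr fun j =>
      aux _ _ (Nat.cast_ne_zero.mpr (by omega))
  filter_upwards [h₁, h₂, h₃] with ε h₁ h₂ h₃
  refine ⟨hδ, fun i j hij t => ?_, fun i j hij t => ?_, fun i j t => ?_⟩
  · convert h₁ i j hij t using 2; ring
  · convert h₂ i j hij t using 2; ring
  · convert h₃ i j t using 2; push_cast; ring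

lemma continuousAt_coef (hb : IsBracket br) {μ : Fin m → ℕ} {I : Finset (Fin r)}
    {x : ℂ → Fin m → ℂ} {y : ℂ → Fin r → ℂ} (hx : Continuous x) (hy : Continuous y) {ε₀ : ℂ}
    (h : CDenomNZ br δ μ I (x ε₀) (y ε₀)) :
    ContinuousAt (fun ε => Coef br δ κ μ I (x ε) (y ε)) ε₀ := by
  have hc := hb.entire.continuous
  obtain ⟨h₁, h₂, h₃, h₄, h₅⟩ := h
  unfold Coef
  refine ContinuousAt.mul (ContinuousAt.mul (ContinuousAt.mul (ContinuousAt.mul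
    continuousAt_const ?_) ?_) ?_) ?_
  · refine tendsto_finsetProd _ fun i _ => tendsto_finsetProd _ fun j _ => ?_
    split_ifs with hij
    · exact ContinuousAt.div (by fun_prop) (by fun_prop) (h₁ i j hij)
    · exact tendsto_const_nhds
  · exact tendsto_finsetProd _ fun i hi => tendsto_finsetProd _ fun j hj =>
      ContinuousAt.div (by fun_prop) (by fun_prop) (h₂ i hi j hj)
  · refine tendsto_finsetProd _ fun i _ => tendsto_finsetProd _ fun j _ =>
      ContinuousAt.div ?_ ?_ (h₃ i j)
    · simp only [sfac_natCast, risingBracket]; fun_prop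
    · simp only [sfac_natCast, risingBracket]; fun_prop
  · exact tendsto_finsetProd _ fun i _ => ContinuousAt.mul
      (tendsto_finsetProd _ fun j hj =>
        ContinuousAt.div (by fun_prop) (by fun_prop) (h₄ i j hj))
      (tendsto_finsetProd _ fun j hj =>
        ContinuousAt.div (by fun_prop) (by fun_prop) (h₅ i j hj))

lemma continuousAt_kernelWeight (hb : IsBracket br) {μ : Fin m → ℕ} {I : Finset (Fin r)}
    {x : ℂ → Fin m → ℂ} {y : ℂ → Fin r → ℂ} {X : ℂ → Fin n → ℂ} {Y : ℂ → Fin s → ℂ}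
    (hx : Continuous x) (hy : Continuous y) (hX : Continuous X) (hY : Continuous Y) {ε₀ : ℂ}
    (hxX : ∀ i j (t : ℕ), t < μ i → br (x ε₀ i + X ε₀ j + t * δ) ≠ 0)
    (hyY : ∀ i j, br (y ε₀ i + Y ε₀ j) ≠ 0) :
    ContinuousAt (fun ε => kernelWeight br δ κ μ I (x ε) (y ε) (X ε) (Y ε)) ε₀ := by
  have hc := hb.entire.continuous
  unfold kernelWeight
  refine ContinuousAt.mul (ContinuousAt.mul (ContinuousAt.mul ?_ ?_) ?_) ?_
  · refine tendsto_finsetProd _ fun i _ => tendsto_finsetProd _ fun j _ =>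
      ContinuousAt.div ?_ ?_ (risingBracket_ne_zero (hxX i j))
    · unfold risingBracket; fun_prop
    · unfold risingBracket; fun_prop
  · exact tendsto_finsetProd _ fun i _ => tendsto_finsetProd _ fun j _ =>
      ContinuousAt.div (by fun_prop) (by fun_prop) (hyY i j)
  · unfold xshift; fun_prop
  · unfold yshift; fun_prop

lemma continuousAt_reducedAction (hb : IsBracket br) {k : ℕ}
    {x : ℂ → Fin m → ℂ} {y : ℂ → Fin r → ℂ} {X : ℂ → Fin n → ℂ} {Y : ℂ → Fin s → ℂ}
    (hx : Continuous x) (hy : Continuous y) (hX : Continuous X) (hY : Continuous Y) {ε₀ : ℂ}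
    (hC : ∀ p ∈ idxSet m r k, CDenomNZ br δ p.1 p.2 (x ε₀) (y ε₀))
    (hxX : ∀ i j (t : ℕ), t < k → br (x ε₀ i + X ε₀ j + t * δ) ≠ 0)
    (hyY : ∀ i j, br (y ε₀ i + Y ε₀ j) ≠ 0) :
    ContinuousAt (fun ε => reducedAction br δ κ k (x ε) (y ε) (X ε) (Y ε)) ε₀ := by
  refine tendsto_finsetSum _ fun p hp => ContinuousAt.mul (continuousAt_coef hb hx hy (hC p hp))
    (continuousAt_kernelWeight hb hx hy hX hY (fun i j t ht => hxX i j t (ht.trans_le ?_)) hyY)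
  have := single_le_sum (f := p.1) (fun _ _ => Nat.zero_le _) (mem_univ i)
  have := mem_idxSet.mp hp
  omega

lemma reducedAction_symm (hb : IsBracket br) (hδ : ∀ n : ℕ, 1 ≤ n → br (n * δ) ≠ 0)
    (hbal : ((m : ℂ) - n) * κ = ((r : ℂ) - s) * δ) {k : ℕ} {x : Fin m → ℂ} {y : Fin r → ℂ}
    {X : Fin n → ℂ} {Y : Fin s → ℂ}
    (hL : ∀ p ∈ idxSet m r k, CDenomNZ br δ p.1 p.2 x y)
    (hR : ∀ p ∈ idxSet n s k, CDenomNZ br δ p.1 p.2 X Y)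
    (hxX : ∀ i j (t : ℕ), t < k → br (x i + X j + t * δ) ≠ 0)
    (hyY : ∀ i j, br (y i + Y j) ≠ 0) :
    reducedAction br δ κ k x y X Y = reducedAction br δ κ k X Y x y := by
  have hstep : ∀ n : ℤ, n ≠ 0 → br (n * δ) ≠ 0 := fun n hn => by
    obtain ⟨t, rfl | rfl⟩ := n.eq_nat_or_neg
    · exact_mod_cast hδ t (by omega)
    · have := hδ t (by omega)
      push_cast
      rwa [neg_mul, hb.odd, neg_ne_zero]
  obtain ⟨a, b, hab⟩ := exists_residual_genericPoles hb hstep (Sum.elim x y) (Sum.elim X Y)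
  set x' : ℂ → Fin m → ℂ := fun ε i => x i + a (Sum.inl i) * ε
  set y' : ℂ → Fin r → ℂ := fun ε i => y i + a (Sum.inr i) * ε
  set X' : ℂ → Fin n → ℂ := fun ε i => X i + b (Sum.inl i) * ε
  set Y' : ℂ → Fin s → ℂ := fun ε i => Y i + b (Sum.inr i) * ε
  have hx : Continuous x' := by fun_prop
  have hy : Continuous y' := by fun_prop
  have hX : Continuous X' := by fun_prop
  have hY : Continuous Y' := by fun_prop
  have x0 : x' 0 = x := by simp [x']
  have y0 : y' 0 = y := by simp [y']
  have X0 : X' 0 = X := by simp [X']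
  have Y0 : Y' 0 = Y := by simp [Y']
  have c₁ := continuousAt_reducedAction (κ := κ) hb hx hy hX hY (ε₀ := 0) (by rwa [x0, y0])
    (by rwa [x0, X0]) (by rwa [y0, Y0])
  have c₂ := continuousAt_reducedAction (κ := κ) hb hX hY hx hy (ε₀ := 0) (by rwa [X0, Y0])
    (by rw [x0, X0]; exact fun i j => by rw [add_comm (X i)]; exact hxX j i)
    (by rw [y0, Y0]; exact fun i j => by rw [add_comm (Y i)]; exact hyY j i)
  have hd := dense_of_mem_residual hab
  have := mem_closure_iff_nhdsWithin_neBot.mp (hd 0)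
  have h := tendsto_nhds_unique_of_eventuallyEq
    (l := nhdsWithin 0 {ε | GenericPoles br δ (fun i => Sum.elim x y i + a i * ε)
      fun l => Sum.elim X Y l + b l * ε}) (c₁.mono_left nhdsWithin_le_nhds)
    (c₂.mono_left nhdsWithin_le_nhds) (by
      filter_upwards [self_mem_nhdsWithin] with ε hε
      refine reducedAction_symm_of_genericPoles hb hbal ?_ k
      convert hε using 1 <;>
      · funext l
        cases l <;> rfl)
  simpa only [x0, y0, X0, Y0] using h

end Perturbation

/-- Kernel function identity: under the balancing condition
`(m-n)κ = (r-s)δ`, `H_{m,r}^{(k)}` acting on `(x; y)` and `H_{n,s}^{(k)}` acting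
on `(X; Y)` give the same result when applied to `Φ`, at every admissible point. -/
theorem kernel_function_identity
    (br : ℂ → ℂ) (hodd : ∀ z : ℂ, br (-z) = -br z)
    (hent : Differentiable ℂ br) (hnz : br ≠ 0)
    (hW : ∀ a b c d : ℂ,
      br (a + b) * br (a - b) * br (c + d) * br (c - d)
        + br (a + d) * br (a - d) * br (b + c) * br (b - c)
        = br (a + c) * br (a - c) * br (b + d) * br (b - d))
    (δ κ : ℂ)
    (hδ : ∀ n : ℕ, 1 ≤ n → br ((n : ℂ) * δ) ≠ 0)
    (hκ : ∀ n : ℕ, 1 ≤ n → br ((n : ℂ) * κ) ≠ 0)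
    (m r n s k : ℕ)
    (hbal : ((m : ℂ) - (n : ℂ)) * κ = ((r : ℂ) - (s : ℂ)) * δ)
    (G₁ G₂ : ℂ → ℂ)
    (hG₁ : ∀ z : ℂ, G₁ (z + δ) = br z * G₁ z)
    (hG₂ : ∀ z : ℂ, G₂ (z - κ) = br z * G₂ z)
    (x : Fin m → ℂ) (y : Fin r → ℂ) (X : Fin n → ℂ) (Y : Fin s → ℂ)
    (hL : ∀ p ∈ idxSet m r k, CDenomNZ br δ p.1 p.2 x y)
    (hR : ∀ p ∈ idxSet n s k, CDenomNZ br δ p.1 p.2 X Y)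
    (hG₁nz : ∀ (i : Fin m) (j : Fin n) (c : ℕ), c ≤ k →
      G₁ (x i + X j + (c : ℂ) * δ) ≠ 0)
    (hG₂nz : ∀ (i : Fin r) (j : Fin s) (c : ℕ), c ≤ 1 →
      G₂ (y i + Y j - (c : ℂ) * κ) ≠ 0) :
    Hop br δ κ m r k (fun x' y' => Phi br G₁ G₂ δ κ x' y' X Y) x y
      = Hop br δ κ n s k (fun X' Y' => Phi br G₁ G₂ δ κ x y X' Y') X Y := by
  refine Hop_Phi_eq_of_reducedAction_eq hG₁ hG₂
    (reducedAction_symm ⟨hodd, hent, hnz, hW⟩ hδ hbal hL hR (fun i j t ht h0 => ?_)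
      fun i j h0 => ?_)
  · refine hG₁nz i j (t + 1) ht ?_
    rw [show x i + X j + ((t + 1 : ℕ) : ℂ) * δ = x i + X j + t * δ + δ by push_cast; ring, hG₁, h0,
      zero_mul]
  · refine hG₂nz i j 1 le_rfl ?_
    rw [Nat.cast_one, one_mul, hG₂, h0, zero_mul]
end

section
/- Source identity for commutativity (Proposition): fix λ ∈ ℤ_{≥0}^m and for k ∈ ℤ define S_k := Σ over pairs (μ, P) with μ ∈ ℤ^m, 0 ≤ μ_j ≤ λ_j for 1 ≤ j ≤ m, P ⊆ {1,…,r}, and |μ|+|P| = k, of the product ∏_{i∈P, j∈P^c} ([y_i−y_j−δ][y_i−y_j+δ−κ])/([y_i−y_j][y_i−y_j−κ]) · ∏_{i,j=1}^m ( [x_i−x_j+δ]_{μ_i−μ_j}/[x_i−x_j+κ; δ]_{μ_i−μ_j} · ([x_i−x_j+κ; δ]_{μ_i} [x_i−x_j−λ_jδ]_{μ_i})/([x_i−x_j+δ]_{μ_i} [x_i−x_j−(λ_j−1)δ−κ]_{μ_i}) ) · ∏_{i=1}^m ( ∏_{j∈P} ([x_i−y_j+λ_iδ][x_i−y_j+(μ_i−1)δ+κ])/([x_i−y_j+μ_iδ][x_i−y_j+(λ_i−1)δ+κ])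 · ∏_{j∈P^c} ([x_i−y_j−δ][x_i−y_j+μ_iδ−κ])/([x_i−y_j−κ][x_i−y_j+(μ_i−1)δ]) ). Then for every k with 0 ≤ k ≤ |λ|+r and every point (x, y) ∈ ℂ^m × ℂ^r at which all bracket values occurring in denominators of the terms of S_k and S_{|λ|+r−k} are nonzero, one has S_k = S_{|λ|+r−k}. -/
open Finset

/-- The summand of `S_k` (Proposition on the source identity for commutativity). -/
noncomputable def Sterm (br : ℂ → ℂ) (δ κ : ℂ) {m r : ℕ} (lam : Fin m → ℕ)
    (μ : Fin m → ℕ) (P : Finset (Fin r)) (x : Fin m → ℂ) (y : Fin r → ℂ) : ℂ :=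
  (∏ i ∈ P, ∏ j ∈ Pᶜ,
      (br (y i - y j - δ) * br (y i - y j + δ - κ)) / (br (y i - y j) * br (y i - y j - κ)))
    * (∏ i : Fin m, ∏ j : Fin m,
        (sfac br δ (x i - x j + δ) ((μ i : ℤ) - (μ j : ℤ))
            / sfac br δ (x i - x j + κ) ((μ i : ℤ) - (μ j : ℤ)))
          * ((sfac br δ (x i - x j + κ) (μ i : ℤ)
                * sfac br δ (x i - x j - (lam j : ℂ) * δ) (μ i : ℤ))
              / (sfac br δ (x i - x j + δ) (μ i : ℤ)
                * sfac br δ (x i - x j - ((lam j : ℂ) - 1) * δ - κ) (μ i : ℤ))))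
    * ∏ i : Fin m,
        ((∏ j ∈ P,
            (br (x i - y j + (lam i : ℂ) * δ) * br (x i - y j + ((μ i : ℂ) - 1) * δ + κ))
              / (br (x i - y j + (μ i : ℂ) * δ) * br (x i - y j + ((lam i : ℂ) - 1) * δ + κ)))
          * ∏ j ∈ Pᶜ,
            (br (x i - y j - δ) * br (x i - y j + (μ i : ℂ) * δ - κ))
              / (br (x i - y j - κ) * br (x i - y j + ((μ i : ℂ) - 1) * δ)))

/-- Index set of `S_k`: pairs `(μ, P)` with `0 ≤ μ_j ≤ λ_j`, `P ⊆ {1,…,r}`, `|μ|+|P| = k`. -/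
def SIdx {m : ℕ} (lam : Fin m → ℕ) (r k : ℕ) : Finset ((Fin m → ℕ) × Finset (Fin r)) :=
  ((Fintype.piFinset fun j : Fin m => Finset.range (lam j + 1)) ×ˢ
      (Finset.univ : Finset (Finset (Fin r)))).filter
    fun p => (∑ i, p.1 i) + p.2.card = k

/-- The sum `S_k`. -/
noncomputable def Ssum (br : ℂ → ℂ) (δ κ : ℂ) {m : ℕ} (lam : Fin m → ℕ) (r k : ℕ)
    (x : Fin m → ℂ) (y : Fin r → ℂ) : ℂ :=
  ∑ p ∈ SIdx lam r k, Sterm br δ κ lam p.1 p.2 x y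

/-- Nonvanishing of all bracket values occurring in denominators of a term of `S_k`. -/
def SDenomNZ (br : ℂ → ℂ) (δ κ : ℂ) {m r : ℕ} (lam : Fin m → ℕ)
    (μ : Fin m → ℕ) (P : Finset (Fin r)) (x : Fin m → ℂ) (y : Fin r → ℂ) : Prop :=
  (∀ i ∈ P, ∀ j ∈ Pᶜ, br (y i - y j) ≠ 0 ∧ br (y i - y j - κ) ≠ 0)
    ∧ (∀ i j : Fin m,
        (if (0 : ℤ) ≤ (μ i : ℤ) - (μ j : ℤ) then
            sfac br δ (x i - x j + κ) ((μ i : ℤ) - (μ j : ℤ)) ≠ 0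
          else sfac br δ (x i - x j + δ) ((μ i : ℤ) - (μ j : ℤ)) ≠ 0)
          ∧ sfac br δ (x i - x j + δ) (μ i : ℤ) ≠ 0
          ∧ sfac br δ (x i - x j - ((lam j : ℂ) - 1) * δ - κ) (μ i : ℤ) ≠ 0)
    ∧ (∀ i : Fin m, ∀ j ∈ P,
        br (x i - y j + (μ i : ℂ) * δ) ≠ 0
          ∧ br (x i - y j + ((lam i : ℂ) - 1) * δ + κ) ≠ 0)
    ∧ (∀ i : Fin m, ∀ j ∈ Pᶜ,
        br (x i - y j - κ) ≠ 0 ∧ br (x i - y j + ((μ i : ℂ) - 1) * δ) ≠ 0)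

/-- An odd, nonzero entire function satisfying the three-term (Weierstrass) relation. -/
structure IsBracket_s7 (br : ℂ → ℂ) : Prop where
  odd : ∀ z : ℂ, br (-z) = -br z
  entire : Differentiable ℂ br
  ne_zero : br ≠ 0
  three_term : ∀ a b c d : ℂ,
    br (a + b) * br (a - b) * br (c + d) * br (c - d)
      + br (a + d) * br (a - d) * br (b + c) * br (b - c)
      = br (a + c) * br (a - c) * br (b + d) * br (b - d)

/-- The product `∏ [u - c]` over a multiset of zeros `c`. -/
noncomputable def thetaProd (br : ℂ → ℂ) (a : Multiset ℂ) (u : ℂ) : ℂ :=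
  (a.map fun c => br (u - c)).prod

/-- The span of the products of `N` brackets `[u - c]` whose zeros `c` add up to `s`. -/
def thetaSpace (br : ℂ → ℂ) (N : ℕ) (s : ℂ) : Submodule ℂ (ℂ → ℂ) :=
  Submodule.span ℂ {φ | ∃ a : Multiset ℂ, a.card = N ∧ a.sum = s ∧ φ = thetaProd br a}

namespace IsBracket_s7

variable {br : ℂ → ℂ}

lemma zero (h : IsBracket_s7 br) : br 0 = 0 := by
  have := h.odd 0
  rw [neg_zero] at this
  exact self_eq_neg.mp this

lemma sub_comm (h : IsBracket_s7 br) (a b : ℂ) : br (a - b) = -br (b - a) := by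
  rw [← h.odd, neg_sub]

lemma countable_zeros (h : IsBracket_s7 br) : {z | br z = 0}.Countable := by
  have han : AnalyticOnNhd ℂ br Set.univ := fun z _ => h.entire.analyticAt z
  obtain ⟨x, hx⟩ : ∃ x, br x ≠ 0 := by
    by_contra! hc
    exact h.ne_zero (funext hc)
  have hd := han.preimage_zero_mem_codiscrete hx
  have hdisc : IsDiscrete {z | br z = 0} := by
    have := isDiscrete_of_codiscreteWithin (s := {z | br z = 0}) (U := Set.univ) hd
    simpa using this
  have := hdisc.to_subtype
  exact Set.countable_coe_iff.mp (countable_of_Lindelof_of_discrete (X := {z | br z = 0}))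

/-- Countably many nonconstant affine functions avoid the zeros of the bracket on a dense set. -/
lemma dense_affine_ne_zero (h : IsBracket_s7 br) {Q : Type*} [Countable Q] (α β : Q → ℂ)
    (hβ : ∀ q, β q ≠ 0) : Dense {t : ℂ | ∀ q, br (α q + β q * t) ≠ 0} := by
  have hc : (⋃ q, {t : ℂ | br (α q + β q * t) = 0}).Countable := by
    refine Set.countable_iUnion fun q => ?_
    exact h.countable_zeros.preimage_of_injOn (f := fun t => α q + β q * t)
      (fun s _ t _ hst => by simpa [hβ q] using hst)
  convert hc.dense_compl ℂ using 1
  ext t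
  simp

lemma pair_interpolation (h : IsBracket_s7 br) (p q z a₁ a₂ : ℂ) :
    br (q - p) * br (q + p - (a₁ + a₂)) * (br (z - a₁) * br (z - a₂))
      = br (q - a₁) * br (q - a₂) * (br (z - p) * br (z - (a₁ + a₂ - p)))
        - br (p - a₁) * br (p - a₂) * (br (z - q) * br (z - (a₁ + a₂ - q))) := by
  have := h.three_term (z - (a₁ + a₂) / 2) ((a₁ - a₂) / 2) (q - (a₁ + a₂) / 2) (p - (a₁ + a₂) / 2)
  have e := h.odd (p - a₁)
  have e' := h.odd (q - a₁)
  ring_nf at this e e' ⊢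
  rw [e, e'] at this
  linear_combination this

lemma continuous (h : IsBracket_s7 br) : Continuous br := h.entire.continuous

lemma thetaProd_cons (c : ℂ) (a : Multiset ℂ) (u : ℂ) :
    thetaProd br (c ::ₘ a) u = br (u - c) * thetaProd br a u := by
  simp [thetaProd]

lemma sum_thetaProd_cons_mem (h : IsBracket_s7 br) {S : Finset ℂ} {p : ℂ} (hp : p ∈ S)
    (hS : ∀ b ∈ S, ∀ c ∈ S, b ≠ c → br (b - c) ≠ 0) (a : Multiset ℂ) :
    ∑ b ∈ S, thetaProd br (p ::ₘ a) b / ∏ c ∈ S.erase b, br (b - c)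
      = ∑ b ∈ S.erase p, thetaProd br a b / ∏ c ∈ (S.erase p).erase b, br (b - c) := by
  rw [← Finset.add_sum_erase _ _ hp, thetaProd_cons, sub_self, h.zero]
  simp only [zero_mul, zero_div, zero_add]
  refine Finset.sum_congr rfl fun b hb => ?_
  obtain ⟨hbp, hbS⟩ := Finset.mem_erase.mp hb
  rw [thetaProd_cons, Finset.erase_right_comm,
    ← Finset.mul_prod_erase (S.erase b) (fun c => br (b - c)) (Finset.mem_erase.mpr ⟨hbp.symm, hp⟩),
    mul_div_mul_left _ _ (hS b hbS p hp hbp)]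

/-- The partial fraction identity, a consequence of the three-term relation. -/
theorem sum_thetaProd_div_eq_zero (h : IsBracket_s7 br) (S : Finset ℂ)
    (hS : ∀ b ∈ S, ∀ c ∈ S, b ≠ c → br (b - c) ≠ 0) (a : Multiset ℂ)
    (hcard : a.card = S.card) (hsum : a.sum = ∑ b ∈ S, b) :
    ∑ b ∈ S, thetaProd br a b / ∏ c ∈ S.erase b, br (b - c) = 0 := by
  induction hn : S.card generalizing S a with
  | zero => simp [Finset.card_eq_zero.mp hn]
  | succ n ih =>
    have key : ∀ p ∈ S, ∀ r : Multiset ℂ, r.card = n → p + r.sum = ∑ b ∈ S, b →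
        ∑ b ∈ S, thetaProd br (p ::ₘ r) b / ∏ c ∈ S.erase b, br (b - c) = 0 := by
      intro p hp r hr hsr
      rw [h.sum_thetaProd_cons_mem hp hS]
      have hc : (S.erase p).card = n := by rw [Finset.card_erase_of_mem hp, hn]; rfl
      refine ih (S.erase p) (fun b hb c hc => hS b (Finset.mem_of_mem_erase hb) c
        (Finset.mem_of_mem_erase hc)) r (by omega) ?_ hc
      rw [← Finset.add_sum_erase _ _ hp] at hsr
      exact add_left_cancel hsr
    match n with
    | 0 =>
      obtain ⟨p, rfl⟩ := Finset.card_eq_one.mp hn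
      obtain ⟨c, rfl⟩ := Multiset.card_eq_one.mp (hcard.trans hn)
      obtain rfl : c = p := by simpa using hsum
      exact key c (by simp) 0 rfl (by simp)
    | 1 =>
      obtain ⟨p, q, hpq, rfl⟩ := Finset.card_eq_two.mp hn
      obtain ⟨c, d, rfl⟩ := Multiset.card_eq_two.mp (hcard.trans hn)
      have hcd : c + d = p + q := by simpa [hpq] using hsum
      obtain rfl : d = p + q - c := by linear_combination hcd
      have hne := hS p (by simp) q (by simp) hpq
      rw [Finset.sum_pair hpq, Finset.erase_insert (by simpa using hpq),
        Finset.pair_comm, Finset.erase_insert (by simpa using hpq.symm)]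
      simp only [thetaProd, Multiset.insert_eq_cons, Multiset.map_cons, Multiset.map_singleton,
        Multiset.prod_cons, Multiset.prod_singleton, Finset.prod_singleton]
      rw [h.sub_comm q p, show p - (p + q - c) = c - q by ring,
        show q - (p + q - c) = c - p by ring, h.sub_comm c q, h.sub_comm c p]
      field_simp
      ring
    | n + 2 =>
      obtain ⟨p, hp, q, hq, hpq⟩ := Finset.one_lt_card.mp (by omega : 1 < S.card)
      have hcons : ∀ (k : ℕ) (s : Multiset ℂ), s.card = k + 1 → ∃ c s', s = c ::ₘ s' :=
        fun k s hk => (Multiset.card_eq_succ_iff.mp hk).imp fun c ⟨s', e, _⟩ => ⟨s', e.symm⟩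
      obtain ⟨c₁, s, rfl⟩ := hcons _ a (hcard.trans hn)
      obtain ⟨c₂, s, rfl⟩ := hcons (n + 1) s (by simpa [hn] using hcard)
      obtain ⟨c₃, s, rfl⟩ := hcons n s (by simpa [hn] using hcard)
      have hs : s.card = n := by simpa [hn] using hcard
      simp only [Multiset.sum_cons] at hsum
      let G : ℂ → ℂ := fun t => ∑ b ∈ S,
        thetaProd br ((c₁ + t) ::ₘ c₂ ::ₘ (c₃ - t) ::ₘ s) b / ∏ c ∈ S.erase b, br (b - c)
      have hG : Continuous G := by
        have := h.continuous
        simp only [G, thetaProd_cons]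
        fun_prop
      have hd := h.dense_affine_ne_zero (fun _ : Unit => q + p - (c₁ + c₂)) (fun _ => -1) (by simp)
      have hz : Set.EqOn G (fun _ => 0) {t | ∀ _ : Unit, br (q + p - (c₁ + c₂) + -1 * t) ≠ 0} := by
        intro t ht
        have ht' : br (q + p - (c₁ + t + c₂)) ≠ 0 := by
          convert ht () using 2; ring
        have hqp := hS q hq p hp hpq.symm
        have k₁ := key p hp ((c₁ + t + c₂ - p) ::ₘ (c₃ - t) ::ₘ s) (by simp [hs])
          (by rw [← hsum]; simp only [Multiset.sum_cons]; ring)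
        have k₂ := key q hq ((c₁ + t + c₂ - q) ::ₘ (c₃ - t) ::ₘ s) (by simp [hs])
          (by rw [← hsum]; simp only [Multiset.sum_cons]; ring)
        have hm : br (q - p) * br (q + p - (c₁ + t + c₂)) * G t = 0 := by
          have e : br (q - p) * br (q + p - (c₁ + t + c₂)) * G t
              = br (q - (c₁ + t)) * br (q - c₂) * 0 - br (p - (c₁ + t)) * br (p - c₂) * 0 := by
            nth_rewrite 1 [← k₁]
            rw [← k₂, Finset.mul_sum, Finset.mul_sum, Finset.mul_sum, ← Finset.sum_sub_distrib]
            refine Finset.sum_congr rfl fun b _ => ?_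
            simp only [thetaProd_cons]
            linear_combination (br (b - (c₃ - t)) * thetaProd br s b
              / ∏ c ∈ S.erase b, br (b - c)) * h.pair_interpolation p q b (c₁ + t) c₂
          simpa using e
        simpa [hqp, ht'] using hm
      have := congrFun (hG.ext_on hd continuous_const hz) 0
      simpa [G] using this

end IsBracket_s7

namespace IsBracket_s7

variable {br : ℂ → ℂ}

/-- A theta function vanishing at its full set `S` of prescribed zeros is a constant multiple
of `∏ [u - b]`. -/
theorem thetaSpace_rigidity (h : IsBracket_s7 br) (S : Finset ℂ)
    (hS : ∀ b ∈ S, ∀ c ∈ S, b ≠ c → br (b - c) ≠ 0) {φ : ℂ → ℂ}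
    (hφ : φ ∈ thetaSpace br S.card (∑ b ∈ S, b)) (hz : ∀ b ∈ S, φ b = 0) {u w : ℂ}
    (hu : ∀ b ∈ S, br (u - b) ≠ 0) (hw : ∀ b ∈ S, br (w - b) ≠ 0) (huw : br (u - w) ≠ 0) :
    φ u * ∏ b ∈ S, br (w - b) = φ w * ∏ b ∈ S, br (u - b) := by
  have huw' : u ≠ w := by rintro rfl; exact huw (by rw [sub_self, h.zero])
  have hwu : br (w - u) ≠ 0 := by rw [h.sub_comm]; exact neg_ne_zero.mpr huw
  have hwS : w ∉ S := fun hm => hw w hm (by rw [sub_self, h.zero])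
  have huS : u ∉ insert w S := by
    rw [Finset.mem_insert, not_or]
    exact ⟨huw', fun hm => hu u hm (by rw [sub_self, h.zero])⟩
  obtain ⟨c, hc⟩ := (h.dense_affine_ne_zero (fun i : Bool => if i then u else w) (fun _ => -1)
    (by simp)).nonempty
  have hcu : br (u - c) ≠ 0 := by simpa [← sub_eq_add_neg] using hc true
  have hcw : br (w - c) ≠ 0 := by simpa [← sub_eq_add_neg] using hc false
  have hgood : ∀ b ∈ insert u (insert w S), ∀ c ∈ insert u (insert w S), b ≠ c →
      br (b - c) ≠ 0 := by
    intro b hb c hc hbc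
    simp only [Finset.mem_insert] at hb hc
    rcases hb with rfl | rfl | hb <;> rcases hc with rfl | rfl | hc
    · exact absurd rfl hbc
    · exact huw
    · exact hu c hc
    · exact hwu
    · exact absurd rfl hbc
    · exact hw c hc
    · rw [h.sub_comm]; exact neg_ne_zero.mpr (hu b hb)
    · rw [h.sub_comm]; exact neg_ne_zero.mpr (hw b hb)
    · exact hS b hb c hc hbc
  have main : ∀ ψ ∈ thetaSpace br S.card (∑ b ∈ S, b),
      ∑ b ∈ insert u (insert w S), br (b - c) * br (b - (u + w - c)) * ψ b
        / ∏ c ∈ (insert u (insert w S)).erase b, br (b - c) = 0 := by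
    intro ψ hψ
    induction hψ using Submodule.span_induction with
    | mem ψ hψ =>
      obtain ⟨a, ha, hs, rfl⟩ := hψ
      have := h.sum_thetaProd_div_eq_zero _ hgood (c ::ₘ (u + w - c) ::ₘ a)
        (by rw [Finset.card_insert_of_notMem huS, Finset.card_insert_of_notMem hwS]; simp [ha])
        (by
          rw [Finset.sum_insert huS, Finset.sum_insert hwS, ← hs]
          simp only [Multiset.sum_cons]; ring)
      simpa only [thetaProd_cons, mul_assoc] using this
    | zero => simp
    | add ψ₁ ψ₂ _ _ h₁ h₂ =>
      simp only [Pi.add_apply, mul_add, add_div, Finset.sum_add_distrib, h₁, h₂, add_zero]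
    | smul k ψ _ hk =>
      rw [← mul_zero k, ← hk, Finset.mul_sum]
      refine Finset.sum_congr rfl fun b _ => ?_
      simp only [Pi.smul_apply, smul_eq_mul]
      ring
  have hm := main φ hφ
  have e₂ : (insert u (insert w S)).erase w = insert u S := by
    rw [Finset.erase_insert_of_ne huw', Finset.erase_insert hwS]
  rw [Finset.sum_insert huS, Finset.sum_insert hwS, Finset.sum_eq_zero (s := S), add_zero,
    Finset.erase_insert huS, e₂, Finset.prod_insert hwS,
    Finset.prod_insert (fun hm => huS (Finset.mem_insert_of_mem hm)), h.sub_comm w u,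
    show u - (u + w - c) = c - w by ring, show w - (u + w - c) = c - u by ring,
    h.sub_comm c w, h.sub_comm c u] at hm
  · have hDu : ∏ b ∈ S, br (u - b) ≠ 0 := Finset.prod_ne_zero_iff.mpr hu
    have hDw : ∏ b ∈ S, br (w - b) ≠ 0 := Finset.prod_ne_zero_iff.mpr hw
    field_simp at hm
    refine mul_left_cancel₀ (mul_ne_zero hcu hcw) ?_
    linear_combination -hm
  · intro b hb
    rw [hz b hb]; simp

lemma thetaSpace_mul {N M : ℕ} {s t : ℂ} {φ ψ : ℂ → ℂ} (hφ : φ ∈ thetaSpace br N s)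
    (hψ : ψ ∈ thetaSpace br M t) : φ * ψ ∈ thetaSpace br (N + M) (s + t) := by
  have := Submodule.mul_mem_mul hφ hψ
  rw [thetaSpace, thetaSpace, Submodule.span_mul_span] at this
  refine Submodule.span_mono ?_ this
  rintro _ ⟨_, ⟨a, ha, hs, rfl⟩, _, ⟨b, hb, ht, rfl⟩, rfl⟩
  refine ⟨a + b, by simp [ha, hb], by simp [hs, ht], ?_⟩
  ext u
  simp [thetaProd]

lemma thetaSpace_prod {ι : Type*} (s : Finset ι) (N : ℕ) (c : ι → ℂ) (φ : ι → ℂ → ℂ)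
    (hφ : ∀ i ∈ s, φ i ∈ thetaSpace br N (c i)) :
    (∏ i ∈ s, φ i) ∈ thetaSpace br (s.card * N) (∑ i ∈ s, c i) := by
  classical
  induction s using Finset.induction_on with
  | empty => exact Submodule.subset_span ⟨0, by simp, by simp, by ext; simp [thetaProd]⟩
  | insert a s ha ih =>
    rw [Finset.prod_insert ha, Finset.sum_insert ha, Finset.card_insert_of_notMem ha,
      add_mul, one_mul, add_comm (s.card * N)]
    exact thetaSpace_mul (hφ a (by simp)) (ih fun i hi => hφ i (by simp [hi]))

lemma thetaSpace_triple (a b c : ℂ) :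
    (fun u => br (u - a) * br (u - b) * br (u - c)) ∈ thetaSpace br 3 (a + b + c) :=
  Submodule.subset_span ⟨{a, b, c}, by simp, by simp [add_assoc],
    by ext u; simp [thetaProd, mul_assoc]⟩

end IsBracket_s7

/-- Sum over the splittings of `s` into `I` and `s \ I`, weighted by `g i j` for `i ∈ I`,
`j ∉ I`, by `p i` for `i ∈ I` and by `q j` for `j ∉ I`. -/
def splitSum {ι : Type*} [DecidableEq ι] (s : Finset ι) (g : ι → ι → ℂ) (p q : ι → ℂ) : ℂ :=
  ∑ I ∈ s.powerset, (∏ i ∈ I, ∏ j ∈ s \ I, g i j) * (∏ i ∈ I, p i) * ∏ j ∈ s \ I, q j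

section splitSum

variable {ι : Type*} [DecidableEq ι]

lemma splitSum_congr {s : Finset ι} {g g' : ι → ι → ℂ} {p p' q q' : ι → ℂ}
    (hg : ∀ i ∈ s, ∀ j ∈ s, i ≠ j → g i j = g' i j) (hp : ∀ i ∈ s, p i = p' i)
    (hq : ∀ i ∈ s, q i = q' i) : splitSum s g p q = splitSum s g' p' q' := by
  refine Finset.sum_congr rfl fun I hI => ?_
  rw [Finset.mem_powerset] at hI
  congr 1
  · congr 1
    · refine Finset.prod_congr rfl fun i hi => Finset.prod_congr rfl fun j hj => ?_
      rw [Finset.mem_sdiff] at hj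
      exact hg i (hI hi) j hj.1 fun e => hj.2 (e ▸ hi)
    · exact Finset.prod_congr rfl fun i hi => hp i (hI hi)
  · exact Finset.prod_congr rfl fun i hi => hq i (Finset.mem_sdiff.mp hi).1

lemma splitSum_mul (s : Finset ι) (g : ι → ι → ℂ) (p q c : ι → ℂ) :
    splitSum s g (fun i => p i * c i) (fun i => q i * c i)
      = (∏ i ∈ s, c i) * splitSum s g p q := by
  rw [splitSum, splitSum, Finset.mul_sum]
  refine Finset.sum_congr rfl fun I hI => ?_
  rw [Finset.mem_powerset] at hI
  rw [Finset.prod_mul_distrib, Finset.prod_mul_distrib, ← Finset.prod_sdiff hI]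
  ring

lemma splitSum_insert {s : Finset ι} {a : ι} (ha : a ∉ s) (g : ι → ι → ℂ) (p q : ι → ℂ) :
    splitSum (insert a s) g p q
      = p a * splitSum s g p (fun j => q j * g a j)
        + q a * splitSum s g (fun i => p i * g i a) q := by
  rw [splitSum, Finset.sum_powerset_insert ha, add_comm, splitSum, splitSum, Finset.mul_sum,
    Finset.mul_sum]
  congr 1 <;> refine Finset.sum_congr rfl fun I hI => ?_ <;> rw [Finset.mem_powerset] at hI
  · have haI : a ∉ I := fun hm => ha (hI hm)
    rw [Finset.insert_sdiff_insert, Finset.prod_insert haI, Finset.prod_insert haI,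
      Finset.sdiff_insert_of_notMem ha, Finset.prod_mul_distrib]
    ring
  · have haI : a ∉ I := fun hm => ha (hI hm)
    have hm : a ∉ s \ I := fun hm => ha (Finset.mem_sdiff.mp hm).1
    rw [Finset.insert_sdiff_of_notMem _ haI, Finset.prod_insert hm, Finset.prod_mul_distrib]
    simp only [Finset.prod_insert hm, Finset.prod_mul_distrib]
    ring

end splitSum

/-- The kernel `[v - δ][v + δ - κ] / ([v][v - κ])`. -/
noncomputable def ruijKernel (br : ℂ → ℂ) (δ κ v : ℂ) : ℂ :=
  (br (v - δ) * br (v + δ - κ)) / (br v * br (v - κ))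

/-- No difference of two distinct coordinates in `s` is a zero of the bracket modulo `ℤ κ`. -/
def KappaGeneric {ι : Type*} (br : ℂ → ℂ) (κ : ℂ) (s : Finset ι) (z : ι → ℂ) : Prop :=
  ∀ i ∈ s, ∀ j ∈ s, i ≠ j → ∀ n : ℤ, br (z i - z j + n * κ) ≠ 0

/-- The difference between the generating function of the products of kernels and
its reflection. -/
noncomputable def ruijDefect {ι : Type*} [DecidableEq ι] (br : ℂ → ℂ) (δ κ X : ℂ) (s : Finset ι)
    (z : ι → ℂ) : ℂ :=
  splitSum s (fun i j => ruijKernel br δ κ (z i - z j)) (fun _ => X) (fun _ => 1)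
    - splitSum s (fun i j => ruijKernel br δ κ (z j - z i)) (fun _ => X) (fun _ => 1)

namespace IsBracket_s7

variable {br : ℂ → ℂ} {δ κ : ℂ} {ι : Type*} [DecidableEq ι]

lemma ruijKernel_reflect (h : IsBracket_s7 br) (v : ℂ) :
    ruijKernel br δ κ (κ - v) = ruijKernel br δ κ v := by
  have e₁ : br (κ - v - δ) = -br (v + δ - κ) := by rw [← h.odd]; ring_nf
  have e₂ : br (κ - v + δ - κ) = -br (v - δ) := by rw [← h.odd]; ring_nf
  have e₃ : br (κ - v) = -br (v - κ) := by rw [← h.odd]; ring_nf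
  have e₄ : br (κ - v - κ) = -br v := by rw [← h.odd]; ring_nf
  simp only [ruijKernel, e₁, e₂, e₃, e₄, neg_mul_neg]
  ring

lemma splitSum_mem_thetaSpace (s : Finset ι) (g : ι → ι → ℂ) (X : ℂ) (p q : ι → ℂ → ℂ) (N : ℕ)
    (c : ι → ℂ) (hp : ∀ i, p i ∈ thetaSpace br N (c i)) (hq : ∀ i, q i ∈ thetaSpace br N (c i)) :
    (fun u => splitSum s g (fun i => X * p i u) (fun i => q i u))
      ∈ thetaSpace br (s.card * N) (∑ i ∈ s, c i) := by
  have : (fun u => splitSum s g (fun i => X * p i u) (fun i => q i u))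
      = ∑ I ∈ s.powerset, ((∏ i ∈ I, ∏ j ∈ s \ I, g i j) * X ^ I.card) •
          ∏ i ∈ s, (if i ∈ I then p i else q i) := by
    ext u
    simp only [splitSum, Finset.sum_apply, Pi.smul_apply, Finset.prod_apply, smul_eq_mul]
    refine Finset.sum_congr rfl fun I hI => ?_
    rw [Finset.mem_powerset] at hI
    have e₁ : ∏ i ∈ I, (if i ∈ I then p i else q i) u = ∏ i ∈ I, p i u :=
      Finset.prod_congr rfl fun i hi => by rw [if_pos hi]
    have e₂ : ∏ i ∈ s \ I, (if i ∈ I then p i else q i) u = ∏ i ∈ s \ I, q i u :=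
      Finset.prod_congr rfl fun i hi => by rw [if_neg (Finset.mem_sdiff.mp hi).2]
    rw [← Finset.prod_sdiff hI, Finset.prod_mul_distrib, Finset.prod_const, e₁, e₂]
    ring
  rw [this]
  refine Submodule.sum_mem _ fun I _ => Submodule.smul_mem _ _ (thetaSpace_prod _ _ _ _ ?_)
  intro i _
  split_ifs
  exacts [hp i, hq i]

/-- One-variable rigidity: if the defect vanishes on all subsets with two fewer elements,
then it does not depend on a single coordinate. -/
lemma ruijDefect_eq_of_agree (h : IsBracket_s7 br) (hκ : ∀ n : ℤ, n ≠ 0 → br (n * κ) ≠ 0) (X : ℂ)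
    {s : Finset ι} {a : ι} (ha : a ∉ s) {z z' : ι → ℂ} (hz : KappaGeneric br κ (insert a s) z)
    (hz' : KappaGeneric br κ (insert a s) z') (hzz' : ∀ i ∈ s, z' i = z i)
    (hne : br (z a - z' a) ≠ 0)
    (ih : ∀ l ∈ s, ruijDefect br δ κ X (s.erase l) z = 0) :
    ruijDefect br δ κ X (insert a s) z = ruijDefect br δ κ X (insert a s) z' := by
  set K := ruijKernel br δ κ with hK
  set D : ι → ℂ → ℂ := fun j u => br (u - z j) * br (u - (z j + κ)) * br (u - (z j - κ)) with hD
  set F : ι → ℂ → ℂ :=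
    fun j u => br (u - (z j + δ)) * br (u - (z j - δ + κ)) * br (u - (z j - κ)) with hF
  set G : ι → ℂ → ℂ :=
    fun j u => br (u - (z j - δ)) * br (u - (z j + δ - κ)) * br (u - (z j + κ)) with hG
  have hFD : ∀ j u, D j u ≠ 0 → K (u - z j) * D j u = F j u := by
    intro j u hne
    simp only [hD, mul_ne_zero_iff] at hne
    obtain ⟨⟨h₁, h₂⟩, h₃⟩ := hne
    simp only [hK, ruijKernel, hD, hF]
    rw [show u - z j - κ = u - (z j + κ) by ring, show u - z j - δ = u - (z j + δ) by ring,
      show u - z j + δ - κ = u - (z j - δ + κ) by ring]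
    field_simp
  have hGD : ∀ j u, D j u ≠ 0 → K (z j - u) * D j u = G j u := by
    intro j u hne
    simp only [hD, mul_ne_zero_iff] at hne
    obtain ⟨⟨h₁, h₂⟩, h₃⟩ := hne
    simp only [hK, ruijKernel, hD, hG]
    rw [show z j - u - κ = -(u - (z j - κ)) by ring, show z j - u - δ = -(u - (z j - δ)) by ring,
      show z j - u + δ - κ = -(u - (z j + δ - κ)) by ring, h.odd, h.odd, h.odd, h.sub_comm (z j) u]
    field_simp
  set Num : ℂ → ℂ := fun u =>
    X * splitSum s (fun i j => K (z i - z j)) (fun i => X * D i u) (fun j => F j u)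
      + splitSum s (fun i j => K (z i - z j)) (fun i => X * G i u) (fun j => D j u)
      - X * splitSum s (fun i j => K (z j - z i)) (fun i => X * D i u) (fun j => G j u)
      - splitSum s (fun i j => K (z j - z i)) (fun i => X * F i u) (fun j => D j u) with hNum
  have hNumEq : ∀ y : ι → ℂ, (∀ i ∈ s, y i = z i) → (∀ i ∈ s, D i (y a) ≠ 0) →
      Num (y a) = (∏ i ∈ s, D i (y a)) * ruijDefect br δ κ X (insert a s) y := by
    intro y hy hDy
    have t₁ : (∏ i ∈ s, D i (y a)) * splitSum s (fun i j => K (y i - y j)) (fun _ => X)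
          (fun j => 1 * K (y a - y j))
        = splitSum s (fun i j => K (z i - z j)) (fun i => X * D i (y a)) (fun j => F j (y a)) := by
      rw [← splitSum_mul]
      exact splitSum_congr (fun i hi j hj _ => by rw [hy i hi, hy j hj]) (fun _ _ => rfl)
        fun i hi => by rw [one_mul, hy i hi, hFD i _ (hDy i hi)]
    have t₂ : (∏ i ∈ s, D i (y a)) * splitSum s (fun i j => K (y i - y j))
          (fun i => X * K (y i - y a)) (fun _ => 1)
        = splitSum s (fun i j => K (z i - z j)) (fun i => X * G i (y a)) (fun j => D j (y a)) := by
      rw [← splitSum_mul]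
      exact splitSum_congr (fun i hi j hj _ => by rw [hy i hi, hy j hj])
        (fun i hi => by rw [mul_assoc, hy i hi, hGD i _ (hDy i hi)]) fun i _ => one_mul _
    have t₃ : (∏ i ∈ s, D i (y a)) * splitSum s (fun i j => K (y j - y i)) (fun _ => X)
          (fun j => 1 * K (y j - y a))
        = splitSum s (fun i j => K (z j - z i)) (fun i => X * D i (y a)) (fun j => G j (y a)) := by
      rw [← splitSum_mul]
      exact splitSum_congr (fun i hi j hj _ => by rw [hy i hi, hy j hj]) (fun _ _ => rfl)
        fun i hi => by rw [one_mul, hy i hi, hGD i _ (hDy i hi)]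
    have t₄ : (∏ i ∈ s, D i (y a)) * splitSum s (fun i j => K (y j - y i))
          (fun i => X * K (y a - y i)) (fun _ => 1)
        = splitSum s (fun i j => K (z j - z i)) (fun i => X * F i (y a)) (fun j => D j (y a)) := by
      rw [← splitSum_mul]
      exact splitSum_congr (fun i hi j hj _ => by rw [hy i hi, hy j hj])
        (fun i hi => by rw [mul_assoc, hy i hi, hFD i _ (hDy i hi)]) fun i _ => one_mul _
    rw [ruijDefect, splitSum_insert ha, splitSum_insert ha]
    simp only [hNum, ← hK]
    linear_combination -X * t₁ - t₂ + X * t₃ + t₄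
  have hDth : ∀ j, D j ∈ thetaSpace br 3 (3 * z j) := fun j => by
    convert thetaSpace_triple (br := br) (z j) (z j + κ) (z j - κ) using 2; ring
  have hFth : ∀ j, F j ∈ thetaSpace br 3 (3 * z j) := fun j => by
    convert thetaSpace_triple (br := br) (z j + δ) (z j - δ + κ) (z j - κ) using 2; ring
  have hGth : ∀ j, G j ∈ thetaSpace br 3 (3 * z j) := fun j => by
    convert thetaSpace_triple (br := br) (z j - δ) (z j + δ - κ) (z j + κ) using 2; ring
  have hNth : Num ∈ thetaSpace br (s.card * 3) (∑ i ∈ s, 3 * z i) :=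
    Submodule.sub_mem _ (Submodule.sub_mem _ (Submodule.add_mem _
      (Submodule.smul_mem _ X (splitSum_mem_thetaSpace s _ X D F 3 _ hDth hFth))
      (splitSum_mem_thetaSpace s _ X G D 3 _ hGth hDth))
      (Submodule.smul_mem _ X (splitSum_mem_thetaSpace s _ X D G 3 _ hDth hGth)))
      (splitSum_mem_thetaSpace s _ X F D 3 _ hFth hDth)
  -- the poles in the variable `z a`
  set ε : Finset ℤ := {0, 1, -1} with hε
  set pole : ι × ℤ → ℂ := fun q => z q.1 + q.2 * κ with hpole
  have hpoles : ∀ q ∈ s ×ˢ ε, ∀ q' ∈ s ×ˢ ε, q ≠ q' → br (pole q - pole q') ≠ 0 := by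
    rintro ⟨i, e⟩ hq ⟨j, e'⟩ hq' hqq
    rw [Finset.mem_product] at hq hq'
    by_cases hij : i = j
    · subst hij
      have := hκ (e - e') (sub_ne_zero.mpr fun he => hqq (by rw [he]))
      convert this using 2
      simp only [hpole]; push_cast; ring
    · have := hz i (by simp [hq.1]) j (by simp [hq'.1]) hij (e - e')
      convert this using 2
      simp only [hpole]; push_cast; ring
  have hinj : Set.InjOn pole (s ×ˢ ε : Finset (ι × ℤ)) := by
    intro q hq q' hq' e
    by_contra hqq
    exact hpoles q hq q' hq' hqq (by rw [e, sub_self, h.zero])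
  have hprod : ∀ u, ∏ b ∈ (s ×ˢ ε).image pole, br (u - b) = ∏ i ∈ s, D i u := by
    intro u
    rw [Finset.prod_image hinj, Finset.prod_product]
    refine Finset.prod_congr rfl fun i _ => ?_
    simp [hε, hpole, hD, sub_eq_add_neg, mul_assoc]
  have hcard : ((s ×ˢ ε).image pole).card = s.card * 3 := by
    rw [Finset.card_image_of_injOn hinj, Finset.card_product]; rfl
  have hsum : ∑ b ∈ (s ×ˢ ε).image pole, b = ∑ i ∈ s, 3 * z i := by
    rw [Finset.sum_image hinj, Finset.sum_product]
    refine Finset.sum_congr rfl fun i _ => ?_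
    simp [hε, hpole]
    ring
  have hvan : ∀ b ∈ (s ×ˢ ε).image pole, Num b = 0 := by
    intro b hb
    obtain ⟨⟨l, e⟩, hq, rfl⟩ := Finset.mem_image.mp hb
    obtain ⟨hl, he⟩ := Finset.mem_product.mp hq
    simp only at hl he
    set b := pole (l, e) with hbdef
    have hDl : D l b = 0 := by
      simp only [hε, Finset.mem_insert, Finset.mem_singleton] at he
      rcases he with rfl | rfl | rfl <;> simp [hD, hbdef, hpole, h.zero]
    have hDne : ∀ j ∈ s.erase l, D j b ≠ 0 := by
      intro j hj
      obtain ⟨hjl, hjs⟩ := Finset.mem_erase.mp hj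
      have k := fun n : ℤ => hz l (by simp [hl]) j (by simp [hjs]) hjl.symm n
      simp only [hD, hbdef, hpole]
      refine mul_ne_zero (mul_ne_zero ?_ ?_) ?_
      · convert k e using 2; ring
      · convert k (e - 1) using 2; push_cast; ring
      · convert k (e + 1) using 2; push_cast; ring
    have hexp : Num b = X * (∏ i ∈ s.erase l, D i b) *
        (F l b * splitSum (s.erase l) (fun i j => K (z i - z j)) (fun i => X * K (z i - z l))
            (fun j => K (b - z j))
          + G l b * splitSum (s.erase l) (fun i j => K (z i - z j)) (fun i => X * K (z i - b))
            (fun j => K (z l - z j))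
          - G l b * splitSum (s.erase l) (fun i j => K (z j - z i)) (fun i => X * K (z l - z i))
            (fun j => K (z j - b))
          - F l b * splitSum (s.erase l) (fun i j => K (z j - z i)) (fun i => X * K (b - z i))
            (fun j => K (z j - z l))) := by
      have e₁ : ∀ (g : ι → ι → ℂ) (p q : ι → ℂ), X * (∏ i ∈ s.erase l, D i b) *
          splitSum (s.erase l) g p q
            = X * splitSum (s.erase l) g (fun i => p i * D i b) (fun i => q i * D i b) := by
        intro g p q; rw [splitSum_mul]; ring
      simp only [mul_sub, mul_add, mul_left_comm _ (F l b), mul_left_comm _ (G l b), e₁]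
      simp only [hNum]
      conv_lhs => rw [← Finset.insert_erase hl]
      simp only [splitSum_insert (Finset.notMem_erase l s), hDl, zero_mul, mul_zero, zero_add,
        add_zero]
      rw [splitSum_congr (s := s.erase l) (g := fun i j => K (z i - z j))
          (p := fun i => X * K (z i - z l) * D i b) (q := fun j => K (b - z j) * D j b)
          (p' := fun i => X * D i b * K (z i - z l)) (q' := fun j => F j b)
          (fun _ _ _ _ _ => rfl) (fun _ _ => by ring) (fun j hj => hFD j b (hDne j hj)),
        splitSum_congr (s := s.erase l) (g := fun i j => K (z i - z j))
          (p := fun i => X * K (z i - b) * D i b) (q := fun j => K (z l - z j) * D j b)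
          (p' := fun i => X * G i b) (q' := fun j => D j b * K (z l - z j))
          (fun _ _ _ _ _ => rfl) (fun i hi => by rw [← hGD i b (hDne i hi)]; ring)
          (fun j hj => mul_comm _ _),
        splitSum_congr (s := s.erase l) (g := fun i j => K (z j - z i))
          (p := fun i => X * K (z l - z i) * D i b) (q := fun j => K (z j - b) * D j b)
          (p' := fun i => X * D i b * K (z l - z i)) (q' := fun j => G j b)
          (fun _ _ _ _ _ => rfl) (fun _ _ => by ring) (fun j hj => hGD j b (hDne j hj)),
        splitSum_congr (s := s.erase l) (g := fun i j => K (z j - z i))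
          (p := fun i => X * K (b - z i) * D i b) (q := fun j => K (z j - z l) * D j b)
          (p' := fun i => X * F i b) (q' := fun j => D j b * K (z j - z l))
          (fun _ _ _ _ _ => rfl) (fun i hi => by rw [← hFD i b (hDne i hi)]; ring)
          (fun j hj => mul_comm _ _)]
      ring
    have hih : splitSum (s.erase l) (fun i j => K (z i - z j)) (fun _ => X) (fun _ => 1)
        = splitSum (s.erase l) (fun i j => K (z j - z i)) (fun _ => X) (fun _ => 1) :=
      sub_eq_zero.mp (ih l hl)
    have hfac : ∀ (g : ι → ι → ℂ) (c : ι → ℂ), splitSum (s.erase l) g (fun i => X * c i) c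
        = (∏ i ∈ s.erase l, c i) * splitSum (s.erase l) g (fun _ => X) (fun _ => 1) := by
      intro g c
      rw [← splitSum_mul]
      simp only [one_mul]
    rw [hexp]
    simp only [hε, Finset.mem_insert, Finset.mem_singleton] at he
    rcases he with rfl | rfl | rfl
    · have hb0 : b = z l := by simp [hbdef, hpole]
      have hFG : F l b = -G l b := by
        simp only [hF, hG, hb0]
        rw [show z l - (z l + δ) = -(z l - (z l - δ)) by ring, h.odd,
          show z l - (z l - δ + κ) = -(z l - (z l + δ - κ)) by ring, h.odd,
          show z l - (z l - κ) = -(z l - (z l + κ)) by ring, h.odd]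
        ring
      rw [hFG, hb0]
      ring
    · have hb1 : b = z l + κ := by simp [hbdef, hpole]
      have hG0 : G l b = 0 := by simp [hG, hb1, h.zero]
      have hrefl : ∀ j, K (b - z j) = K (z j - z l) := by
        intro j
        rw [hK, ← h.ruijKernel_reflect, hb1]; congr 1; ring
      simp only [hG0, hrefl]
      rw [hfac _ fun j => K (z j - z l), hfac _ fun j => K (z j - z l), hih]
      ring
    · have hb1 : b = z l - κ := by simp [hbdef, hpole, sub_eq_add_neg]
      have hF0 : F l b = 0 := by simp [hF, hb1, h.zero]
      have hrefl : ∀ j, K (z j - b) = K (z l - z j) := by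
        intro j
        rw [hK, ← h.ruijKernel_reflect, hb1]; congr 1; ring
      simp only [hF0, hrefl]
      rw [hfac _ fun j => K (z l - z j), hfac _ fun j => K (z l - z j), hih]
      ring
  have hDa : ∀ y : ι → ℂ, KappaGeneric br κ (insert a s) y → (∀ i ∈ s, y i = z i) →
      ∀ i ∈ s, D i (y a) ≠ 0 := by
    intro y hy hyz i hi
    have k := fun n : ℤ => hy a (by simp) i (by simp [hi]) (fun e => ha (e ▸ hi)) n
    rw [hyz i hi] at k
    refine mul_ne_zero (mul_ne_zero ?_ ?_) ?_
    · convert k 0 using 2; simp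
    · convert k (-1) using 2; push_cast; ring
    · convert k 1 using 2; push_cast; ring
  have hpd : ∀ y : ι → ℂ, KappaGeneric br κ (insert a s) y → (∀ i ∈ s, y i = z i) →
      ∏ i ∈ s, D i (y a) ≠ 0 := fun y hy hyz => Finset.prod_ne_zero_iff.mpr (hDa y hy hyz)
  have hav : ∀ y : ι → ℂ, KappaGeneric br κ (insert a s) y → (∀ i ∈ s, y i = z i) →
      ∀ b ∈ (s ×ˢ ε).image pole, br (y a - b) ≠ 0 := by
    intro y hy hyz
    exact Finset.prod_ne_zero_iff.mp (by rw [hprod]; exact hpd y hy hyz)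
  have hrig := h.thetaSpace_rigidity ((s ×ˢ ε).image pole)
    (by
      intro b hb c hc hbc
      obtain ⟨q, hq, rfl⟩ := Finset.mem_image.mp hb
      obtain ⟨q', hq', rfl⟩ := Finset.mem_image.mp hc
      exact hpoles q hq q' hq' fun e => hbc (by rw [e]))
    (by rw [hcard, hsum]; exact hNth) hvan (hav z hz fun _ _ => rfl) (hav z' hz' hzz') hne
  rw [hprod, hprod, hNumEq z (fun _ _ => rfl) (hDa z hz fun _ _ => rfl),
    hNumEq z' hzz' (hDa z' hz' hzz')] at hrig
  refine mul_left_cancel₀ (mul_ne_zero (hpd z hz fun _ _ => rfl) (hpd z' hz' hzz')) ?_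
  linear_combination hrig

end IsBracket_s7

namespace IsBracket_s7

variable {br : ℂ → ℂ} {δ κ : ℂ} {ι : Type*} [DecidableEq ι]

lemma ruijDefect_congr (X : ℂ) {s : Finset ι} {z z' : ι → ℂ} (hz : ∀ i ∈ s, z i = z' i) :
    ruijDefect br δ κ X s z = ruijDefect br δ κ X s z' := by
  unfold ruijDefect
  congr 1 <;>
  exact splitSum_congr (fun i hi j hj _ => by rw [hz i hi, hz j hj]) (fun _ _ => rfl)
    (fun _ _ => rfl)

lemma ruijDefect_neg (X : ℂ) (s : Finset ι) (z : ι → ℂ) :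
    ruijDefect br δ κ X s (-z) = -ruijDefect br δ κ X s z := by
  unfold ruijDefect
  simp only [Pi.neg_apply, neg_sub_neg, neg_sub]

/-- Moving from `z` to `w` one coordinate at a time. -/
lemma ruijDefect_piecewise (h : IsBracket_s7 br) (hκ : ∀ n : ℤ, n ≠ 0 → br (n * κ) ≠ 0) (X : ℂ)
    {s : Finset ι}
    (ih : ∀ t : Finset ι, t.card < s.card → ∀ z, KappaGeneric br κ t z →
      ruijDefect br δ κ X t z = 0)
    {z w : ι → ℂ} (hz : KappaGeneric br κ s z) (hw : KappaGeneric br κ s w)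
    (hzw : ∀ i ∈ s, ∀ j ∈ s, ∀ n : ℤ, br (w i - z j + n * κ) ≠ 0) :
    ruijDefect br δ κ X s z = ruijDefect br δ κ X s w := by
  have hgen : ∀ S : Finset ι, KappaGeneric br κ s (S.piecewise w z) := by
    intro S i hi j hj hij n
    simp only [Finset.piecewise]
    split_ifs
    · exact hw i hi j hj hij n
    · exact hzw i hi j hj n
    · have := hzw j hj i hi (-n)
      rw [← neg_ne_zero, ← h.odd] at this
      convert this using 2
      push_cast; ring
    · exact hz i hi j hj hij n
  have step : ∀ S ⊆ s, ruijDefect br δ κ X s z = ruijDefect br δ κ X s (S.piecewise w z) := by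
    intro S
    induction S using Finset.induction_on with
    | empty => intro _; simp
    | insert a S haS ihS =>
      intro hS
      have has : a ∈ s := hS (by simp)
      rw [ihS fun i hi => hS (by simp [hi]), ← Finset.insert_erase has]
      refine h.ruijDefect_eq_of_agree hκ X (Finset.notMem_erase a s)
        (by rw [Finset.insert_erase has]; exact hgen S)
        (by rw [Finset.insert_erase has]; exact hgen (insert a S)) ?_ ?_ ?_
      · intro i hi
        have hia : i ≠ a := (Finset.mem_erase.mp hi).1
        simp [Finset.piecewise, hia]
      · have := hzw a has a has 0
        rw [← neg_ne_zero, ← h.odd] at this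
        convert this using 2
        simp [Finset.piecewise, haS]
      · intro l hl
        refine ih _ ?_ _ ?_
        · calc ((s.erase a).erase l).card ≤ (s.erase a).card := Finset.card_erase_le
            _ < s.card := Finset.card_erase_lt_of_mem has
        · intro i hi j hj
          exact hgen S i (Finset.mem_of_mem_erase (Finset.mem_of_mem_erase hi)) j
            (Finset.mem_of_mem_erase (Finset.mem_of_mem_erase hj))
  rw [step s subset_rfl]
  exact ruijDefect_congr X fun i hi => Finset.piecewise_eq_of_mem _ _ _ hi

/-- Ruijsenaars' identity, in generating function form. -/
theorem ruijDefect_eq_zero [Countable ι] (h : IsBracket_s7 br)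
    (hκ : ∀ n : ℤ, n ≠ 0 → br (n * κ) ≠ 0) (X : ℂ) (s : Finset ι) (z : ι → ℂ)
    (hz : KappaGeneric br κ s z) : ruijDefect br δ κ X s z = 0 := by
  induction hN : s.card using Nat.strong_induction_on generalizing s z with
  | _ N ihN =>
  subst hN
  obtain ⟨v, hv⟩ := exists_injective_nat ι
  obtain ⟨t, ht⟩ := (h.dense_affine_ne_zero
    (Q := {q : ι × ι // q.1 ≠ q.2} × ℤ ⊕ ι × ι × ℤ ⊕ ι × ι × ℤ)
    (Sum.elim (fun q => q.2 * κ)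
      (Sum.elim (fun q => -z q.2.1 + q.2.2 * κ) (fun q => z q.2.1 + q.2.2 * κ)))
    (Sum.elim (fun q => (v q.1.1.1 : ℂ) - v q.1.1.2)
      (Sum.elim (fun q => (v q.1 : ℂ) + 1) (fun q => (v q.1 : ℂ) + 1)))
    (by
      rintro (⟨⟨⟨i, j⟩, hij⟩, n⟩ | ⟨i, j, n⟩ | ⟨i, j, n⟩)
      · simpa [sub_eq_zero] using fun e => hij (hv e)
      · exact Nat.cast_add_one_ne_zero _
      · exact Nat.cast_add_one_ne_zero _)).nonempty
  set w : ι → ℂ := fun i => ((v i : ℂ) + 1) * t with hw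
  have hwg : KappaGeneric br κ s w := by
    intro i _ j _ hij n
    convert ht (Sum.inl (⟨(i, j), hij⟩, n)) using 2
    simp only [hw, Sum.elim_inl]; ring
  have ih : ∀ t : Finset ι, t.card < s.card → ∀ z, KappaGeneric br κ t z →
      ruijDefect br δ κ X t z = 0 := fun t ht z hz => ihN _ ht t z hz rfl
  have h₁ := h.ruijDefect_piecewise hκ X ih hz hwg fun i _ j _ n => by
    convert ht (Sum.inr (Sum.inl (i, j, n))) using 2
    simp only [hw, Sum.elim_inl, Sum.elim_inr]; ring
  have hzneg : KappaGeneric br κ s (-z) := by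
    intro i hi j hj hij n
    convert hz j hj i hi hij.symm n using 2
    simp only [Pi.neg_apply]; ring
  have h₂ := h.ruijDefect_piecewise hκ X ih hzneg hwg fun i _ j _ n => by
    convert ht (Sum.inr (Sum.inr (i, j, n))) using 2
    simp only [hw, Sum.elim_inr, Pi.neg_apply]; ring
  rw [ruijDefect_neg, ← h₁] at h₂
  exact self_eq_neg.mp h₂.symm

/-- Ruijsenaars' identity for the subsets of fixed cardinality. -/
theorem sum_powersetCard_ruijKernel [Fintype ι] (h : IsBracket_s7 br)
    (hκ : ∀ n : ℤ, n ≠ 0 → br (n * κ) ≠ 0) (z : ι → ℂ) (hz : KappaGeneric br κ univ z) {k : ℕ}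
    (hk : k ≤ Fintype.card ι) :
    ∑ I ∈ powersetCard k univ, ∏ i ∈ I, ∏ j ∈ Iᶜ, ruijKernel br δ κ (z i - z j)
      = ∑ I ∈ powersetCard (Fintype.card ι - k) univ,
          ∏ i ∈ I, ∏ j ∈ Iᶜ, ruijKernel br δ κ (z i - z j) := by
  have hpoly : ∑ I : Finset ι, Polynomial.monomial I.card
        (∏ i ∈ I, ∏ j ∈ Iᶜ, ruijKernel br δ κ (z i - z j))
      = ∑ I : Finset ι, Polynomial.monomial I.card
        (∏ i ∈ I, ∏ j ∈ Iᶜ, ruijKernel br δ κ (z j - z i)) := by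
    refine Polynomial.funext fun X => ?_
    have := sub_eq_zero.mp (h.ruijDefect_eq_zero (δ := δ) hκ X univ z hz)
    simpa [splitSum, Polynomial.eval_finsetSum, Finset.compl_eq_univ_sdiff] using this
  have hcoeff := congrArg (fun p => p.coeff k) hpoly
  simp only [Polynomial.finsetSum_coeff, Polynomial.coeff_monomial, ← Finset.sum_filter] at hcoeff
  have hf : ∀ k, (univ : Finset (Finset ι)).filter (fun I => I.card = k) = powersetCard k univ := by
    intro k; ext I; simp [Finset.mem_powersetCard]
  rw [hf] at hcoeff
  rw [hcoeff]
  refine Finset.sum_nbij' (fun I => Iᶜ) (fun I => Iᶜ) ?_ ?_ (by simp) (by simp) ?_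
  · intro I hI
    simp only [Finset.mem_powersetCard_univ] at hI ⊢
    rw [Finset.card_compl, hI]
  · intro I hI
    simp only [Finset.mem_powersetCard_univ] at hI ⊢
    rw [Finset.card_compl, hI]; omega
  · intro I _
    rw [Finset.prod_comm, compl_compl]

end IsBracket_s7

lemma sfac_natCast_s7 (br : ℂ → ℂ) (a x : ℂ) (n : ℕ) :
    sfac br a x n = ∏ i ∈ range n, br (x + (i : ℂ) * a) := by
  simp [sfac]

lemma sfac_ne_zero {br : ℂ → ℂ} {a x : ℂ} (hx : ∀ c : ℤ, br (x + c * a) ≠ 0) (n : ℤ) :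
    sfac br a x n ≠ 0 := by
  unfold sfac
  split_ifs
  · exact Finset.prod_ne_zero_iff.mpr fun i _ => by simpa using hx i
  · exact inv_ne_zero (Finset.prod_ne_zero_iff.mpr fun i _ => by simpa using hx (n + i))

/-- Splitting a shifted factorial of length `p` at the (possibly negative) position `p - q`. -/
lemma sfac_split {br : ℂ → ℂ} {a x : ℂ} {p q : ℕ} (hx : sfac br a x ((p : ℤ) - q) ≠ 0) :
    sfac br a x p
      = sfac br a x ((p : ℤ) - q) * ∏ c ∈ range q, br (x + ((p : ℂ) - q + c) * a) := by
  rw [sfac_natCast_s7]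
  rcases le_total q p with hqp | hpq
  · obtain ⟨d, rfl⟩ := Nat.exists_eq_add_of_le hqp
    have e : ((q + d : ℕ) : ℤ) - q = (d : ℕ) := by push_cast; ring
    rw [e, sfac_natCast_s7, add_comm q d, Finset.prod_range_add]
    congr 1
    refine Finset.prod_congr rfl fun c _ => ?_
    congr 2; push_cast; ring
  · obtain ⟨d, rfl⟩ := Nat.exists_eq_add_of_le hpq
    rcases Nat.eq_zero_or_pos d with rfl | hd
    · simp [sfac]
    have e : (p : ℤ) - (p + d : ℕ) = -(d : ℤ) := by push_cast; ring
    have hs : sfac br a x (-(d : ℤ)) = (∏ i ∈ range d, br (x + (-(d : ℂ) + i) * a))⁻¹ := by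
      rw [sfac, if_neg (by omega)]
      simp
    rw [e, hs] at hx ⊢
    have hne : ∏ i ∈ range d, br (x + (-(d : ℂ) + i) * a) ≠ 0 := fun e => hx (by rw [e, inv_zero])
    rw [add_comm p d, Finset.prod_range_add]
    have e₁ : ∏ c ∈ range d, br (x + ((p : ℂ) - (d + p : ℕ) + c) * a)
        = ∏ i ∈ range d, br (x + (-(d : ℂ) + i) * a) :=
      Finset.prod_congr rfl fun c _ => by congr 2; push_cast; ring
    have e₂ : ∏ c ∈ range p, br (x + ((p : ℂ) - (d + p : ℕ) + (d + c : ℕ)) * a)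
        = ∏ i ∈ range p, br (x + (i : ℂ) * a) :=
      Finset.prod_congr rfl fun c _ => by congr 2; push_cast; ring
    rw [e₁, e₂, ← mul_assoc, inv_mul_cancel₀ hne, one_mul]

lemma prod_fin_filter_lt {n k : ℕ} (hk : k ≤ n) (g : ℕ → ℂ) :
    ∏ a ∈ univ.filter (fun a : Fin n => (a : ℕ) < k), g a = ∏ a ∈ range k, g a := by
  rw [Finset.prod_filter, Fin.prod_univ_eq_prod_range (fun a => if a < k then g a else 1),
    ← Finset.prod_filter]
  congr 1; ext a; simp; omega

lemma prod_fin_filter_not_lt {n k : ℕ} (g : ℕ → ℂ) :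
    ∏ a ∈ univ.filter (fun a : Fin n => ¬ (a : ℕ) < k), g a = ∏ a ∈ Ico k n, g a := by
  rw [Finset.prod_filter, Fin.prod_univ_eq_prod_range (fun a => if ¬ a < k then g a else 1),
    ← Finset.prod_filter]
  congr 1; ext a; simp; omega

section telescoping

variable {br : ℂ → ℂ} {δ κ : ℂ}

lemma prod_Ico_ruijKernel {v : ℂ} {k n : ℕ} (hkn : k ≤ n)
    (h₁ : ∀ b : ℕ, k ≤ b → br (v - b * δ) ≠ 0) (h₂ : ∀ b : ℤ, br (v - b * δ - κ) ≠ 0) :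
    ∏ b ∈ Ico k n, ruijKernel br δ κ (v - b * δ)
      = (br (v - n * δ) * br (v - ((k : ℂ) - 1) * δ - κ))
        / (br (v - k * δ) * br (v - ((n : ℂ) - 1) * δ - κ)) := by
  have h₂' : ∀ b : ℕ, br (v - ((b : ℂ) - 1) * δ - κ) ≠ 0 := fun b => by
    simpa using h₂ ((b : ℤ) - 1)
  induction n, hkn using Nat.le_induction with
  | base =>
    rw [Finset.Ico_self, Finset.prod_empty, div_self]
    exact mul_ne_zero (h₁ k le_rfl) (h₂' k)
  | succ n hkn ih =>
    rw [Finset.prod_Ico_succ_top hkn, ih, ruijKernel]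
    have e₁ : v - n * δ - δ = v - ((n + 1 : ℕ) : ℂ) * δ := by push_cast; ring
    have e₂ : v - n * δ + δ - κ = v - ((n : ℂ) - 1) * δ - κ := by ring
    have e₃ : v - (((n + 1 : ℕ) : ℂ) - 1) * δ - κ = v - n * δ - κ := by push_cast; ring
    rw [e₁, e₂, e₃]
    have aux : ∀ A B C D E F : ℂ, A ≠ 0 → D ≠ 0 →
        A * B / (C * D) * (E * D / (A * F)) = E * B / (C * F) := by
      intros; field_simp
    exact aux _ _ _ _ _ _ (h₁ n hkn) (h₂' n)

lemma prod_range_ruijKernel {v : ℂ} (n : ℕ) (h₁ : ∀ b : ℤ, br (v + b * δ) ≠ 0)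
    (h₂ : ∀ b : ℤ, br (v + b * δ - κ) ≠ 0) :
    ∏ a ∈ range n, ruijKernel br δ κ (v + a * δ)
      = (br (v - δ) * br (v + n * δ - κ)) / (br (v - κ) * br (v + ((n : ℂ) - 1) * δ)) := by
  have hv : br (v - δ) ≠ 0 := by
    convert h₁ (-1) using 2; push_cast; ring
  have hv' : br (v - κ) ≠ 0 := by simpa using h₂ 0
  induction n with
  | zero =>
    have e : v + ((0 : ℕ) - 1 : ℂ) * δ = v - δ := by push_cast; ring
    rw [e]
    simp only [Finset.range_zero, Finset.prod_empty, Nat.cast_zero, zero_mul, add_zero]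
    field_simp
  | succ n ih =>
    rw [Finset.prod_range_succ, ih, ruijKernel]
    have e₁ : v + n * δ - δ = v + ((n : ℂ) - 1) * δ := by ring
    have e₂ : v + n * δ + δ - κ = v + ((n + 1 : ℕ) : ℂ) * δ - κ := by push_cast; ring
    have e₃ : v + (((n + 1 : ℕ) : ℂ) - 1) * δ = v + n * δ := by push_cast; ring
    rw [e₁, e₂, e₃]
    have aux : ∀ A B C D E F : ℂ, B ≠ 0 → D ≠ 0 →
        A * B / (C * D) * (D * E / (F * B)) = A * E / (C * F) := by
      intros; field_simp
    exact aux _ _ _ _ _ _ (by simpa using h₂ n) (by simpa using h₁ ((n : ℤ) - 1))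

end telescoping

section blocks

variable {br : ℂ → ℂ} {δ κ : ℂ}

lemma prod_prod_ruijKernel {v : ℂ} {p q L : ℕ} (hL : q ≤ L)
    (h₁ : ∀ a < p, ∀ b : ℕ, q ≤ b → br (v + a * δ - b * δ) ≠ 0)
    (h₂ : ∀ c : ℤ, br (v + c * δ - κ) ≠ 0) :
    ∏ a ∈ range p, ∏ b ∈ Ico q L, ruijKernel br δ κ (v + a * δ - b * δ)
      = (sfac br δ (v - L * δ) p / sfac br δ (v - ((L : ℂ) - 1) * δ - κ) p)
        * ∏ a ∈ range p, br (v + ((a : ℂ) - q + 1) * δ - κ) / br (v + ((a : ℂ) - q) * δ) := by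
  rw [sfac_natCast_s7, sfac_natCast_s7, ← Finset.prod_div_distrib, ← Finset.prod_mul_distrib]
  refine Finset.prod_congr rfl fun a ha => ?_
  rw [prod_Ico_ruijKernel hL (h₁ a (mem_range.mp ha))]
  · rw [mul_div_mul_comm, div_mul_div_comm, div_mul_div_comm, mul_comm (br _) (br (_ - _ - κ))]
    ring_nf
  · intro b
    convert h₂ (a - b) using 2
    push_cast; ring

lemma IsBracket_s7.sfac_ratio (h : IsBracket_s7 br) {v : ℂ} {p q : ℕ} (C : ℂ)
    (h₁ : sfac br δ (v + δ) ((p : ℤ) - q) ≠ 0) (h₂ : sfac br δ (v + κ) ((p : ℤ) - q) ≠ 0) :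
    (sfac br δ (v + δ) ((p : ℤ) - q) / sfac br δ (v + κ) ((p : ℤ) - q))
        * ((sfac br δ (v + κ) p * sfac br δ (v - C * δ) p)
          / (sfac br δ (v + δ) p * sfac br δ (v - (C - 1) * δ - κ) p))
      = (sfac br δ (v - C * δ) p / sfac br δ (v - (C - 1) * δ - κ) p)
        * ∏ a ∈ range q, br (-v + ((a : ℂ) - p + 1) * δ - κ) / br (-v + ((a : ℂ) - p) * δ) := by
  rw [sfac_split h₁, sfac_split h₂]
  have e : ∏ a ∈ range q, br (-v + ((a : ℂ) - p + 1) * δ - κ) / br (-v + ((a : ℂ) - p) * δ)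
      = (∏ c ∈ range q, br (v + κ + ((p : ℂ) - q + c) * δ))
        / ∏ c ∈ range q, br (v + δ + ((p : ℂ) - q + c) * δ) := by
    rw [← Finset.prod_div_distrib, ← Finset.prod_range_reflect]
    refine Finset.prod_congr rfl fun c hc => ?_
    have hc' : c + 1 ≤ q := mem_range.mp hc
    rw [← neg_div_neg_eq, ← h.odd, ← h.odd, Nat.sub_sub, add_comm 1 c, Nat.cast_sub hc']
    congr 2 <;> push_cast <;> ring
  rw [e]
  field_simp

end blocks

/-- Brackets of differences of the points `W p`, shifted by the lattice `ℤδ + ℤκ`, never vanish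
unless they are trivially zero. -/
structure LatticeGeneric (br : ℂ → ℂ) (δ κ : ℂ) {τ : Type*} (W : τ → ℂ) : Prop where
  ne : ∀ p q, p ≠ q → ∀ c d : ℤ, br (W p - W q + c * δ + d * κ) ≠ 0
  lattice : ∀ c d : ℤ, c ≠ 0 ∨ d ≠ 0 → br (c * δ + d * κ) ≠ 0

/-- The points `y_j` together with the arithmetic progressions `x_i, x_i + δ, …` of length `λ_i`. -/
def fusedPoints (δ : ℂ) {m r : ℕ} (lam : Fin m → ℕ) (x : Fin m → ℂ) (y : Fin r → ℂ) :
    (Σ i, Fin (lam i)) ⊕ Fin r → ℂ :=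
  Sum.elim (fun p => x p.1 + (p.2 : ℕ) * δ) y

/-- The initial segments of lengths `μ_i` of the progressions together with the points in `P`. -/
def initialPoints {m r : ℕ} (lam μ : Fin m → ℕ) (P : Finset (Fin r)) :
    Finset ((Σ i, Fin (lam i)) ⊕ Fin r) :=
  ((univ : Finset (Fin m)).sigma fun i => univ.filter fun a : Fin (lam i) => (a : ℕ) < μ i).disjSum P

lemma compl_initialPoints {m r : ℕ} (lam μ : Fin m → ℕ) (P : Finset (Fin r)) :
    (initialPoints lam μ P)ᶜ
      = ((univ : Finset (Fin m)).sigma fun i =>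
          univ.filter fun a : Fin (lam i) => ¬ (a : ℕ) < μ i).disjSum Pᶜ := by
  ext (p | j) <;> simp [initialPoints]

section

variable {br : ℂ → ℂ} {δ κ : ℂ} {m r : ℕ} {lam μ : Fin m → ℕ} {P : Finset (Fin r)}
  {x : Fin m → ℂ} {y : Fin r → ℂ}

lemma LatticeGeneric.x_sub_x (hg : LatticeGeneric br δ κ (Sum.elim x y)) (i j : Fin m) {c d : ℤ}
    (h : i ≠ j ∨ c ≠ 0 ∨ d ≠ 0) : br (x i - x j + c * δ + d * κ) ≠ 0 := by
  rcases eq_or_ne i j with rfl | hij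
  · rw [sub_self, zero_add]
    exact hg.lattice c d (by simpa using h)
  · exact hg.ne (.inl i) (.inl j) (by simpa using hij) c d

lemma LatticeGeneric.x_sub_y (hg : LatticeGeneric br δ κ (Sum.elim x y)) (i : Fin m) (j : Fin r)
    (c d : ℤ) : br (x i - y j + c * δ + d * κ) ≠ 0 :=
  hg.ne (.inl i) (.inr j) (by simp) c d

lemma LatticeGeneric.y_sub_x (hg : LatticeGeneric br δ κ (Sum.elim x y)) (i : Fin r) (j : Fin m)
    (c d : ℤ) : br (y i - x j + c * δ + d * κ) ≠ 0 :=
  hg.ne (.inr i) (.inl j) (by simp) c d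

lemma prod_x_x_eq (h : IsBracket_s7 br) (hg : LatticeGeneric br δ κ (Sum.elim x y))
    (hμ : ∀ i, μ i ≤ lam i) :
    ∏ i : Fin m, ∏ j : Fin m,
        (sfac br δ (x i - x j + δ) ((μ i : ℤ) - (μ j : ℤ))
            / sfac br δ (x i - x j + κ) ((μ i : ℤ) - (μ j : ℤ)))
          * ((sfac br δ (x i - x j + κ) (μ i : ℤ)
                * sfac br δ (x i - x j - (lam j : ℂ) * δ) (μ i : ℤ))
              / (sfac br δ (x i - x j + δ) (μ i : ℤ)
                * sfac br δ (x i - x j - ((lam j : ℂ) - 1) * δ - κ) (μ i : ℤ)))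
      = ∏ i : Fin m, ∏ j : Fin m, ∏ a ∈ range (μ i), ∏ b ∈ Ico (μ j) (lam j),
          ruijKernel br δ κ (x i - x j + a * δ - b * δ) := by
  have hL : ∀ i j : Fin m, sfac br δ (x i - x j + δ) ((μ i : ℤ) - μ j) ≠ 0 := fun i j => by
    rcases eq_or_ne i j with rfl | hij
    · simp [sfac]
    · refine sfac_ne_zero (fun c => ?_) _
      convert hg.x_sub_x i j (c := c + 1) (d := 0) (.inl hij) using 2
      push_cast; ring
  have hL' : ∀ i j : Fin m, sfac br δ (x i - x j + κ) ((μ i : ℤ) - μ j) ≠ 0 := fun i j => by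
    refine sfac_ne_zero (fun c => ?_) _
    convert hg.x_sub_x i j (c := c) (d := 1) (by simp) using 2
    push_cast; ring
  have hR : ∀ i j : Fin m, ∏ a ∈ range (μ i), ∏ b ∈ Ico (μ j) (lam j),
      ruijKernel br δ κ (x i - x j + a * δ - b * δ) = _ := fun i j => by
    refine prod_prod_ruijKernel (hμ j) (fun a ha b hb => ?_) (fun c => ?_)
    · convert hg.x_sub_x i j (c := a - b) (d := 0) ?_ using 2
      · push_cast; ring
      · by_cases hij : i = j
        · subst hij; right; left; omega
        · exact .inl hij
    · convert hg.x_sub_x i j (c := c) (d := -1) (by simp) using 2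
      push_cast; ring
  simp_rw [fun i j => h.sfac_ratio (lam j : ℂ) (hL i j) (hL' i j), hR, Finset.prod_mul_distrib,
    neg_sub]
  congr 1
  exact Finset.prod_comm

lemma Sterm_eq_prod_ruijKernel (h : IsBracket_s7 br) (hg : LatticeGeneric br δ κ (Sum.elim x y))
    (hμ : ∀ i, μ i ≤ lam i) :
    Sterm br δ κ lam μ P x y = ∏ i ∈ initialPoints lam μ P, ∏ j ∈ (initialPoints lam μ P)ᶜ,
      ruijKernel br δ κ (fusedPoints δ lam x y i - fusedPoints δ lam x y j) := by
  rw [compl_initialPoints, initialPoints]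
  simp only [Finset.prod_disjSum, Finset.prod_sigma, fusedPoints, Sum.elim_inl, Sum.elim_inr]
  have hxy : ∀ (i : Fin m) (j : Fin r),
      ∏ a ∈ univ.filter (fun a : Fin (lam i) => (a : ℕ) < μ i),
        ruijKernel br δ κ (x i + (a : ℕ) * δ - y j) =
      (br (x i - y j - δ) * br (x i - y j + (μ i : ℂ) * δ - κ))
              / (br (x i - y j - κ) * br (x i - y j + ((μ i : ℂ) - 1) * δ)) := fun i j => by
    rw [prod_fin_filter_lt (hμ i) fun a => ruijKernel br δ κ (x i + (a : ℂ) * δ - y j)]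
    simp_rw [add_sub_right_comm (x i)]
    refine prod_range_ruijKernel _ (fun b => ?_) (fun b => ?_)
    · simpa using hg.x_sub_y i j b 0
    · convert hg.x_sub_y i j b (-1) using 2
      push_cast; ring
  have hyx : ∀ (i : Fin m) (j : Fin r),
      ∏ a ∈ univ.filter (fun a : Fin (lam i) => ¬ (a : ℕ) < μ i),
        ruijKernel br δ κ (y j - (x i + (a : ℕ) * δ)) =
      (br (x i - y j + (lam i : ℂ) * δ) * br (x i - y j + ((μ i : ℂ) - 1) * δ + κ))
              / (br (x i - y j + (μ i : ℂ) * δ) * br (x i - y j + ((lam i : ℂ) - 1) * δ + κ)) :=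
    fun i j => by
    rw [prod_fin_filter_not_lt fun a => ruijKernel br δ κ (y j - (x i + (a : ℂ) * δ))]
    simp_rw [← sub_sub]
    rw [prod_Ico_ruijKernel (hμ i)]
    · rw [← neg_mul_neg, ← neg_mul_neg (br (y j - x i - _)), ← h.odd, ← h.odd, ← h.odd, ← h.odd]
      congr 3 <;> ring
    · intro b _
      convert hg.y_sub_x j i (-b) 0 using 2
      push_cast; ring
    · intro b
      convert hg.y_sub_x j i (-b) (-1) using 2
      push_cast; ring
  have hxx : ∀ i j : Fin m,
      ∏ a ∈ univ.filter (fun a : Fin (lam i) => (a : ℕ) < μ i),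
        ∏ b ∈ univ.filter (fun b : Fin (lam j) => ¬ (b : ℕ) < μ j),
          ruijKernel br δ κ (x i + (a : ℕ) * δ - (x j + (b : ℕ) * δ)) =
      ∏ a ∈ range (μ i), ∏ b ∈ Ico (μ j) (lam j),
          ruijKernel br δ κ (x i - x j + a * δ - b * δ) := fun i j => by
    rw [← prod_fin_filter_lt (hμ i) fun a => ∏ b ∈ Ico (μ j) (lam j),
          ruijKernel br δ κ (x i - x j + a * δ - b * δ)]
    refine Finset.prod_congr rfl fun a _ => ?_
    rw [← prod_fin_filter_not_lt fun b => ruijKernel br δ κ (x i - x j + (a : ℕ) * δ - b * δ)]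
    refine Finset.prod_congr rfl fun b _ => ?_
    congr 1; ring
  simp only [Finset.prod_mul_distrib]
  rw [Sterm, prod_x_x_eq h hg hμ]
  simp_rw [← hxx, ← hxy, ← hyx, Finset.prod_mul_distrib]
  have e₁ : ∀ i, ∏ a ∈ univ.filter (fun a : Fin (lam i) => (a : ℕ) < μ i), ∏ j,
      ∏ b ∈ univ.filter (fun b : Fin (lam j) => ¬ (b : ℕ) < μ j),
        ruijKernel br δ κ (x i + (a : ℕ) * δ - (x j + (b : ℕ) * δ)) = _ :=
    fun i => Finset.prod_comm
  have e₂ : ∀ i, ∏ a ∈ univ.filter (fun a : Fin (lam i) => (a : ℕ) < μ i), ∏ j ∈ Pᶜ,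
      ruijKernel br δ κ (x i + (a : ℕ) * δ - y j) = _ := fun i => Finset.prod_comm
  simp_rw [e₁, e₂, Finset.prod_comm (s := P) (t := univ), ruijKernel]
  ring

end

lemma card_filter_fin_val_lt {n k : ℕ} (hk : k ≤ n) :
    (univ.filter fun a : Fin n => (a : ℕ) < k).card = k := by
  rw [Finset.card_filter, Fin.sum_univ_eq_sum_range fun a => if a < k then 1 else 0,
    ← Finset.card_filter]
  conv_rhs => rw [← card_range k]
  congr 1; ext a; simp; omega

lemma Finset.mem_iff_lt_card_of_pred_mem {n : ℕ} {S : Finset (Fin n)}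
    (hS : ∀ a b : Fin n, (b : ℕ) + 1 = a → a ∈ S → b ∈ S) (a : Fin n) :
    a ∈ S ↔ (a : ℕ) < S.card := by
  have hdown : ∀ d : ℕ, ∀ a b : Fin n, (b : ℕ) + d = a → a ∈ S → b ∈ S := by
    intro d
    induction d with
    | zero => intro a b hab ha; rwa [Fin.ext (by simpa using hab) (a := b) (b := a)]
    | succ d ih =>
      intro a b hab ha
      have hlt := a.isLt
      exact ih ⟨b + d, by omega⟩ b rfl (hS a _ (by simpa [add_assoc] using hab) ha)
  constructor
  · intro ha
    have hsub : Iic a ⊆ S := fun b hb => by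
      have hba : (b : ℕ) ≤ a := Fin.le_def.mp (mem_Iic.mp hb)
      exact hdown (a - b) a b (by omega) ha
    have := card_le_card hsub
    rw [Fin.card_Iic] at this
    omega
  · intro ha
    by_contra hn
    have hsub : S ⊆ Iio a := fun b hb => by
      rw [mem_Iio]
      by_contra hba
      have hba' : (a : ℕ) ≤ b := not_lt.mp hba
      exact hn (hdown (b - a) b a (by omega) hb)
    have := card_le_card hsub
    rw [Fin.card_Iio] at this
    omega

section

variable {br : ℂ → ℂ} {δ κ : ℂ} {m r : ℕ} {lam μ : Fin m → ℕ} {P : Finset (Fin r)}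
  {x : Fin m → ℂ} {y : Fin r → ℂ}

lemma mem_SIdx {k : ℕ} {p : (Fin m → ℕ) × Finset (Fin r)} :
    p ∈ SIdx lam r k ↔ (∀ i, p.1 i ≤ lam i) ∧ (∑ i, p.1 i) + p.2.card = k := by
  simp [SIdx]

lemma card_initialPoints (hμ : ∀ i, μ i ≤ lam i) :
    (initialPoints lam μ P).card = (∑ i, μ i) + P.card := by
  rw [initialPoints, card_disjSum, card_sigma]
  simp_rw [card_filter_fin_val_lt (hμ _)]

lemma injOn_initialPoints (k : ℕ) :
    Set.InjOn (fun p : (Fin m → ℕ) × Finset (Fin r) => initialPoints lam p.1 p.2)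
      (SIdx lam r k) := by
  rintro ⟨μ, P⟩ hp ⟨ν, Q⟩ hq he
  have hμ : ∀ i, μ i ≤ lam i := (mem_SIdx.mp (mem_coe.mp hp)).1
  have hν : ∀ i, ν i ≤ lam i := (mem_SIdx.mp (mem_coe.mp hq)).1
  have he' := fun z => Finset.ext_iff.mp he z
  have hPQ : P = Q := by
    ext j
    simpa [initialPoints] using he' (.inr j)
  have hμν : μ = ν := by
    funext i
    have hf : (univ.filter fun a : Fin (lam i) => (a : ℕ) < μ i)
        = univ.filter fun a : Fin (lam i) => (a : ℕ) < ν i := by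
      ext a
      simpa [initialPoints] using he' (.inl ⟨i, a⟩)
    rw [← card_filter_fin_val_lt (hμ i), hf, card_filter_fin_val_lt (hν i)]
  rw [hPQ, hμν]

/-- A subset with nonvanishing product meets every progression in an initial segment. -/
lemma exists_eq_initialPoints (h : IsBracket_s7 br) {I : Finset ((Σ i, Fin (lam i)) ⊕ Fin r)}
    (hI : ∏ i ∈ I, ∏ j ∈ Iᶜ,
      ruijKernel br δ κ (fusedPoints δ lam x y i - fusedPoints δ lam x y j) ≠ 0) :
    ∃ p ∈ SIdx lam r I.card, initialPoints lam p.1 p.2 = I := by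
  have hdown : ∀ i, ∀ a b : Fin (lam i), (b : ℕ) + 1 = a →
      (Sum.inl ⟨i, a⟩ : (Σ i, Fin (lam i)) ⊕ Fin r) ∈ I → Sum.inl ⟨i, b⟩ ∈ I := by
    intro i a b hab ha
    by_contra hb
    refine prod_ne_zero_iff.mp (prod_ne_zero_iff.mp hI _ ha) _ (mem_compl.mpr hb) ?_
    have e : fusedPoints δ lam x y (.inl ⟨i, a⟩) - fusedPoints δ lam x y (.inl ⟨i, b⟩) - δ = 0 := by
      simp only [fusedPoints, Sum.elim_inl, ← hab]
      push_cast; ring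
    rw [ruijKernel, e, h.zero, zero_mul, zero_div]
  let S : ∀ i, Finset (Fin (lam i)) := fun i => univ.filter fun a => Sum.inl ⟨i, a⟩ ∈ I
  have hS : ∀ i (a : Fin (lam i)), Sum.inl ⟨i, a⟩ ∈ I ↔ (a : ℕ) < (S i).card := fun i a => by
    rw [← Finset.mem_iff_lt_card_of_pred_mem]
    · simp [S]
    · intro a b hab ha
      simp only [S, mem_filter, mem_univ, true_and] at ha ⊢
      exact hdown i a b hab ha
  have hμ : ∀ i, (S i).card ≤ lam i := fun i => by simpa using card_le_univ (S i)
  have hI' : initialPoints lam (fun i => (S i).card) (univ.filter fun j => Sum.inr j ∈ I) = I := by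
    ext (⟨i, a⟩ | j)
    · simp [initialPoints, hS]
    · simp [initialPoints]
  refine ⟨(fun i => (S i).card, univ.filter fun j => Sum.inr j ∈ I), mem_SIdx.mpr ⟨hμ, ?_⟩, hI'⟩
  rw [← card_initialPoints hμ, hI']

lemma Ssum_eq_sum_powersetCard (h : IsBracket_s7 br) (hg : LatticeGeneric br δ κ (Sum.elim x y))
    (k : ℕ) :
    Ssum br δ κ lam r k x y = ∑ I ∈ powersetCard k univ, ∏ i ∈ I, ∏ j ∈ Iᶜ,
      ruijKernel br δ κ (fusedPoints δ lam x y i - fusedPoints δ lam x y j) := by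
  refine Finset.sum_of_injOn (fun p => initialPoints lam p.1 p.2) (injOn_initialPoints k) ?_ ?_ ?_
  · intro p hp
    obtain ⟨hμ, hk⟩ := mem_SIdx.mp (mem_coe.mp hp)
    simp [card_initialPoints hμ, hk]
  · intro I hI hn
    by_contra hne
    obtain ⟨p, hp, rfl⟩ := exists_eq_initialPoints h hne
    rw [(mem_powersetCard.mp hI).2] at hp
    exact hn ⟨p, hp, rfl⟩
  · intro p hp
    exact Sterm_eq_prod_ruijKernel h hg (mem_SIdx.mp hp).1

lemma LatticeGeneric.kappaGeneric_fusedPoints (hg : LatticeGeneric br δ κ (Sum.elim x y)) :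
    KappaGeneric br κ univ (fusedPoints δ lam x y) := by
  rintro (⟨i, a⟩ | i) - (⟨j, b⟩ | j) - hij n
  · convert hg.x_sub_x i j (c := (a : ℕ) - (b : ℕ)) (d := n) ?_ using 2
    · simp only [fusedPoints, Sum.elim_inl]
      push_cast; ring
    · by_contra! hc
      obtain ⟨rfl, hab, -⟩ := hc
      exact hij (by rw [Fin.ext (a := a) (b := b) (by omega)])
  · convert hg.x_sub_y i j (a : ℕ) n using 2
    simp only [fusedPoints, Sum.elim_inl, Sum.elim_inr]
    push_cast; ring
  · convert hg.y_sub_x i j (-(b : ℕ)) n using 2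
    simp only [fusedPoints, Sum.elim_inl, Sum.elim_inr]
    push_cast; ring
  · convert hg.ne (.inr i) (.inr j) (by simpa using hij) 0 n using 2
    simp [fusedPoints]

lemma Ssum_symm_of_latticeGeneric (h : IsBracket_s7 br)
    (hg : LatticeGeneric br δ κ (Sum.elim x y)) {k : ℕ} (hk : k ≤ (∑ i, lam i) + r) :
    Ssum br δ κ lam r k x y = Ssum br δ κ lam r ((∑ i, lam i) + r - k) x y := by
  have hcard : Fintype.card ((Σ i, Fin (lam i)) ⊕ Fin r) = (∑ i, lam i) + r := by simp
  rw [Ssum_eq_sum_powersetCard h hg, Ssum_eq_sum_powersetCard h hg, ← hcard]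
  refine h.sum_powersetCard_ruijKernel (fun n hn => ?_) _ hg.kappaGeneric_fusedPoints
    (hcard ▸ hk)
  simpa using hg.lattice 0 n (.inr hn)

end

section continuity

variable {br : ℂ → ℂ} {T : Type*} [TopologicalSpace T]

lemma continuous_sfac_of_nonneg (hbr : Continuous br) {a : ℂ} {u : T → ℂ} (hu : Continuous u)
    {n : ℤ} (hn : 0 ≤ n) : Continuous fun t => sfac br a (u t) n := by
  simp only [sfac, if_pos hn]
  fun_prop

lemma continuous_inv_sfac_of_neg (hbr : Continuous br) {a : ℂ} {u : T → ℂ} (hu : Continuous u)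
    {n : ℤ} (hn : n < 0) : Continuous fun t => (sfac br a (u t) n)⁻¹ := by
  simp only [sfac, if_neg (not_le.mpr hn), inv_inv]
  fun_prop

lemma continuousAt_sfac_div_sfac (hbr : Continuous br) {a : ℂ} {u v : T → ℂ} (hu : Continuous u)
    (hv : Continuous v) {n : ℤ} {t₀ : T}
    (h : if 0 ≤ n then sfac br a (v t₀) n ≠ 0 else sfac br a (u t₀) n ≠ 0) :
    ContinuousAt (fun t => sfac br a (u t) n / sfac br a (v t) n) t₀ := by
  split_ifs at h with hn
  · exact (continuous_sfac_of_nonneg hbr hu hn).continuousAt.div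
      (continuous_sfac_of_nonneg hbr hv hn).continuousAt h
  · rw [not_le] at hn
    have hnum : ContinuousAt (fun t => sfac br a (u t) n) t₀ := by
      simpa only [inv_inv, Pi.inv_def] using
        (continuous_inv_sfac_of_neg hbr (a := a) hu hn).continuousAt.inv₀ (inv_ne_zero h)
    simp only [div_eq_mul_inv]
    exact hnum.mul (continuous_inv_sfac_of_neg hbr hv hn).continuousAt

lemma continuousAt_Sterm (hbr : Continuous br) {δ : ℂ} {m r : ℕ} {lam μ : Fin m → ℕ}
    {P : Finset (Fin r)} {K : T → ℂ} {X : T → Fin m → ℂ} {Y : T → Fin r → ℂ}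
    (hK : Continuous K) (hX : Continuous X) (hY : Continuous Y) {t₀ : T}
    (h : SDenomNZ br δ (K t₀) lam μ P (X t₀) (Y t₀)) :
    ContinuousAt (fun t => Sterm br δ (K t) lam μ P (X t) (Y t)) t₀ := by
  obtain ⟨hyy, hxx, hxP, hxPc⟩ := h
  unfold Sterm
  refine ((tendsto_finsetProd _ fun i hi => tendsto_finsetProd _ fun j hj => ?_).mul
    (tendsto_finsetProd _ fun i _ => tendsto_finsetProd _ fun j _ => ?_)).mul
    (tendsto_finsetProd _ fun i _ => (tendsto_finsetProd _ fun j hj => ?_).mul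
      (tendsto_finsetProd _ fun j hj => ?_))
  · exact ContinuousAt.div (by fun_prop) (by fun_prop)
      (mul_ne_zero (hyy i hi j hj).1 (hyy i hi j hj).2)
  · obtain ⟨h₁, h₂, h₃⟩ := hxx i j
    have hc : ∀ {u : T → ℂ}, Continuous u → ContinuousAt (fun t => sfac br δ (u t) (μ i : ℤ)) t₀ :=
      fun hu => (continuous_sfac_of_nonneg hbr hu (Int.natCast_nonneg _)).continuousAt
    refine ContinuousAt.mul (continuousAt_sfac_div_sfac hbr (by fun_prop) (by fun_prop) h₁)
      (ContinuousAt.div ((hc ?_).mul (hc ?_)) ((hc ?_).mul (hc ?_)) (mul_ne_zero h₂ h₃)) <;>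
    fun_prop
  · exact ContinuousAt.div (by fun_prop) (by fun_prop)
      (mul_ne_zero (hxP i j hj).1 (hxP i j hj).2)
  · exact ContinuousAt.div (by fun_prop) (by fun_prop)
      (mul_ne_zero (hxPc i j hj).1 (hxPc i j hj).2)

lemma continuousAt_Ssum (hbr : Continuous br) {δ : ℂ} {m r k : ℕ} {lam : Fin m → ℕ}
    {K : T → ℂ} {X : T → Fin m → ℂ} {Y : T → Fin r → ℂ}
    (hK : Continuous K) (hX : Continuous X) (hY : Continuous Y) {t₀ : T}
    (h : ∀ p ∈ SIdx lam r k, SDenomNZ br δ (K t₀) lam p.1 p.2 (X t₀) (Y t₀)) :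
    ContinuousAt (fun t => Ssum br δ (K t) lam r k (X t) (Y t)) t₀ :=
  tendsto_finsetSum _ fun p hp => continuousAt_Sterm hbr hK hX hY (h p hp)

end continuity

/-- Moving the points in independent imaginary directions and `κ` in a real direction is generic. -/
lemma IsBracket_s7.dense_latticeGeneric {br : ℂ → ℂ} (h : IsBracket_s7 br) {δ : ℂ}
    (hδ : ∀ n : ℕ, 1 ≤ n → br (n * δ) ≠ 0) (κ : ℂ) {τ : Type*} [Countable τ] (W : τ → ℂ)
    {w : τ → ℕ} (hw : Function.Injective w) :
    Dense {t : ℂ | LatticeGeneric br δ (κ + t) fun p => W p + w p * Complex.I * t} := by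
  let α : {q : τ × τ × ℤ × ℤ // q.1 ≠ q.2.1} ⊕ {q : ℤ × ℤ // q.2 ≠ 0} → ℂ :=
    Sum.elim (fun q => W q.1.1 - W q.1.2.1 + q.1.2.2.1 * δ + q.1.2.2.2 * κ)
      fun q => q.1.1 * δ + q.1.2 * κ
  let β : {q : τ × τ × ℤ × ℤ // q.1 ≠ q.2.1} ⊕ {q : ℤ × ℤ // q.2 ≠ 0} → ℂ :=
    Sum.elim (fun q => (w q.1.1 - w q.1.2.1) * Complex.I + q.1.2.2.2) fun q => q.1.2
  have hβ : ∀ q, β q ≠ 0 := by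
    rintro (⟨⟨p, q, c, d⟩, hpq⟩ | ⟨⟨c, d⟩, hd⟩) he
    · have := congrArg Complex.im he
      simp only [β, Sum.elim_inl, Complex.add_im, Complex.mul_im, Complex.I_im, Complex.I_re,
        Complex.sub_re, Complex.natCast_re, Complex.intCast_im, Complex.zero_im] at this
      exact hpq (hw (by exact_mod_cast (by linarith : (w p : ℝ) = w q)))
    · exact hd (by simpa [β] using he)
  refine (h.dense_affine_ne_zero α β hβ).mono fun t ht => ⟨fun p q hpq c d => ?_, fun c d hcd => ?_⟩
  · convert ht (.inl ⟨(p, q, c, d), hpq⟩) using 2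
    simp only [α, β, Sum.elim_inl]
    ring
  · rcases eq_or_ne d 0 with rfl | hd
    · have hc : c ≠ 0 := by simpa using hcd
      rw [Int.cast_zero, zero_mul, add_zero]
      rcases Int.natAbs_eq c with e | e <;> rw [e]
      · simpa using hδ c.natAbs (by omega)
      · have := hδ c.natAbs (by omega)
        push_cast
        rw [neg_mul, h.odd]
        simpa using this
    · convert ht (.inr ⟨(c, d), hd⟩) using 2
      simp only [α, β, Sum.elim_inr]
      ring

/-- Source identity for commutativity: `S_k = S_{|λ|+r-k}`
at every admissible point. -/
theorem Ssum_symm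
    (br : ℂ → ℂ) (hodd : ∀ z : ℂ, br (-z) = -br z)
    (hent : Differentiable ℂ br) (hnz : br ≠ 0)
    (hW : ∀ a b c d : ℂ,
      br (a + b) * br (a - b) * br (c + d) * br (c - d)
        + br (a + d) * br (a - d) * br (b + c) * br (b - c)
        = br (a + c) * br (a - c) * br (b + d) * br (b - d))
    (δ κ : ℂ)
    (hδ : ∀ n : ℕ, 1 ≤ n → br ((n : ℂ) * δ) ≠ 0)
    (hκ : ∀ n : ℕ, 1 ≤ n → br ((n : ℂ) * κ) ≠ 0)
    (m r : ℕ) (lam : Fin m → ℕ) (k : ℕ) (hk : k ≤ (∑ i, lam i) + r)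
    (x : Fin m → ℂ) (y : Fin r → ℂ)
    (h1 : ∀ p ∈ SIdx lam r k, SDenomNZ br δ κ lam p.1 p.2 x y)
    (h2 : ∀ p ∈ SIdx lam r ((∑ i, lam i) + r - k), SDenomNZ br δ κ lam p.1 p.2 x y) :
    Ssum br δ κ lam r k x y = Ssum br δ κ lam r ((∑ i, lam i) + r - k) x y := by
  have h : IsBracket_s7 br := ⟨hodd, hent, hnz, hW⟩
  let w : Fin m ⊕ Fin r → ℕ := fun p => (finSumFinEquiv p : ℕ)
  have hw : Function.Injective w := Fin.val_injective.comp finSumFinEquiv.injective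
  let K : ℂ → ℂ := fun t => κ + t
  let X : ℂ → Fin m → ℂ := fun t i => x i + w (.inl i) * Complex.I * t
  let Y : ℂ → Fin r → ℂ := fun t j => y j + w (.inr j) * Complex.I * t
  have hX0 : X 0 = x := by simp [X]
  have hY0 : Y 0 = y := by simp [Y]
  have hK0 : K 0 = κ := by simp [K]
  have hc : ∀ n, (∀ p ∈ SIdx lam r n, SDenomNZ br δ κ lam p.1 p.2 x y) →
      ContinuousAt (fun t => Ssum br δ (K t) lam r n (X t) (Y t)) 0 := fun n hn =>
    continuousAt_Ssum h.continuous (by fun_prop) (by fun_prop) (by fun_prop)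
      (by rwa [hX0, hY0, hK0])
  obtain ⟨G, hG, hsymm⟩ : ∃ G : Set ℂ, Dense G ∧ ∀ t ∈ G, Ssum br δ (K t) lam r k (X t) (Y t)
      = Ssum br δ (K t) lam r ((∑ i, lam i) + r - k) (X t) (Y t) := by
    refine ⟨_, h.dense_latticeGeneric hδ κ (Sum.elim x y) hw, fun t ht => ?_⟩
    refine Ssum_symm_of_latticeGeneric h ?_ hk
    convert ht.out using 1
    funext p
    rcases p with i | j <;> rfl
  have := mem_closure_iff_nhdsWithin_neBot.mp (hG 0)
  have hlim := tendsto_nhds_unique_of_eventuallyEq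
    ((hc _ h1).mono_left (nhdsWithin_le_nhds (s := G)))
    ((hc _ h2).mono_left nhdsWithin_le_nhds) (eventually_mem_nhdsWithin.mono hsymm)
  simpa only [hX0, hY0, hK0] using hlim
end
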